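/- arXiv:1309.0232 — 5 statements merged into one kernel-verified Lean document; each statement's English description precedes it below -/
import Mathlib

section
/- Let z ∈ ℂ, x ∈ H, and let (φ_n) be a bounded sequence of vectors with φ_n ∈ L_n such that max over normalised v ∈ L_n of |(s − z)(φ_n, v) − ⟨x, v⟩| tends to 0 as n → ∞. Then there exist u ∈ H and a subsequence (n_k) such that ‖Aφ_{n_k} − u‖ → 0. Moreover, if the singleton {z} is a T_n-regular set, then ‖φ_{n_k} − (T − z)^{-1}(x − u)‖_t → 0. -/
open scoped ComplexInnerProductSpace
open Filter

noncomputable section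

variable {H : Type*} [NormedAddCommGroup H] [InnerProductSpace ℂ H] [CompleteSpace H]

/-- The resolvent set of a (possibly unbounded) operator given as a `LinearPMap`. -/
def pmResolventSet (T : H →ₗ.[ℂ] H) : Set ℂ :=
  {z | ∃ R : H →L[ℂ] H, (∀ y : H, ∃ hy : R y ∈ T.domain, T ⟨R y, hy⟩ - z • R y = y) ∧
        ∀ x : T.domain, R (T x - z • (x : H)) = x}

/-- The spectrum of a (possibly unbounded) operator given as a `LinearPMap`. -/
def pmSpectrum (T : H →ₗ.[ℂ] H) : Set ℂ := (pmResolventSet T)ᶜ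

/-- A self-adjoint operator with `T - z` bounded below has `T - z` surjective. -/
theorem aux_surj (T : H →ₗ.[ℂ] H) (hsa : IsSelfAdjoint T) (z : ℂ) (δ : ℝ) (hδ : 0 < δ)
    (hb : ∀ ψ : T.domain, δ * ‖(ψ : H)‖ ≤ ‖T ψ - z • (ψ : H)‖) (y : H) :
    ∃ w : T.domain, T w - z • (w : H) = y := by
  have hd := hsa.dense_domain
  have hadj : T.adjoint = T := hsa
  have hsym : ∀ a b : T.domain, (⟪T a, (b : H)⟫ : ℂ) = ⟪(a : H), T b⟫ := by
    have h := LinearPMap.adjoint_isFormalAdjoint hd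
    rw [hadj] at h
    exact h
  have hmem : ∀ a w : H, (∀ b : T.domain, (⟪w, (b : H)⟫ : ℂ) = ⟪a, T b⟫) →
      ∃ ha : a ∈ T.domain, T ⟨a, ha⟩ = w := by
    intro a w h
    have h1 : a ∈ T.adjoint.domain := LinearPMap.mem_adjoint_domain_of_exists a ⟨w, h⟩
    have h2 : T.adjoint ⟨a, h1⟩ = w := LinearPMap.adjoint_apply_eq hd ⟨a, h1⟩ h
    have h3 : (a, w) ∈ T.adjoint.graph := by
      rw [LinearPMap.mem_graph_iff]
      exact ⟨⟨a, h1⟩, rfl, h2⟩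
    rw [hadj, LinearPMap.mem_graph_iff] at h3
    obtain ⟨⟨a', ha'⟩, h4, h5⟩ := h3
    simp only at h4 h5
    subst h4
    exact ⟨ha', h5⟩
  let M : T.domain →ₗ[ℂ] H := T.toFun - z • T.domain.subtype
  have hM : ∀ a : T.domain, M a = T a - z • (a : H) := fun a => rfl
  let K := LinearMap.range M
  have hclosed : IsClosed (K : Set H) := by
    rw [← isSeqClosed_iff_isClosed]
    intro f p hf hp
    choose a ha using hf
    have hc : CauchySeq (fun n => (a n : H)) := by
      have hfc := hp.cauchySeq
      rw [Metric.cauchySeq_iff] at hfc ⊢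
      intro e he
      obtain ⟨N, hN⟩ := hfc (δ * e) (by positivity)
      refine ⟨N, fun i hi j hj => ?_⟩
      have h1 := hN i hi j hj
      rw [dist_eq_norm, ← ha, ← ha, ← map_sub, hM] at h1
      have h2 := hb (a i - a j)
      rw [dist_eq_norm]
      have h3 : δ * ‖(a i : H) - a j‖ < δ * e := by
        simpa using lt_of_le_of_lt h2 h1
      exact lt_of_mul_lt_mul_left h3 hδ.le
    obtain ⟨w, hw⟩ := cauchySeq_tendsto_of_complete hc
    have hTa : Tendsto (fun n => T (a n)) atTop (nhds (p + z • w)) := by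
      have : (fun n => T (a n)) = fun n => f n + z • (a n : H) := by
        funext n
        rw [← ha n, hM]; abel
      rw [this]
      exact hp.add (hw.const_smul z)
    obtain ⟨hwd, hTw⟩ := hmem w (p + z • w) (by
      intro b
      have h1 : Tendsto (fun n => (⟪T (a n), (b : H)⟫ : ℂ)) atTop (nhds ⟪p + z • w, (b : H)⟫) :=
        hTa.inner tendsto_const_nhds
      have h2 : Tendsto (fun n => (⟪(a n : H), T b⟫ : ℂ)) atTop (nhds ⟪w, T b⟫) :=
        hw.inner tendsto_const_nhds
      simp only [hsym] at h1
      exact tendsto_nhds_unique h1 h2)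
    refine ⟨⟨w, hwd⟩, ?_⟩
    rw [hM, hTw]
    simp
  have hnorm : ∀ a : T.domain, ‖T a - (starRingEnd ℂ z) • (a : H)‖ = ‖T a - z • (a : H)‖ := by
    intro a
    have h0 : ∀ c : ℂ, (⟪T a - c • (a : H), T a - c • (a : H)⟫ : ℂ) =
        ⟪T a, T a⟫ - c * ⟪(a : H), T a⟫ - (starRingEnd ℂ c) * ⟪(a : H), T a⟫
          + c * (starRingEnd ℂ c) * ⟪(a : H), a⟫ := by
      intro c
      simp only [inner_sub_left, inner_sub_right, inner_smul_left, inner_smul_right, hsym]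
      ring
    have h1 : (⟪T a - (starRingEnd ℂ z) • (a : H), T a - (starRingEnd ℂ z) • (a : H)⟫ : ℂ) =
        ⟪T a - z • (a : H), T a - z • (a : H)⟫ := by
      rw [h0, h0]
      simp only [Complex.conj_conj]
      ring
    rw [@norm_eq_sqrt_re_inner ℂ, h1, ← @norm_eq_sqrt_re_inner ℂ]
  have : CompleteSpace K := hclosed.completeSpace_coe
  have hbot : Kᗮ = ⊥ := by
    rw [Submodule.eq_bot_iff]
    intro f hf
    rw [Submodule.mem_orthogonal'] at hf
    obtain ⟨hfd, hTf⟩ := hmem f ((starRingEnd ℂ z) • f) (by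
      intro b
      have := hf (M b) ⟨b, rfl⟩
      rw [hM, inner_sub_right, inner_smul_right] at this
      rw [inner_smul_left, Complex.conj_conj]
      linear_combination -this)
    have h1 := hb ⟨f, hfd⟩
    rw [← hnorm, hTf] at h1
    simp only [sub_self, norm_zero] at h1
    have : ‖f‖ ≤ 0 := by
      by_contra h
      push Not at h
      have := mul_pos hδ h
      linarith
    simpa using this
  have htop := (Submodule.orthogonal_eq_bot_iff).1 hbot
  have : y ∈ K := by rw [htop]; trivial
  exact this

/-- Abstract form facts. -/
theorem aux_form (m : ℝ)
    (dt : Submodule ℂ H) (t : H →ₗ[ℂ] H →ₗ⋆[ℂ] ℂ)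
    (therm : ∀ φ ∈ dt, ∀ ψ ∈ dt, t ψ φ = starRingEnd ℂ (t φ ψ))
    (tnormSq : H → ℝ)
    (htn : ∀ φ, tnormSq φ = (t φ φ).re - m * ‖φ‖ ^ 2 + ‖φ‖ ^ 2)
    (a b : H) (ha : a ∈ dt) (hb : b ∈ dt) :
    tnormSq (a + b) = tnormSq a + tnormSq b + 2 * (t a b - (m - 1) * ⟪b, a⟫).re := by
  have h1 := @norm_add_sq ℂ H _ _ _ a b
  have h2 : RCLike.re (⟪a, b⟫ : ℂ) = (⟪b, a⟫ : ℂ).re := by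
    rw [← inner_conj_symm]; exact Complex.conj_re _
  rw [h2] at h1
  rw [htn, htn, htn, h1]
  simp only [map_add, LinearMap.add_apply, therm a ha b hb, Complex.add_re, Complex.conj_re,
    Complex.sub_re, Complex.mul_re, Complex.ofReal_re, Complex.ofReal_im, Complex.one_re,
    Complex.one_im, Complex.sub_im]
  ring

/-- Galerkin projection of `w ∈ Dom T`. -/
theorem aux_proj (T : H →ₗ.[ℂ] H) (m : ℝ)
    (dt : Submodule ℂ H) (t : H →ₗ[ℂ] H →ₗ⋆[ℂ] ℂ)
    (hdomt : T.domain ≤ dt)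
    (therm : ∀ φ ∈ dt, ∀ ψ ∈ dt, t ψ φ = starRingEnd ℂ (t φ ψ))
    (hcomp : ∀ φ : T.domain, ∀ ψ ∈ dt, t φ ψ = ⟪ψ, T φ⟫)
    (hlb : ∀ φ ∈ dt, m * ‖φ‖ ^ 2 ≤ (t φ φ).re)
    (tnormSq : H → ℝ)
    (htn : ∀ φ, tnormSq φ = (t φ φ).re - m * ‖φ‖ ^ 2 + ‖φ‖ ^ 2)
    (L : ℕ → Submodule ℂ H) (hL : ∀ n, L n ≤ dt)
    [∀ n, FiniteDimensional ℂ (L n)]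
    (hLdense : ∀ φ ∈ dt, ∃ u : ℕ → H, (∀ n, u n ∈ L n) ∧
      Tendsto (fun n => tnormSq (φ - u n)) atTop (nhds 0))
    (Tn : ∀ n, L n →ₗ[ℂ] L n)
    (hTn : ∀ n, ∀ φ ψ : L n, (⟪ψ, Tn n φ⟫ : ℂ) = t (φ : H) (ψ : H))
    (w : T.domain) :
    ∃ ψ : ∀ n, L n, (∀ n, ∀ v ∈ L n, t ((w : H) - ψ n) v = (m - 1) * ⟪v, (w : H) - ψ n⟫) ∧
      Tendsto (fun n => tnormSq ((w : H) - ψ n)) atTop (nhds 0) := by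
  have hwd : (w : H) ∈ dt := hdomt w.2
  have hnn : ∀ a ∈ dt, ‖a‖ ^ 2 ≤ tnormSq a := by
    intro a ha
    rw [htn]; linarith [hlb a ha]
  have hex : ∀ n, ∃ ψ : L n, ∀ v ∈ L n,
      t ((w : H) - ψ) v = (m - 1) * ⟪v, (w : H) - ψ⟫ := by
    intro n
    let S : L n →ₗ[ℂ] L n := Tn n - ((m : ℂ) - 1) • LinearMap.id
    have hS : ∀ a v : L n, (⟪v, S a⟫ : ℂ) = t a v - (m - 1) * ⟪(v : H), a⟫ := by
      intro a v
      simp only [S, LinearMap.sub_apply, LinearMap.smul_apply, LinearMap.id_apply,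
        inner_sub_right, inner_smul_right, hTn, Submodule.coe_inner]
    have hinj : Function.Injective S := by
      rw [← LinearMap.ker_eq_bot, LinearMap.ker_eq_bot']
      intro a ha
      have h1 := hS a a
      rw [ha, inner_zero_right] at h1
      have h2 := congrArg Complex.re h1
      have h3 : (⟪(a : H), (a : H)⟫ : ℂ) = ((‖(a : H)‖ ^ 2 : ℝ) : ℂ) := by
        rw [inner_self_eq_norm_sq_to_K]; simp
      rw [h3] at h2
      have h4 : ((m : ℂ) - 1) = ((m - 1 : ℝ) : ℂ) := by push_cast; rfl
      rw [h4, ← Complex.ofReal_mul, Complex.sub_re, Complex.ofReal_re, Complex.zero_re] at h2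
      have h5 := hlb a (hL n a.2)
      have h6 : ‖(a : H)‖ ^ 2 ≤ 0 := by nlinarith
      have h7 : ‖(a : H)‖ = 0 := by
        have := sq_nonneg ‖(a : H)‖
        exact pow_eq_zero_iff (two_ne_zero) |>.1 (le_antisymm h6 this)
      exact Subtype.ext (norm_eq_zero.1 h7)
    have hsurj := LinearMap.injective_iff_surjective.1 hinj
    obtain ⟨ψ, hψ⟩ := hsurj ((L n).orthogonalProjectionOnto (T w - ((m : ℂ) - 1) • (w : H)))
    refine ⟨ψ, fun v hv => ?_⟩
    have h1 := hS ψ ⟨v, hv⟩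
    rw [hψ, Submodule.inner_orthogonalProjectionOnto_eq_of_mem_left] at h1
    simp only [inner_sub_right, inner_smul_right] at h1
    rw [map_sub, LinearMap.sub_apply, hcomp w v (hL n hv), inner_sub_right]
    linear_combination h1
  choose ψ hψ using hex
  refine ⟨ψ, hψ, ?_⟩
  obtain ⟨u, hu, hut⟩ := hLdense w hwd
  refine squeeze_zero (fun n => ?_) (fun n => ?_) hut
  · exact (sq_nonneg _).trans (hnn _ (dt.sub_mem hwd (hL n (ψ n).2)))
  · have hmemb : (ψ n : H) - u n ∈ L n := (L n).sub_mem (ψ n).2 (hu n)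
    have h1 := aux_form m dt t therm tnormSq htn ((w : H) - ψ n) ((ψ n : H) - u n)
      (dt.sub_mem hwd (hL n (ψ n).2)) (hL n hmemb)
    rw [hψ n _ hmemb, sub_self, Complex.zero_re] at h1
    have h2 := (sq_nonneg _).trans (hnn _ (hL n hmemb))
    have h3 : (w : H) - ψ n + (ψ n - u n) = w - u n := by abel
    rw [h3] at h1
    linarith

/-- Duality estimate. -/
theorem aux_dual {E : Type*} [NormedAddCommGroup E] [InnerProductSpace ℂ E] (a : E) (C : ℝ)
    (h : ∀ v : E, ‖(⟪v, a⟫ : ℂ)‖ ≤ C * ‖v‖) (hC : 0 ≤ C) : ‖a‖ ≤ C := by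
  have h1 := h a
  rw [inner_self_eq_norm_sq_to_K] at h1
  simp at h1
  by_cases ha : ‖a‖ = 0
  · rw [ha]; exact hC
  · have : 0 < ‖a‖ := lt_of_le_of_ne (norm_nonneg _) (Ne.symm ha)
    nlinarith

/-- **Lemma on relatively compact perturbations (Lemma 2.2).** -/
theorem stmt_1
    -- `T` is a semi-bounded self-adjoint operator with `m = min σ(T)`
    (T : H →ₗ.[ℂ] H) (hsa : IsSelfAdjoint T)
    (m : ℝ) (hm : IsLeast {x : ℝ | (x : ℂ) ∈ pmSpectrum T} m)
    -- `t` is the closed sesquilinear form associated to `T`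
    (dt : Submodule ℂ H) (t : H →ₗ[ℂ] H →ₗ⋆[ℂ] ℂ)
    (hdomt : T.domain ≤ dt)
    (therm : ∀ φ ∈ dt, ∀ ψ ∈ dt, t ψ φ = starRingEnd ℂ (t φ ψ))
    (hcomp : ∀ φ : T.domain, ∀ ψ ∈ dt, t φ ψ = ⟪ψ, T φ⟫)
    (hlb : ∀ φ ∈ dt, m * ‖φ‖ ^ 2 ≤ (t φ φ).re)
    (tnormSq : H → ℝ)
    (htn : ∀ φ, tnormSq φ = (t φ φ).re - m * ‖φ‖ ^ 2 + ‖φ‖ ^ 2)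
    (hclosed : ∀ u : ℕ → H, (∀ k, u k ∈ dt) →
      (∀ ε > 0, ∃ N, ∀ j ≥ N, ∀ k ≥ N, tnormSq (u j - u k) < ε) →
      ∃ φ ∈ dt, Tendsto (fun k => tnormSq (u k - φ)) atTop (nhds 0))
    -- `A` is a closed `|T|^(1/2)`-compact operator defined (at least) on `Dom t`
    (A : H →ₗ.[ℂ] H) (hdomA : dt ≤ A.domain)
    (hAclosed : IsClosed (A.graph : Set (H × H)))
    (hAcpt : ∀ (u : ℕ → H) (hu : ∀ k, u k ∈ dt), (∃ C, ∀ k, tnormSq (u k) ≤ C) →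
      ∃ (g : ℕ → ℕ) (v : H), StrictMono g ∧
        Tendsto (fun k => A ⟨u (g k), hdomA (hu (g k))⟩) atTop (nhds v))
    -- `(T+A)* = T + A*`
    (hTAadj : (T + A).adjoint = T + A.adjoint)
    -- the relative form bound `|⟨Aφ,φ⟩| ≤ α t[φ] + β ‖φ‖²`
    (α β : ℝ) (hα0 : 0 ≤ α) (hα1 : α < 1) (hβ : 0 ≤ β)
    (hbound : ∀ φ (hφ : φ ∈ dt), ‖(⟪φ, A ⟨φ, hdomA hφ⟩⟫ : ℂ)‖ ≤ α * (t φ φ).re + β * ‖φ‖ ^ 2)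
    -- trial spaces
    (L : ℕ → Submodule ℂ H) (hL : ∀ n, L n ≤ dt)
    [∀ n, FiniteDimensional ℂ (L n)]
    (hLdense : ∀ φ ∈ dt, ∃ u : ℕ → H, (∀ n, u n ∈ L n) ∧
      Tendsto (fun n => tnormSq (φ - u n)) atTop (nhds 0))
    -- compressions of the form `t`
    (Tn : ∀ n, L n →ₗ[ℂ] L n)
    (hTn : ∀ n, ∀ φ ψ : L n, (⟪ψ, Tn n φ⟫ : ℂ) = t (φ : H) (ψ : H))
    -- a bounded sequence `φ n ∈ L n`
    (z : ℂ) (x : H) (φ : ℕ → H) (hφ : ∀ n, φ n ∈ L n)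
    (hφbdd : ∃ C, ∀ n, ‖φ n‖ ≤ C)
    -- `max_{v ∈ L n, ‖v‖=1} |(s - z)(φ n, v) - ⟨x, v⟩| → 0`
    (ε : ℕ → ℝ) (hε : Tendsto ε atTop (nhds 0))
    (hconv : ∀ n, ∀ v ∈ L n, ‖v‖ = 1 →
      ‖t (φ n) v + ⟪v, A ⟨φ n, hdomA (hL n (hφ n))⟩⟫ - z * ⟪v, φ n⟫ - ⟪v, x⟫‖ ≤ ε n) :
    ∃ (u : H) (g : ℕ → ℕ), StrictMono g ∧
      Tendsto (fun k => A ⟨φ (g k), hdomA (hL (g k) (hφ (g k)))⟩) atTop (nhds u) ∧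
      ((∃ δ > 0, ∃ N : ℕ, ∀ n ≥ N, ∀ ψ : L n, δ * ‖ψ‖ ≤ ‖Tn n ψ - z • ψ‖) →
        ∃ (w : H) (hw : w ∈ T.domain), T ⟨w, hw⟩ - z • w = x - u ∧
          Tendsto (fun k => tnormSq (φ (g k) - w)) atTop (nhds 0)) := by
  have hnn : ∀ a ∈ dt, ‖a‖ ^ 2 ≤ tnormSq a := by
    intro a ha
    rw [htn]; linarith [hlb a ha]
  have hφd : ∀ n, φ n ∈ dt := fun n => hL n (hφ n)
  obtain ⟨C, hC⟩ := hφbdd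
  have hC0 : 0 ≤ C := (norm_nonneg _).trans (hC 0)
  -- homogeneous version of `hconv`
  have hconv' : ∀ n, ∀ v ∈ L n,
      ‖t (φ n) v + ⟪v, A ⟨φ n, hdomA (hL n (hφ n))⟩⟫ - z * ⟪v, φ n⟫ - ⟪v, x⟫‖ ≤ |ε n| * ‖v‖ := by
    intro n v hv
    by_cases h0 : v = 0
    · subst h0; simp
    have hpos : 0 < ‖v‖ := norm_pos_iff.2 h0
    let c : ℂ := ((‖v‖⁻¹ : ℝ) : ℂ)
    have hcn : ‖c‖ = ‖v‖⁻¹ := by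
      simp only [c, Complex.norm_real, norm_inv, norm_norm]
    have h1 := hconv n (c • v) ((L n).smul_mem c hv) (by
      rw [norm_smul, hcn, inv_mul_cancel₀ hpos.ne'])
    simp only [LinearMap.map_smulₛₗ, inner_smul_left, smul_eq_mul] at h1
    have h2 : (starRingEnd ℂ) c * (t (φ n)) v
        + (starRingEnd ℂ) c * ⟪v, A ⟨φ n, hdomA (hL n (hφ n))⟩⟫
        - z * ((starRingEnd ℂ) c * ⟪v, φ n⟫) - (starRingEnd ℂ) c * ⟪v, x⟫
        = (starRingEnd ℂ) c * (t (φ n) v + ⟪v, A ⟨φ n, hdomA (hL n (hφ n))⟩⟫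
          - z * ⟪v, φ n⟫ - ⟪v, x⟫) := by ring
    rw [h2, norm_mul, RCLike.norm_conj, hcn] at h1
    have h3 := h1.trans (le_abs_self _)
    rw [inv_mul_le_iff₀ hpos] at h3
    linarith
  -- boundedness in the form norm
  obtain ⟨B, hB⟩ : ∃ B, ∀ n, |ε n| ≤ B := by
    obtain ⟨B, hB⟩ := (Metric.isBounded_range_of_tendsto ε hε).exists_norm_le
    exact ⟨B, fun n => by simpa using hB (ε n) ⟨n, rfl⟩⟩
  have hB0 : 0 ≤ B := (abs_nonneg _).trans (hB 0)
  have hbd : ∀ n, (1 - α) * (t (φ n) (φ n)).re ≤ β * C ^ 2 + ‖z‖ * C ^ 2 + C * ‖x‖ + B * C := by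
    intro n
    have h1 := hconv' n (φ n) (hφ n)
    have h2 := hbound (φ n) (hφd n)
    have h3 : ‖(⟪φ n, x⟫ : ℂ)‖ ≤ ‖φ n‖ * ‖x‖ := norm_inner_le_norm _ _
    have h4 : ‖z * (⟪φ n, φ n⟫ : ℂ)‖ ≤ ‖z‖ * ‖φ n‖ ^ 2 := by
      rw [norm_mul, sq]
      gcongr
      exact norm_inner_le_norm _ _
    have h5 := (Complex.abs_re_le_norm _).trans h1
    have h6 := (abs_le.1 h5).2
    simp only [Complex.add_re, Complex.sub_re] at h6
    have h7 := (abs_le.1 ((Complex.abs_re_le_norm _).trans h2)).1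
    have h8 := (abs_le.1 ((Complex.abs_re_le_norm _).trans h3)).2
    have h9 := (abs_le.1 ((Complex.abs_re_le_norm _).trans h4)).2
    have hCn := hC n
    have hn0 := norm_nonneg (φ n)
    have e1 : ‖φ n‖ ^ 2 ≤ C ^ 2 := by gcongr
    have e2 : |ε n| * ‖φ n‖ ≤ B * C := by
      have := hB n
      gcongr
    have e3 : ‖φ n‖ * ‖x‖ ≤ C * ‖x‖ := by gcongr
    have e4 : ‖z‖ * ‖φ n‖ ^ 2 ≤ ‖z‖ * C ^ 2 := by gcongr
    have e5 : β * ‖φ n‖ ^ 2 ≤ β * C ^ 2 := by gcongr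
    linarith
  have h1α : 0 < 1 - α := by linarith
  obtain ⟨g, u, hg, hu⟩ := hAcpt φ hφd
    ⟨(β * C ^ 2 + ‖z‖ * C ^ 2 + C * ‖x‖ + B * C) / (1 - α) + (|m| + 1) * C ^ 2, fun n => by
      have h1 := hbd n
      rw [mul_comm, ← le_div_iff₀ h1α] at h1
      have hCn := hC n
      have hn0 := norm_nonneg (φ n)
      have e1 : ‖φ n‖ ^ 2 ≤ C ^ 2 := by gcongr
      have e2 : (|m| + 1) * ‖φ n‖ ^ 2 ≤ (|m| + 1) * C ^ 2 := by gcongr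
      have e3 : -m * ‖φ n‖ ^ 2 ≤ |m| * ‖φ n‖ ^ 2 := by
        gcongr; exact neg_le_abs m
      rw [htn]
      linarith⟩
  refine ⟨u, g, hg, hu, ?_⟩
  rintro ⟨δ, hδ, N, hreg⟩
  -- form-norm convergence gives norm convergence
  have hnormlim : ∀ a : ℕ → H, (∀ n, a n ∈ dt) →
      Tendsto (fun n => tnormSq (a n)) atTop (nhds 0) →
      Tendsto (fun n => ‖a n‖) atTop (nhds 0) := by
    intro a ha h
    have h1 : Tendsto (fun n => ‖a n‖ ^ 2) atTop (nhds 0) :=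
      squeeze_zero (fun n => sq_nonneg _) (fun n => hnn _ (ha n)) h
    have h2 := h1.sqrt
    simpa using h2
  have hTnz : ∀ n, ∀ e v : L n,
      (⟪v, Tn n e - z • e⟫ : ℂ) = t (e : H) (v : H) - z * ⟪(v : H), (e : H)⟫ := by
    intro n e v
    rw [inner_sub_right, inner_smul_right, hTn, Submodule.coe_inner]
  -- the bound below for `T - z`
  have hbelow : ∀ ψ : T.domain, δ * ‖(ψ : H)‖ ≤ ‖T ψ - z • (ψ : H)‖ := by
    intro w
    obtain ⟨ψ, hψ, hψt⟩ := aux_proj T m dt t hdomt therm hcomp hlb tnormSq htn L hL hLdense Tn hTn w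
    have hd : ∀ n, (w : H) - ψ n ∈ dt := fun n => dt.sub_mem (hdomt w.2) (hL n (ψ n).2)
    have hlim := hnormlim _ hd hψt
    have hlimψ : Tendsto (fun n => (ψ n : H)) atTop (nhds (w : H)) := by
      rw [tendsto_iff_norm_sub_tendsto_zero]
      simpa only [norm_sub_rev] using hlim
    have hest : ∀ n ≥ N, δ * ‖(ψ n : H)‖ ≤
        ‖T w - z • (w : H)‖ + ‖(m : ℂ) - 1 - z‖ * ‖(w : H) - ψ n‖ := by
      intro n hn
      refine (hreg n hn (ψ n)).trans (aux_dual _ _ (fun v => ?_) (by positivity))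
      have h1 : (⟪v, Tn n (ψ n) - z • ψ n⟫ : ℂ) = ⟪(v : H), T w - z • (w : H)⟫
          - ((m : ℂ) - 1 - z) * ⟪(v : H), (w : H) - ψ n⟫ := by
        have h2 := hψ n v v.2
        rw [map_sub, LinearMap.sub_apply, hcomp w v (hL n v.2)] at h2
        rw [hTnz]
        simp only [inner_sub_right, inner_smul_right] at h2 ⊢
        linear_combination -h2
      rw [h1]
      refine (norm_sub_le _ _).trans ?_
      rw [norm_mul]
      have h3 : ‖(⟪(v : H), T w - z • (w : H)⟫ : ℂ)‖ ≤ ‖(v : H)‖ * ‖T w - z • (w : H)‖ :=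
        norm_inner_le_norm _ _
      have h4 : ‖(m : ℂ) - 1 - z‖ * ‖(⟪(v : H), (w : H) - ψ n⟫ : ℂ)‖
          ≤ ‖(m : ℂ) - 1 - z‖ * (‖(v : H)‖ * ‖(w : H) - ψ n‖) := by
        gcongr
        exact norm_inner_le_norm _ _
      have h5 : ‖v‖ = ‖(v : H)‖ := rfl
      rw [h5]
      linarith
    have hl1 : Tendsto (fun n => δ * ‖(ψ n : H)‖) atTop (nhds (δ * ‖(w : H)‖)) :=
      hlimψ.norm.const_mul δ
    have hl2 : Tendsto (fun n => ‖T w - z • (w : H)‖ + ‖(m : ℂ) - 1 - z‖ * ‖(w : H) - ψ n‖)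
        atTop (nhds (‖T w - z • (w : H)‖ + ‖(m : ℂ) - 1 - z‖ * 0)) :=
      (hlim.const_mul _).const_add _
    rw [mul_zero, add_zero] at hl2
    exact le_of_tendsto_of_tendsto hl1 hl2 (eventually_atTop.2 ⟨N, hest⟩)
  obtain ⟨w, hw⟩ := aux_surj T hsa z δ hδ hbelow (x - u)
  refine ⟨w, w.2, hw, ?_⟩
  obtain ⟨ψ, hψ, hψt⟩ := aux_proj T m dt t hdomt therm hcomp hlb tnormSq htn L hL hLdense Tn hTn w
  have hd : ∀ n, (w : H) - ψ n ∈ dt := fun n => dt.sub_mem (hdomt w.2) (hL n (ψ n).2)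
  have hlim := hnormlim _ hd hψt
  have hgt := hg.tendsto_atTop
  let η : ℕ → ℝ := fun k => |ε (g k)| + ‖u - A ⟨φ (g k), hdomA (hL (g k) (hφ (g k)))⟩‖
    + ‖(m : ℂ) - 1 - z‖ * ‖(w : H) - ψ (g k)‖
  have hη0 : ∀ k, 0 ≤ η k := fun k => by positivity
  have hηlim : Tendsto η atTop (nhds 0) := by
    have h1 : Tendsto (fun k => |ε (g k)|) atTop (nhds 0) := by
      simpa using (hε.comp hgt).abs
    have h2 : Tendsto (fun k => ‖u - A ⟨φ (g k), hdomA (hL (g k) (hφ (g k)))⟩‖) atTop (nhds 0) := by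
      simpa using (hu.const_sub u).norm
    have h3 := (hlim.comp hgt).const_mul ‖(m : ℂ) - 1 - z‖
    have h4 := (h1.add h2).add h3
    simp only [mul_zero, add_zero] at h4
    exact h4
  let e : ∀ k, L (g k) := fun k => ⟨φ (g k), hφ (g k)⟩ - ψ (g k)
  have hecoe : ∀ k, (e k : H) = φ (g k) - ψ (g k) := fun k => rfl
  have hdual : ∀ k, ∀ v ∈ L (g k),
      ‖t (e k : H) v - z * ⟪v, (e k : H)⟫‖ ≤ η k * ‖v‖ := by
    intro k v hv
    have h0 := hψ (g k) v hv
    have h0' : t (w : H) v = ⟪v, x - u⟫ + z * ⟪v, (w : H)⟫ := by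
      rw [hcomp w v (hL _ hv), ← hw, inner_sub_right, inner_smul_right]; ring
    have h1 : t (e k : H) v - z * ⟪v, (e k : H)⟫ =
        (t (φ (g k)) v + ⟪v, A ⟨φ (g k), hdomA (hL (g k) (hφ (g k)))⟩⟫ - z * ⟪v, φ (g k)⟫ - ⟪v, x⟫)
        + ⟪v, u - A ⟨φ (g k), hdomA (hL (g k) (hφ (g k)))⟩⟫
        + ((m : ℂ) - 1 - z) * ⟪v, (w : H) - ψ (g k)⟫ := by
      rw [map_sub, LinearMap.sub_apply, h0'] at h0
      rw [hecoe, map_sub, LinearMap.sub_apply]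
      simp only [inner_sub_right] at h0 ⊢
      linear_combination h0
    rw [h1]
    refine (norm_add₃_le).trans ?_
    have h2 := hconv' (g k) v hv
    have h3 : ‖(⟪v, u - A ⟨φ (g k), hdomA (hL (g k) (hφ (g k)))⟩⟫ : ℂ)‖
      ≤ ‖v‖ * ‖u - A ⟨φ (g k), hdomA (hL (g k) (hφ (g k)))⟩‖ := norm_inner_le_norm _ _
    have h4 : ‖((m : ℂ) - 1 - z) * ⟪v, (w : H) - ψ (g k)⟫‖
        ≤ ‖(m : ℂ) - 1 - z‖ * (‖v‖ * ‖(w : H) - ψ (g k)‖) := by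
      rw [norm_mul]
      gcongr
      exact norm_inner_le_norm _ _
    simp only [η]
    linarith
  have helim : Tendsto (fun k => ‖(e k : H)‖) atTop (nhds 0) := by
    have h1 : Tendsto (fun k => η k / δ) atTop (nhds 0) := by
      simpa using hηlim.div_const δ
    refine squeeze_zero' (Eventually.of_forall fun k => norm_nonneg _) ?_ h1
    filter_upwards [hgt.eventually_ge_atTop N] with k hk
    rw [le_div_iff₀ hδ, mul_comm]
    refine (hreg (g k) hk (e k)).trans (aux_dual _ _ (fun v => ?_) (hη0 k))
    rw [hTnz]
    exact hdual k v v.2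
  have hed : ∀ k, (e k : H) ∈ dt := fun k => hL _ (e k).2
  have hetn : Tendsto (fun k => tnormSq (e k : H)) atTop (nhds 0) := by
    have h1 : Tendsto (fun k => η k * ‖(e k : H)‖ + (‖z‖ + |m| + 1) * ‖(e k : H)‖ ^ 2)
        atTop (nhds 0) := by
      have := (hηlim.mul helim).add ((helim.pow 2).const_mul (‖z‖ + |m| + 1))
      simpa using this
    refine squeeze_zero (fun k => (sq_nonneg _).trans (hnn _ (hed k))) (fun k => ?_) h1
    have h2 := hdual k (e k) (e k).2
    have h3 := (abs_le.1 ((Complex.abs_re_le_norm _).trans h2)).2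
    have h4 : ‖z * (⟪(e k : H), (e k : H)⟫ : ℂ)‖ ≤ ‖z‖ * ‖(e k : H)‖ ^ 2 := by
      rw [norm_mul, sq]
      gcongr
      exact norm_inner_le_norm _ _
    have h5 := (abs_le.1 ((Complex.abs_re_le_norm _).trans h4)).2
    rw [Complex.sub_re] at h3
    have e3 : -m * ‖(e k : H)‖ ^ 2 ≤ |m| * ‖(e k : H)‖ ^ 2 := by
      gcongr; exact neg_le_abs m
    rw [htn]
    linarith
  have hfin : Tendsto (fun k => 2 * tnormSq (e k : H) + 2 * tnormSq ((w : H) - ψ (g k)))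
      atTop (nhds 0) := by
    have := (hetn.const_mul 2).add ((hψt.comp hgt).const_mul 2)
    simpa using this
  refine squeeze_zero (fun k => ?_) (fun k => ?_) hfin
  · exact (sq_nonneg _).trans (hnn _ (dt.sub_mem (hφd _) (hdomt w.2)))
  · have hneg : -((w : H) - ψ (g k)) ∈ dt := dt.neg_mem (hd _)
    have h1 := aux_form m dt t therm tnormSq htn (e k) ((w : H) - ψ (g k)) (hed k) (hd _)
    have h2 := aux_form m dt t therm tnormSq htn (e k) (-((w : H) - ψ (g k))) (hed k) hneg
    have h3 : tnormSq (-((w : H) - ψ (g k))) = tnormSq ((w : H) - ψ (g k)) := by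
      rw [htn, htn, norm_neg]
      simp only [map_neg, LinearMap.neg_apply, neg_neg]
    have h4 := (sq_nonneg _).trans (hnn _ (dt.add_mem (hed k) (hd (g k))))
    have h5 : (e k : H) + -((w : H) - ψ (g k)) = φ (g k) - w := by
      rw [hecoe]; abel
    have h6 : (t (e k : H) (-((w : H) - ψ (g k))) - (m - 1) * ⟪-((w : H) - ψ (g k)), (e k : H)⟫).re
        = -(t (e k : H) ((w : H) - ψ (g k)) - (m - 1) * ⟪(w : H) - ψ (g k), (e k : H)⟫).re := by
      rw [← Complex.neg_re, map_neg, inner_neg_left]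
      congr 1
      ring
    rw [h5, h3, h6] at h2
    linarith
end
end

section
/- Let U be a T_n-uniform set, let λ ∈ σ(T) ∩ U with eigenspace L(λ), and let Γ ⊂ U be a circle with center λ which neither intersects nor encloses any other element of σ(T). Let L_n(Γ) denote the spectral subspace of T_n associated to those elements of σ(T, L_n) enclosed by Γ. Then the gap in the ‖·‖_t-norm satisfies δ̂_t(L(λ), L_n(Γ)) = O(δ_t(L(λ), L_n)) as n → ∞. -/
open scoped ComplexInnerProductSpace
open Filter

noncomputable section

variable {H : Type*} [NormedAddCommGroup H] [InnerProductSpace ℂ H] [CompleteSpace H]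

/-- The eigenspace of a (possibly unbounded) operator given as a `LinearPMap`. -/
def pmEigenspace (T : H →ₗ.[ℂ] H) (z : ℂ) : Submodule ℂ H where
  carrier := {φ | ∃ h : φ ∈ T.domain, T ⟨φ, h⟩ = z • φ}
  add_mem' := by
    rintro a b ⟨ha, hTa⟩ ⟨hb, hTb⟩
    refine ⟨add_mem ha hb, ?_⟩
    have : (⟨a + b, add_mem ha hb⟩ : T.domain) = ⟨a, ha⟩ + ⟨b, hb⟩ := rfl
    rw [this, T.map_add, hTa, hTb, smul_add]
  zero_mem' := ⟨zero_mem _, by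
    have : (⟨0, zero_mem _⟩ : T.domain) = 0 := rfl
    rw [this, T.map_zero, smul_zero]⟩
  smul_mem' := by
    rintro c a ⟨ha, hTa⟩
    refine ⟨Submodule.smul_mem _ c ha, ?_⟩
    have : (⟨c • a, Submodule.smul_mem _ c ha⟩ : T.domain) = c • ⟨a, ha⟩ := rfl
    rw [this, T.map_smul, hTa, smul_comm]

/-- The discrete spectrum: isolated eigenvalues of finite multiplicity. -/
def pmDiscSpectrum (T : H →ₗ.[ℂ] H) : Set ℂ :=
  {z | z ∈ pmSpectrum T ∧ (∃ ε > 0, ∀ w ∈ pmSpectrum T, w ≠ z → ε ≤ dist w z) ∧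
    pmEigenspace T z ≠ ⊥ ∧ FiniteDimensional ℂ (pmEigenspace T z)}

/-- Distance with respect to the form norm `‖·‖_t` (whose square is `tnormSq`). -/
def tdist (tnormSq : H → ℝ) (x : H) (S : Set H) : ℝ :=
  sInf ((fun y => Real.sqrt (tnormSq (x - y))) '' S)

/-- The (one-sided) gap `δ_t(M,N)` between subspaces, in the form norm. -/
def tgap (tnormSq : H → ℝ) (M N : Set H) : ℝ :=
  sSup ((fun x => tdist tnormSq x N) '' {x ∈ M | Real.sqrt (tnormSq x) = 1})

/-- The symmetric gap `δ̂_t(M,N)` between subspaces, in the form norm. -/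
def tgapHat (tnormSq : H → ℝ) (M N : Set H) : ℝ :=
  max (tgap tnormSq M N) (tgap tnormSq N M)

/-- The spectral subspace of `T_n` associated with the Galerkin eigenvalues enclosed by the
circle with centre `c` and radius `r`, regarded as a subspace of `H`. -/
def enclosedSubspace (L : ℕ → Submodule ℂ H) (Tn : ∀ n, L n →ₗ[ℂ] L n) (n : ℕ)
    (c : ℂ) (r : ℝ) : Submodule ℂ H :=
  Submodule.map (L n).subtype
    (⨆ (μ : ℂ) (_ : μ ∈ Metric.ball c r), Module.End.maxGenEigenspace (Tn n) μ)

section helpers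

structure FormData (dt : Submodule ℂ H) (t : H →ₗ[ℂ] H →ₗ⋆[ℂ] ℂ) (m : ℝ)
    (tnormSq : H → ℝ) : Prop where
  herm : ∀ φ ∈ dt, ∀ ψ ∈ dt, t ψ φ = starRingEnd ℂ (t φ ψ)
  lb : ∀ φ ∈ dt, m * ‖φ‖ ^ 2 ≤ (t φ φ).re
  tn : ∀ φ, tnormSq φ = (t φ φ).re - m * ‖φ‖ ^ 2 + ‖φ‖ ^ 2

variable {dt : Submodule ℂ H} {t : H →ₗ[ℂ] H →ₗ⋆[ℂ] ℂ} {m : ℝ} {tnormSq : H → ℝ}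

lemma FormData.ge (h : FormData dt t m tnormSq) {x : H} (hx : x ∈ dt) :
    ‖x‖ ^ 2 ≤ tnormSq x := by
  have := h.lb x hx; rw [h.tn]; linarith

lemma FormData.nonneg (h : FormData dt t m tnormSq) {x : H} (hx : x ∈ dt) :
    0 ≤ tnormSq x := le_trans (sq_nonneg _) (h.ge hx)

lemma FormData.smul (h : FormData dt t m tnormSq) (c : ℂ) (x : H) :
    tnormSq (c • x) = ‖c‖ ^ 2 * tnormSq x := by
  rw [h.tn, h.tn, norm_smul]
  have : t (c • x) (c • x) = ((‖c‖ ^ 2 : ℝ) : ℂ) * t x x := by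
    rw [map_smulₛₗ, map_smul, LinearMap.smul_apply, smul_eq_mul, smul_eq_mul, ← mul_assoc,
      Complex.conj_mul']
    push_cast; ring
  rw [this, Complex.re_ofReal_mul]; ring

lemma FormData.neg (h : FormData dt t m tnormSq) (x : H) :
    tnormSq (-x) = tnormSq x := by
  have := h.smul (-1) x
  simpa using this

lemma FormData.add (h : FormData dt t m tnormSq) {x y : H} (hx : x ∈ dt) (hy : y ∈ dt) :
    tnormSq (x + y) = tnormSq x + tnormSq y
      + 2 * (t x y + (1 - m) * ⟪y, x⟫).re := by
  rw [h.tn, h.tn, h.tn, @norm_add_sq ℂ]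
  have h1 := h.herm x hx y hy
  have h2 : (t y x).re = (t x y).re := by rw [h1]; simp
  have h3 : (⟪y, x⟫ : ℂ).re = (⟪x, y⟫ : ℂ).re := by
    rw [← inner_conj_symm, Complex.conj_re]
  have h4 : (((1 - m : ℂ)) * ⟪y, x⟫).re = (1 - m) * (⟪x, y⟫ : ℂ).re := by
    rw [← h3]
    have : (1 - m : ℂ) = ((1 - m : ℝ) : ℂ) := by push_cast; rfl
    rw [this, Complex.re_ofReal_mul]
  simp only [map_add, LinearMap.add_apply, Complex.add_re, h2, h4]
  simp only [RCLike.re_to_complex]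
  ring

lemma FormData.add_le (h : FormData dt t m tnormSq) {x y : H} (hx : x ∈ dt) (hy : y ∈ dt) :
    tnormSq (x + y) ≤ 2 * tnormSq x + 2 * tnormSq y := by
  have h1 := h.add hx hy
  have h2 := h.add hx (neg_mem hy)
  have h3 := h.nonneg (add_mem hx (neg_mem hy))
  rw [h.neg] at h2
  have h4 : (t x (-y) + (1 - m) * ⟪-y, x⟫).re = - (t x y + (1 - m) * ⟪y, x⟫).re := by
    rw [map_neg, inner_neg_left, ← Complex.neg_re]; congr 1; ring
  rw [h4] at h2
  linarith

lemma FormData.sum_le (h : FormData dt t m tnormSq) {ι : Type*} (s : Finset ι) (x : ι → H)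
    (hx : ∀ i, x i ∈ dt) :
    tnormSq (∑ i ∈ s, x i) ≤ 2 ^ s.card * ∑ i ∈ s, tnormSq (x i) := by
  classical
  induction s using Finset.induction_on with
  | empty => simp [h.tn]
  | insert a s ha ih =>
    rw [Finset.sum_insert ha, Finset.sum_insert ha, Finset.card_insert_of_notMem ha]
    have h1 := h.add_le (hx a) (Submodule.sum_mem dt (fun i (_ : i ∈ s) => hx i))
    have h2 : (1 : ℝ) ≤ 2 ^ s.card := one_le_pow₀ (by norm_num)
    have h3 := h.nonneg (hx a)
    rw [pow_succ]
    nlinarith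

/-- Spectral gap estimate for a symmetric operator in finite dimension. -/
lemma spectral_lower {V : Type*} [NormedAddCommGroup V] [InnerProductSpace ℂ V]
    [FiniteDimensional ℂ V] (A : V →ₗ[ℂ] V) (hA : A.IsSymmetric) (l r : ℝ) (hr : 0 < r)
    (w : V) (hw : w ∈ (⨆ (μ : ℂ) (_ : μ ∈ Metric.ball (l : ℂ) r),
      Module.End.maxGenEigenspace A μ)ᗮ) :
    r * ‖w‖ ≤ ‖A w - (l : ℂ) • w‖ := by
  set b := hA.eigenvectorBasis rfl with hb
  have h1 : ∀ i, r ^ 2 * ‖(⟪b i, w⟫ : ℂ)‖ ^ 2 ≤ ‖(⟪b i, A w - (l : ℂ) • w⟫ : ℂ)‖ ^ 2 := by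
    intro i
    have hAb : A (b i) = (hA.eigenvalues rfl i : ℂ) • b i := hA.apply_eigenvectorBasis rfl i
    have h2 : (⟪b i, A w - (l : ℂ) • w⟫ : ℂ) = ((hA.eigenvalues rfl i : ℂ) - l) * ⟪b i, w⟫ := by
      rw [inner_sub_right, ← hA, hAb, inner_smul_left, inner_smul_right]
      simp; ring
    by_cases hm : (hA.eigenvalues rfl i : ℂ) ∈ Metric.ball (l : ℂ) r
    · have : (⟪b i, w⟫ : ℂ) = 0 := by
        apply hw
        refine Submodule.mem_iSup_of_mem _ (Submodule.mem_iSup_of_mem hm ?_)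
        apply Module.End.mem_maxGenEigenspace A _ _ |>.2
        exact ⟨1, by simp [hAb]⟩
      rw [h2, this]; simp
    · rw [h2, norm_mul, mul_pow]
      rw [Metric.mem_ball, not_lt, dist_eq_norm] at hm
      gcongr
  have h3 := Finset.sum_le_sum (fun i (_ : i ∈ Finset.univ) => h1 i)
  rw [← Finset.mul_sum, b.sum_sq_norm_inner_right, b.sum_sq_norm_inner_right, ← mul_pow] at h3
  exact le_of_sq_le_sq h3 (norm_nonneg _)

lemma key (h : FormData dt t m tnormSq) (L : Submodule ℂ H) (hL : L ≤ dt)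
    [FiniteDimensional ℂ L] (A : L →ₗ[ℂ] L)
    (hA : ∀ φ ψ : L, (⟪ψ, A φ⟫ : ℂ) = t (φ : H) (ψ : H))
    (E : Submodule ℂ H) (hE : E ≤ dt) (l r : ℝ) (hr : 0 < r)
    (hEt : ∀ e ∈ E, ∀ ψ ∈ dt, t e ψ = l * ⟪ψ, e⟫) :
    ∃ S : E →ₗ[ℂ] H, (∀ e, S e ∈ Submodule.map L.subtype
      (⨆ (μ : ℂ) (_ : μ ∈ Metric.ball (l : ℂ) r), Module.End.maxGenEigenspace A μ)) ∧
      ∀ e : E, ∀ y ∈ L, tnormSq (e - S e) ≤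
        (2 + 2 * (|l + 1 - m| / r ^ 2 + 1 / r) * (l + 1 - m) ^ 2) * tnormSq (e - y) := by
  set G := (⨆ (μ : ℂ) (_ : μ ∈ Metric.ball (l : ℂ) r), Module.End.maxGenEigenspace A μ) with hG
  set Λ : ℝ := l + 1 - m with hΛ
  have hsym : A.IsSymmetric := by
    intro x y
    rw [← inner_conj_symm, hA, hA, h.herm y (hL y.2) x (hL x.2), Complex.conj_conj]
  -- the shifted operator
  set B : L →ₗ[ℂ] L := A + ((1 - m : ℝ) : ℂ) • LinearMap.id with hB
  have hBin : ∀ x y : L, (⟪y, B x⟫ : ℂ) = t (x : H) (y : H) + (1 - m) * ⟪(y : H), (x : H)⟫ := by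
    intro x y
    simp [hB, inner_add_right, inner_smul_right, hA]
  have hBpos : ∀ x : L, (⟪x, B x⟫ : ℂ).re = tnormSq x := by
    intro x
    rw [hBin, h.tn]
    have : (1 - m : ℂ) = ((1 - m : ℝ) : ℂ) := by push_cast; rfl
    have h2 : (⟪(x : H), (x : H)⟫ : ℂ).re = ‖(x : H)‖ ^ 2 := by
      rw [inner_self_eq_norm_sq_to_K]; norm_cast
    rw [this, Complex.add_re, Complex.re_ofReal_mul, h2]
    ring
  have hBinj : Function.Injective B := by
    rw [← LinearMap.ker_eq_bot, LinearMap.ker_eq_bot']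
    intro x hx
    have h1 := hBpos x
    rw [hx, inner_zero_right, Complex.zero_re] at h1
    have h2 := h.ge (hL x.2)
    have h3 : ‖(x : H)‖ = 0 := by nlinarith [norm_nonneg (x : H)]
    exact Subtype.ext (norm_eq_zero.1 h3)
  let Be := LinearEquiv.ofInjectiveEndo B hBinj
  have hBe : ∀ y, B (Be.symm y) = y := fun y => Be.apply_symm_apply y
  let V : E →ₗ[ℂ] L := Be.symm.toLinearMap ∘ₗ ((Λ : ℂ) • (L.orthogonalProjectionOnto.toLinearMap)) ∘ₗ E.subtype
  have hV : ∀ e : E, B (V e) = (Λ : ℂ) • L.orthogonalProjectionOnto (e : H) := fun e => hBe _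
  have hGinv : ∀ g ∈ G, A g ∈ G := by
    intro g hg
    have : G ≤ G.comap A := by
      rw [hG]
      refine iSup₂_le fun μ hμ x hx => ?_
      refine Submodule.mem_iSup_of_mem μ (Submodule.mem_iSup_of_mem hμ ?_)
      exact Module.End.mapsTo_maxGenEigenspace_of_comm (Commute.refl A) μ hx
    exact this hg
  refine ⟨L.subtype ∘ₗ G.starProjection.toLinearMap ∘ₗ V, ?_, ?_⟩
  · intro e
    exact ⟨_, Submodule.starProjection_apply_mem G _, rfl⟩
  intro e y hy
  set v := V e with hv
  set p := G.starProjection v with hp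
  set w := v - p with hw
  have hpG : p ∈ G := Submodule.starProjection_apply_mem G _
  have hwG : w ∈ Gᗮ := Submodule.sub_starProjection_mem_orthogonal v
  have hedt := hE e.2
  have hvdt := hL v.2
  -- orthogonality
  have horth : ∀ ψ : L, t ((e : H) - v) ψ + (1 - m) * ⟪(ψ : H), (e : H) - v⟫ = 0 := by
    intro ψ
    have h1 := hBin v ψ
    rw [hv, hV, inner_smul_right, ← hv] at h1
    have h2 : (⟪ψ, L.orthogonalProjectionOnto (e : H)⟫ : ℂ) = ⟪(ψ : H), (e : H)⟫ :=
      L.inner_orthogonalProjectionOnto_eq_of_mem_left ψ e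
    rw [h2] at h1
    rw [map_sub, LinearMap.sub_apply, hEt e e.2 ψ (hL ψ.2), inner_sub_right]
    have : (Λ : ℂ) = l + 1 - m := by rw [hΛ]; push_cast; rfl
    rw [this] at h1
    linear_combination h1
  have hbest : tnormSq ((e : H) - v) ≤ tnormSq ((e : H) - y) := by
    have h1 := h.add (sub_mem hedt hvdt) (sub_mem hvdt (hL hy))
    have h2 := horth (v - ⟨y, hy⟩)
    simp only [Submodule.coe_sub] at h2
    rw [h2, sub_add_sub_cancel] at h1
    have := h.nonneg (sub_mem hvdt (hL hy))
    simp at h1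
    linarith
  -- z
  set z : L := A v - (l : ℂ) • v with hz
  have hzeq : z = (Λ : ℂ) • L.orthogonalProjectionOnto ((e : H) - v) := by
    have h1 := hV e
    rw [← hv] at h1
    rw [map_sub, smul_sub, ← h1, Submodule.orthogonalProjectionOnto_mem_subspace_eq_self, hz, hB, hΛ]
    simp
    module
  have hznorm : ‖z‖ ≤ |Λ| * ‖(e : H) - v‖ := by
    rw [hzeq, norm_smul, Complex.norm_real, Real.norm_eq_abs]
    gcongr
    exact Submodule.norm_orthogonalProjectionOnto_apply_le _ _
  set q : L := A w - (l : ℂ) • w with hq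
  have hqz : z = (A p - (l : ℂ) • p) + q := by
    rw [hz, hq, hw, map_sub]; module
  have hpl : A p - (l : ℂ) • p ∈ G := sub_mem (hGinv p hpG) (G.smul_mem _ hpG)
  have hqG : q ∈ Gᗮ := by
    intro g hg
    rw [hq, inner_sub_right, ← hsym, inner_smul_right, hwG _ (hGinv g hg), hwG g hg]; simp
  have hqn : ‖q‖ ≤ ‖z‖ := by
    have h1 : (⟪A p - (l : ℂ) • p, q⟫ : ℂ) = 0 := hqG _ hpl
    have h2 := norm_add_sq_eq_norm_sq_add_norm_sq_of_inner_eq_zero (A p - (l : ℂ) • p) q h1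
    rw [← hqz] at h2
    nlinarith [norm_nonneg q, norm_nonneg z, norm_nonneg (A p - (l : ℂ) • p)]
  have hwn : ‖w‖ ≤ ‖z‖ / r := by
    rw [le_div_iff₀ hr, mul_comm]
    exact (spectral_lower A hsym l r hr w hwG).trans hqn
  have hwt : tnormSq w ≤ (|Λ| / r ^ 2 + 1 / r) * ‖z‖ ^ 2 := by
    rw [← hBpos]
    have h1 : B w = (Λ : ℂ) • w + q := by
      rw [hB, hq, hΛ]; simp; module
    rw [h1, inner_add_right, inner_smul_right, Complex.add_re, Complex.re_ofReal_mul]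
    have h2 : (⟪w, w⟫ : ℂ).re = ‖w‖ ^ 2 := by
      rw [inner_self_eq_norm_sq_to_K]; norm_cast
    have h3 : (⟪w, q⟫ : ℂ).re ≤ ‖w‖ * ‖q‖ :=
      (Complex.re_le_norm _).trans (norm_inner_le_norm w q)
    rw [h2]
    have h4 : ‖w‖ ^ 2 ≤ (‖z‖ / r) ^ 2 := by gcongr
    have h5 : Λ * ‖w‖ ^ 2 ≤ |Λ| * (‖z‖ / r) ^ 2 :=
      mul_le_mul (le_abs_self _) h4 (by positivity) (abs_nonneg _)
    have h6 : ‖w‖ * ‖q‖ ≤ (‖z‖ / r) * ‖z‖ := by gcongr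
    calc _ ≤ |Λ| * (‖z‖ / r) ^ 2 + (‖z‖ / r) * ‖z‖ := by linarith
      _ = _ := by field_simp
  have hz2 : ‖z‖ ^ 2 ≤ Λ ^ 2 * tnormSq ((e : H) - v) := by
    have h1 : ‖z‖ ^ 2 ≤ (|Λ| * ‖(e : H) - v‖) ^ 2 := by gcongr
    rw [mul_pow, sq_abs] at h1
    exact h1.trans (mul_le_mul_of_nonneg_left (h.ge (sub_mem hedt hvdt)) (sq_nonneg _))
  have hfin := h.add_le (sub_mem hedt hvdt) (hL w.2)
  have heq : (e : H) - v + w = e - p := by rw [hw]; simp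
  rw [heq] at hfin
  change tnormSq ((e : H) - p) ≤ _
  have hc : 0 ≤ |Λ| / r ^ 2 + 1 / r := by positivity
  have h8 : tnormSq w ≤ (|Λ| / r ^ 2 + 1 / r) * (Λ ^ 2 * tnormSq ((e : H) - v)) :=
    hwt.trans (mul_le_mul_of_nonneg_left hz2 hc)
  calc _ ≤ (2 + 2 * (|Λ| / r ^ 2 + 1 / r) * Λ ^ 2) * tnormSq ((e : H) - v) := by linarith
    _ ≤ _ := by gcongr

/-- Approximation of finite-dimensional spaces. -/
lemma approx (h : FormData dt t m tnormSq) (L : ℕ → Submodule ℂ H) (hL : ∀ n, L n ≤ dt)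
    (hLdense : ∀ φ ∈ dt, ∃ u : ℕ → H, (∀ n, u n ∈ L n) ∧
      Tendsto (fun n => tnormSq (φ - u n)) atTop (nhds 0))
    (E : Submodule ℂ H) (hE : E ≤ dt) [FiniteDimensional ℂ E] (ε : ℝ) (hε : 0 < ε) :
    ∀ᶠ n in atTop, ∀ e : E, ∃ y ∈ L n, tnormSq (e - y) ≤ ε * tnormSq e := by
  set b := Module.finBasis ℂ E with hb
  choose u huL hu using fun i => hLdense (b i) (hE (b i).2)
  have hK : ∀ i, ∃ K : ℝ, 0 ≤ K ∧ ∀ e : E, ‖b.coord i e‖ ≤ K * ‖e‖ := by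
    intro i
    let c : E →L[ℂ] ℂ := LinearMap.toContinuousLinearMap (b.coord i)
    exact ⟨‖c‖, norm_nonneg c, fun e => c.le_opNorm e⟩
  choose K hK0 hK using hK
  have hlim : Tendsto (fun n => 2 ^ Module.finrank ℂ E * ∑ i, K i ^ 2 * tnormSq (b i - u i n)) atTop (nhds 0) := by
    have : (0 : ℝ) = 2 ^ Module.finrank ℂ E * ∑ i, K i ^ 2 * 0 := by simp
    rw [this]
    exact (tendsto_finsetSum _ fun i _ => (hu i).const_mul _).const_mul _
  filter_upwards [hlim.eventually (gt_mem_nhds hε)] with n hn e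
  refine ⟨∑ i, b.coord i e • u i n, Submodule.sum_mem _ fun i _ => (L n).smul_mem _ (huL i n), ?_⟩
  have he : (e : H) - ∑ i, b.coord i e • u i n = ∑ i, b.coord i e • ((b i : H) - u i n) := by
    simp only [smul_sub, Finset.sum_sub_distrib]
    congr 1
    have := congrArg (fun x : E => (x : H)) (b.sum_repr e)
    simp only [Submodule.coe_sum, Submodule.coe_smul] at this
    exact this.symm
  rw [he]
  have hd : ∀ i, (b i : H) - u i n ∈ dt := fun i => sub_mem (hE (b i).2) (hL n (huL i n))
  refine (h.sum_le _ _ fun i => dt.smul_mem _ (hd i)).trans ?_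
  rw [Finset.card_univ, Fintype.card_fin]
  have h1 : ∑ i, tnormSq (b.coord i e • ((b i : H) - u i n)) ≤
      ∑ i, (K i ^ 2 * tnormSq (b i - u i n)) * tnormSq e := by
    refine Finset.sum_le_sum fun i _ => ?_
    rw [h.smul]
    have h2 : ‖b.coord i e‖ ^ 2 ≤ (K i * ‖e‖) ^ 2 := by
      gcongr; exact hK i e
    have h3 : ‖e‖ ^ 2 ≤ tnormSq e := h.ge (hE e.2)
    have h4 : ‖b.coord i e‖ ^ 2 ≤ K i ^ 2 * tnormSq e := by
      rw [mul_pow] at h2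
      exact h2.trans (mul_le_mul_of_nonneg_left h3 (sq_nonneg _))
    have := mul_le_mul_of_nonneg_right h4 (h.nonneg (hd i))
    linarith
  rw [← Finset.sum_mul] at h1
  have h5 := h.nonneg (hE e.2)
  calc _ ≤ 2 ^ Module.finrank ℂ E * ((∑ i, K i ^ 2 * tnormSq (b i - u i n)) * tnormSq e) := by gcongr
    _ = (2 ^ Module.finrank ℂ E * (∑ i, K i ^ 2 * tnormSq (b i - u i n))) * tnormSq e := by ring
    _ ≤ _ := by gcongr

lemma tdist_le (x : H) (S : Set H) (y : H) (hy : y ∈ S) :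
    tdist tnormSq x S ≤ Real.sqrt (tnormSq (x - y)) := by
  refine csInf_le ⟨0, ?_⟩ ⟨y, hy, rfl⟩
  rintro _ ⟨z, _, rfl⟩
  exact Real.sqrt_nonneg _

lemma tgap_bdd (M N : Submodule ℂ H) :
    BddAbove ((fun x => tdist tnormSq x N) '' {x ∈ (M : Set H) | Real.sqrt (tnormSq x) = 1}) := by
  refine ⟨1, ?_⟩
  rintro _ ⟨x, ⟨_, hx⟩, rfl⟩
  have := tdist_le (tnormSq := tnormSq) x N 0 N.zero_mem
  rw [sub_zero, hx] at this
  exact this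

lemma tgap_nonneg (M N : Submodule ℂ H) : 0 ≤ tgap tnormSq M N := by
  apply Real.sSup_nonneg
  rintro _ ⟨x, _, rfl⟩
  apply Real.sInf_nonneg
  rintro _ ⟨z, _, rfl⟩
  exact Real.sqrt_nonneg _

lemma tgap_spec (h : FormData dt t m tnormSq) (M N : Submodule ℂ H) (hM : M ≤ dt)
    (x : H) (hx : x ∈ M) (a : ℝ) (ha : ∀ y ∈ N, a ≤ tnormSq (x - y)) :
    a ≤ (tgap tnormSq M N) ^ 2 * tnormSq x := by
  have hxn := h.nonneg (hM hx)
  rcases hxn.eq_or_lt with h0 | hpos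
  · have := ha 0 N.zero_mem
    rw [sub_zero, ← h0] at this
    rw [← h0]; simpa using this
  set s := Real.sqrt (tnormSq x) with hs
  have hspos : 0 < s := Real.sqrt_pos.2 hpos
  have hs2 : s ^ 2 = tnormSq x := Real.sq_sqrt hxn
  set c : ℂ := ((s⁻¹ : ℝ) : ℂ) with hc
  have hcn : ‖c‖ ^ 2 = (s ^ 2)⁻¹ := by
    rw [hc, Complex.norm_real, Real.norm_eq_abs, sq_abs, inv_pow]
  have hc0 : c ≠ 0 := by
    rw [hc]; exact_mod_cast (inv_pos.2 hspos).ne'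
  have hmem : c • x ∈ {x ∈ (M : Set H) | Real.sqrt (tnormSq x) = 1} := by
    refine ⟨M.smul_mem _ hx, ?_⟩
    rw [h.smul, hcn, ← hs2, inv_mul_cancel₀ (by positivity), Real.sqrt_one]
  have h1 : tdist tnormSq (c • x) N ≤ tgap tnormSq M N := le_csSup (tgap_bdd M N) ⟨_, hmem, rfl⟩
  have h2 : Real.sqrt (a / s ^ 2) ≤ tdist tnormSq (c • x) N := by
    refine le_csInf ⟨_, 0, N.zero_mem, rfl⟩ ?_
    rintro _ ⟨y, hy, rfl⟩
    apply Real.sqrt_le_sqrt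
    have h3 : c • x - y = c • (x - c⁻¹ • y) := by
      rw [smul_sub, smul_smul, mul_inv_cancel₀ hc0, one_smul]
    rw [h3, h.smul, hcn, div_eq_inv_mul]
    have := ha _ (N.smul_mem c⁻¹ hy)
    gcongr
  have h4 : a / s ^ 2 ≤ (tgap tnormSq M N) ^ 2 := by
    exact (Real.sqrt_le_left (tgap_nonneg M N)).1 (h2.trans h1)
  rw [← hs2]
  exact (div_le_iff₀ (by positivity)).1 h4

lemma tgap_small (h : FormData dt t m tnormSq) (M N : Submodule ℂ H) (ε : ℝ) (hε : 0 < ε)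
    (hy : ∀ e : M, ∃ y ∈ N, tnormSq (e - y) ≤ ε * tnormSq e) :
    (tgap tnormSq M N) ^ 2 ≤ ε := by
  have : tgap tnormSq M N ≤ Real.sqrt ε := by
    refine Real.sSup_le ?_ (Real.sqrt_nonneg _)
    rintro _ ⟨x, ⟨hx, hx1⟩, rfl⟩
    obtain ⟨y, hyN, hy⟩ := hy ⟨x, hx⟩
    refine (tdist_le x N y hyN).trans (Real.sqrt_le_sqrt ?_)
    rw [Real.sqrt_eq_one] at hx1
    simpa [hx1] using hy
  exact (Real.le_sqrt (tgap_nonneg M N) hε.le).1 this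

lemma main_aux (h : FormData dt t m tnormSq) (L : ℕ → Submodule ℂ H) (hL : ∀ n, L n ≤ dt)
    [∀ n, FiniteDimensional ℂ (L n)]
    (hLdense : ∀ φ ∈ dt, ∃ u : ℕ → H, (∀ n, u n ∈ L n) ∧
      Tendsto (fun n => tnormSq (φ - u n)) atTop (nhds 0))
    (Tn : ∀ n, L n →ₗ[ℂ] L n)
    (hTn : ∀ n, ∀ φ ψ : L n, (⟪ψ, Tn n φ⟫ : ℂ) = t (φ : H) (ψ : H))
    (E : Submodule ℂ H) (hE : E ≤ dt) [FiniteDimensional ℂ E] (l r : ℝ) (hr : 0 < r)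
    (hEt : ∀ e ∈ E, ∀ ψ ∈ dt, t e ψ = l * ⟪ψ, e⟫)
    (hdim : ∀ᶠ n in atTop, Module.finrank ℂ (enclosedSubspace L Tn n l r) = Module.finrank ℂ E) :
    ∃ C : ℝ, ∀ᶠ n in atTop,
      tgapHat tnormSq E (enclosedSubspace L Tn n l r) ≤ C * tgap tnormSq E (L n) := by
  set K : ℝ := 2 + 2 * (|l + 1 - m| / r ^ 2 + 1 / r) * (l + 1 - m) ^ 2 with hK
  have hKpos : 0 < K := by positivity
  refine ⟨2 * Real.sqrt K, ?_⟩
  filter_upwards [hdim, approx h L hL hLdense E hE (1 / (4 * K)) (by positivity)] with n hd hap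
  have hsm := tgap_small h E (L n) _ (by positivity) hap
  set δ := tgap tnormSq E (L n) with hδ
  have hδ0 : 0 ≤ δ := tgap_nonneg _ _
  obtain ⟨S, hSm, hS⟩ := key h (L n) (hL n) (Tn n) (hTn n) E hE l r hr hEt
  rw [← hK] at hS
  have hFdt : enclosedSubspace L Tn n l r ≤ dt := by
    rintro _ ⟨x, _, rfl⟩
    exact hL n x.2
  have hS' : ∀ e : E, tnormSq (e - S e) ≤ K * δ ^ 2 * tnormSq e := by
    intro e
    have := tgap_spec h E (L n) hE e e.2 (tnormSq (e - S e) / K) (fun y hy => by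
      rw [div_le_iff₀ hKpos, mul_comm]; exact hS e y hy)
    rw [div_le_iff₀ hKpos] at this
    linarith
  have hKδ : K * δ ^ 2 ≤ 1 / 4 := by
    calc K * δ ^ 2 ≤ K * (1 / (4 * K)) := by gcongr
      _ = 1 / 4 := by field_simp
  have hlow : ∀ e : E, tnormSq e ≤ 4 * tnormSq (S e) := by
    intro e
    have hSe := hFdt (hSm e)
    have h1 := h.add_le hSe (sub_mem (hE e.2) hSe)
    rw [add_sub_cancel] at h1
    have h2 := mul_le_mul_of_nonneg_right hKδ (h.nonneg (hE e.2))
    have h3 := hS' e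
    linarith
  have hsq : Real.sqrt K * δ = Real.sqrt (K * δ ^ 2) := by
    rw [Real.sqrt_mul hKpos.le, Real.sqrt_sq hδ0]
  refine max_le ?_ ?_
  · refine Real.sSup_le ?_ (by positivity)
    rintro _ ⟨x, ⟨hx, hx1⟩, rfl⟩
    refine (tdist_le x _ _ (hSm ⟨x, hx⟩)).trans ?_
    rw [Real.sqrt_eq_one] at hx1
    have h1 := hS' ⟨x, hx⟩
    simp only [hx1, mul_one] at h1
    have h2 := Real.sqrt_le_sqrt h1
    rw [← hsq] at h2
    have : 0 ≤ Real.sqrt K * δ := by positivity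
    linarith
  · refine Real.sSup_le ?_ (by positivity)
    rintro _ ⟨f, ⟨hf, hf1⟩, rfl⟩
    rw [Real.sqrt_eq_one] at hf1
    have hfd : FiniteDimensional ℂ (enclosedSubspace L Tn n l r) := by
      unfold enclosedSubspace; infer_instance
    let S' : E →ₗ[ℂ] enclosedSubspace L Tn n l r := S.codRestrict _ hSm
    have hinj : Function.Injective S' := by
      rw [← LinearMap.ker_eq_bot, LinearMap.ker_eq_bot']
      intro e he
      have h0 : S e = 0 := congrArg Subtype.val he
      have h1 := hlow e
      have h2 := h.ge (hE e.2)
      have h3 : tnormSq (0 : H) = 0 := by simp [h.tn]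
      rw [h0, h3] at h1
      have h4 : ‖(e : H)‖ = 0 := by nlinarith [norm_nonneg (e : H)]
      exact Subtype.ext (norm_eq_zero.1 h4)
    have hsurj : Function.Surjective S' :=
      (LinearMap.injective_iff_surjective_of_finrank_eq_finrank hd.symm).1 hinj
    obtain ⟨e, he⟩ := hsurj ⟨f, hf⟩
    have hef : S e = f := congrArg Subtype.val he
    refine (tdist_le f _ e e.2).trans ?_
    have h1 := hS' e
    have h2 := hlow e
    rw [hef] at h1 h2
    rw [hf1] at h2
    have h3 : tnormSq (f - e) ≤ 2 ^ 2 * (K * δ ^ 2) := by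
      rw [← h.neg, neg_sub]
      have : K * δ ^ 2 * tnormSq e ≤ K * δ ^ 2 * (4 * 1) := by gcongr
      linarith
    have h4 := Real.sqrt_le_sqrt h3
    rw [Real.sqrt_mul (by norm_num), ← hsq, Real.sqrt_sq (by norm_num)] at h4
    linarith

end helpers

/-- **Lemma (subspace gap).** `δ̂_t(L(λ), L_n(Γ)) = O(δ_t(L(λ), L_n))`. -/
theorem stmt_3
    -- `T` is a semi-bounded self-adjoint operator with `m = min σ(T)`
    (T : H →ₗ.[ℂ] H) (hsa : IsSelfAdjoint T)
    (m : ℝ) (hm : IsLeast {x : ℝ | (x : ℂ) ∈ pmSpectrum T} m)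
    -- `t` is the closed sesquilinear form associated to `T`
    (dt : Submodule ℂ H) (t : H →ₗ[ℂ] H →ₗ⋆[ℂ] ℂ)
    (hdomt : T.domain ≤ dt)
    (therm : ∀ φ ∈ dt, ∀ ψ ∈ dt, t ψ φ = starRingEnd ℂ (t φ ψ))
    (hcomp : ∀ φ : T.domain, ∀ ψ ∈ dt, t φ ψ = ⟪ψ, T φ⟫)
    (hlb : ∀ φ ∈ dt, m * ‖φ‖ ^ 2 ≤ (t φ φ).re)
    (tnormSq : H → ℝ)
    (htn : ∀ φ, tnormSq φ = (t φ φ).re - m * ‖φ‖ ^ 2 + ‖φ‖ ^ 2)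
    (hclosed : ∀ u : ℕ → H, (∀ k, u k ∈ dt) →
      (∀ ε > 0, ∃ N, ∀ j ≥ N, ∀ k ≥ N, tnormSq (u j - u k) < ε) →
      ∃ φ ∈ dt, Tendsto (fun k => tnormSq (u k - φ)) atTop (nhds 0))
    -- trial spaces
    (L : ℕ → Submodule ℂ H) (hL : ∀ n, L n ≤ dt)
    [∀ n, FiniteDimensional ℂ (L n)]
    (hLdense : ∀ φ ∈ dt, ∃ u : ℕ → H, (∀ n, u n ∈ L n) ∧
      Tendsto (fun n => tnormSq (φ - u n)) atTop (nhds 0))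
    -- compressions of the form `t`
    (Tn : ∀ n, L n →ₗ[ℂ] L n)
    (hTn : ∀ n, ∀ φ ψ : L n, (⟪ψ, Tn n φ⟫ : ℂ) = t (φ : H) (ψ : H))
    -- `U` is a `T_n`-uniform set:
    (U : Set ℂ) (hUopen : IsOpen U)
    -- (1) compact subsets of `U ∩ ρ(T)` are `T_n`-regular
    (hU1 : ∀ Γ : Set ℂ, Γ ⊆ U ∩ pmResolventSet T → IsCompact Γ →
      ∃ δ > 0, ∃ N : ℕ, ∀ z ∈ Γ, ∀ n ≥ N, ∀ φ : L n, δ * ‖φ‖ ≤ ‖Tn n φ - z • φ‖)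
    -- (2) `U ∩ σ(T, L_∞) = U ∩ σ(T) ⊆ σ_dis(T)`
    (hU2 : U ∩ {w : ℂ | ∃ zs : ℕ → ℂ,
        (∀ n, zs n ∈ spectrum ℂ (Tn n : Module.End ℂ (L n))) ∧ Tendsto zs atTop (nhds w)}
      = U ∩ pmSpectrum T)
    (hU2' : U ∩ pmSpectrum T ⊆ pmDiscSpectrum T)
    -- (3) the multiplicity condition
    (hU3 : ∀ μ ∈ pmSpectrum T ∩ U, ∀ r > 0, Metric.sphere μ r ⊆ U →
      (∀ w ∈ pmSpectrum T, w ∈ Metric.closedBall μ r → w = μ) →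
      ∀ᶠ n in atTop, Module.finrank ℂ (enclosedSubspace L Tn n μ r)
        = Module.finrank ℂ (pmEigenspace T μ))
    -- `λ ∈ σ(T) ∩ U` and `Γ ⊆ U` is a circle centred at `λ` enclosing no other spectrum
    (lam : ℂ) (hlam : lam ∈ pmSpectrum T ∩ U)
    (r : ℝ) (hr : 0 < r) (hΓU : Metric.sphere lam r ⊆ U)
    (hsep : ∀ w ∈ pmSpectrum T, w ∈ Metric.closedBall lam r → w = lam) :
    ∃ C : ℝ, ∀ᶠ n in atTop,
      tgapHat tnormSq (pmEigenspace T lam) (enclosedSubspace L Tn n lam r)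
        ≤ C * tgap tnormSq (pmEigenspace T lam) (L n) := by
  have h : FormData dt t m tnormSq := ⟨therm, hlb, htn⟩
  have hE : pmEigenspace T lam ≤ dt := fun x hx => hdomt hx.1
  obtain ⟨-, -, hne, hfd⟩ := hU2' ⟨hlam.2, hlam.1⟩
  have hEt0 : ∀ e ∈ pmEigenspace T lam, ∀ ψ ∈ dt, t e ψ = lam * ⟪ψ, e⟫ := by
    rintro e ⟨he, heT⟩ ψ hψ
    have := hcomp ⟨e, he⟩ ψ hψ
    rw [heT, inner_smul_right] at this
    exact this
  obtain ⟨l, rfl⟩ : ∃ l : ℝ, (l : ℂ) = lam := by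
    obtain ⟨e, he, he0⟩ := Submodule.exists_mem_ne_zero_of_ne_bot hne
    have h1 := hEt0 e he e (hE he)
    have h2 := therm e (hE he) e (hE he)
    have h3 : (⟪e, e⟫ : ℂ) ≠ 0 := inner_self_ne_zero.2 he0
    rw [h1, map_mul, inner_conj_symm] at h2
    exact ⟨lam.re, Complex.conj_eq_iff_re.1 (mul_right_cancel₀ h3 h2).symm⟩
  exact main_aux h L hL hLdense Tn hTn _ hE l r hr hEt0 (hU3 _ hlam r hr hΓU hsep)
end
end

section
/- Let z ∈ σ(T+A) ∩ U and x ∈ H, and let 𝒯 denote the self-adjoint operator on H ⊖ ker(T − z) with domain Dom(T) ⊖ ker(T − z) and action 𝒯φ = Tφ (so z ∈ ρ(𝒯)). Let (φ_n) be a bounded sequence with φ_n ∈ L_n and max over normalised v ∈ L_n of |(s − z)(φ_n, v) − ⟨x, v⟩| → 0. Then there exist u ∈ H and a subsequence (n_k) with ‖Aφ_{n_k} − u‖ → 0; moreover x − u ⊥ ker(T − z) and dist_t[φ_{n_k} − (𝒯 − z)^{-1}(x − u), ker(T − z)] → 0. -/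
open scoped ComplexInnerProductSpace
open Filter

noncomputable section

variable {H : Type*} [NormedAddCommGroup H] [InnerProductSpace ℂ H] [CompleteSpace H]

theorem aux_sym_split {V : Type*} [NormedAddCommGroup V] [InnerProductSpace ℂ V]
    [FiniteDimensional ℂ V] (B : V →ₗ[ℂ] V) (hB : B.IsSymmetric) (z : ℂ) (r : ℝ) (hr : 0 < r)
    (ψ : V) : ∃ p ∈ (⨆ (μ : ℂ) (_ : μ ∈ Metric.ball z r), Module.End.maxGenEigenspace B μ),
      r * ‖ψ - p‖ ≤ ‖B ψ - z • ψ‖ ∧ ‖B (ψ - p) - z • (ψ - p)‖ ≤ ‖B ψ - z • ψ‖ := by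
  classical
  let b := hB.eigenvectorBasis rfl
  let lam : Fin (Module.finrank ℂ V) → ℂ := fun i => ((hB.eigenvalues rfl i : ℝ) : ℂ)
  let q : V := b.repr.symm (WithLp.toLp 2 fun i =>
    if ‖lam i - z‖ < r then (0 : ℂ) else b.repr ψ i)
  have hq : ∀ i, b.repr q i = if ‖lam i - z‖ < r then (0 : ℂ) else b.repr ψ i := by
    intro i; simp [q]
  have hBr : ∀ v i, b.repr (B v - z • v) i = (lam i - z) * b.repr v i := by
    intro v i
    have := hB.eigenvectorBasis_apply_self_apply rfl v i
    rw [map_sub, map_smul, PiLp.sub_apply, PiLp.smul_apply, smul_eq_mul, sub_mul]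
    congr 1
  have hns : ∀ v : V, ‖v‖ ^ 2 = ∑ i, ‖b.repr v i‖ ^ 2 := by
    intro v
    rw [← b.repr.norm_map v, EuclideanSpace.norm_sq_eq]
  refine ⟨ψ - q, ?_, ?_, ?_⟩
  · rw [← b.sum_repr (ψ - q)]
    refine Submodule.sum_mem _ fun i _ => ?_
    by_cases hi : ‖lam i - z‖ < r
    · refine Submodule.smul_mem _ _ ?_
      refine Submodule.mem_iSup_of_mem (lam i) (Submodule.mem_iSup_of_mem ?_ ?_)
      · rw [Metric.mem_ball, dist_eq_norm]; exact hi
      · rw [Module.End.mem_maxGenEigenspace]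
        refine ⟨1, ?_⟩
        have h1 : B (b i) = lam i • b i := hB.apply_eigenvectorBasis rfl i
        rw [pow_one, LinearMap.sub_apply, h1, LinearMap.smul_apply, Module.End.one_apply, sub_self]
    · rw [map_sub, PiLp.sub_apply, hq, if_neg hi, sub_self, zero_smul]
      exact zero_mem _
  · rw [sub_sub_cancel]
    refine abs_le_of_sq_le_sq' ?_ (norm_nonneg _) |>.2
    rw [mul_pow, hns q, hns (B ψ - z • ψ), Finset.mul_sum]
    refine Finset.sum_le_sum fun i _ => ?_
    rw [hBr, hq, norm_mul, mul_pow]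
    split_ifs with hi
    · simp; positivity
    · have : r ^ 2 ≤ ‖lam i - z‖ ^ 2 := by
        have := not_lt.1 hi
        gcongr
      gcongr
  · rw [sub_sub_cancel]
    refine abs_le_of_sq_le_sq' ?_ (norm_nonneg _) |>.2
    rw [hns, hns (B ψ - z • ψ)]
    refine Finset.sum_le_sum fun i _ => ?_
    rw [hBr, hBr, hq]
    split_ifs with hi
    · simp; positivity
    · exact le_rfl

theorem aux_weak (φ : ℕ → H) (hb : ∃ C, ∀ n, ‖φ n‖ ≤ C) :
    ∃ (F : Ultrafilter ℕ) (p : H), (F : Filter ℕ) ≤ atTop ∧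
      ∀ v : H, Tendsto (fun n => (⟪φ n, v⟫ : ℂ)) F (nhds ⟪p, v⟫) := by
  obtain ⟨C, hC⟩ := hb
  let e : ℕ → WeakDual ℂ H := fun n => StrongDual.toWeakDual (InnerProductSpace.toDual ℂ H (φ n))
  have hcomp := WeakDual.isCompact_closedBall (𝕜 := ℂ) (E := H) 0 C
  have hmem : ∀ n, e n ∈ (WeakDual.toStrongDual ⁻¹' Metric.closedBall (0 : StrongDual ℂ H) C) := by
    intro n
    simp [e, hC n]
  let F : Ultrafilter ℕ := Filter.hyperfilter ℕ
  obtain ⟨f, hf, hlim⟩ := isCompact_iff_ultrafilter_le_nhds.1 hcomp (F.map e) (by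
    rw [Filter.le_principal_iff]
    exact Filter.mem_map.2 (Filter.mem_of_superset Filter.univ_mem (fun n _ => hmem n)))
  refine ⟨F, (InnerProductSpace.toDual ℂ H).symm (WeakDual.toStrongDual f), ?_, ?_⟩
  · exact Nat.hyperfilter_le_atTop
  · intro v
    rw [InnerProductSpace.toDual_symm_apply]
    have h1 : Tendsto e F (nhds f) := hlim
    have h2 := ((WeakDual.eval_continuous v).tendsto f).comp h1
    exact h2

set_option linter.unusedSectionVars false

section form
variable {dt : Submodule ℂ H} {t : H →ₗ[ℂ] H →ₗ⋆[ℂ] ℂ} {m : ℝ} {tnormSq : H → ℝ}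

theorem aux_norm_le (hlb : ∀ φ ∈ dt, m * ‖φ‖ ^ 2 ≤ (t φ φ).re)
    (htn : ∀ φ, tnormSq φ = (t φ φ).re - m * ‖φ‖ ^ 2 + ‖φ‖ ^ 2) {a : H} (ha : a ∈ dt) :
    ‖a‖ ^ 2 ≤ tnormSq a := by
  rw [htn]; linarith [hlb a ha]

theorem aux_par (htn : ∀ φ, tnormSq φ = (t φ φ).re - m * ‖φ‖ ^ 2 + ‖φ‖ ^ 2) (a b : H) :
    tnormSq (a + b) + tnormSq (a - b) = 2 * tnormSq a + 2 * tnormSq b := by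
  have h := parallelogram_law_with_norm ℂ a b
  simp only [htn, map_add, map_sub, LinearMap.add_apply, LinearMap.sub_apply, Complex.add_re,
    Complex.sub_re]
  linear_combination (1 - m) * h

theorem aux_add_le (hlb : ∀ φ ∈ dt, m * ‖φ‖ ^ 2 ≤ (t φ φ).re)
    (htn : ∀ φ, tnormSq φ = (t φ φ).re - m * ‖φ‖ ^ 2 + ‖φ‖ ^ 2) {a b : H}
    (ha : a ∈ dt) (hb : b ∈ dt) :
    tnormSq (a + b) ≤ 2 * tnormSq a + 2 * tnormSq b := by
  have := aux_par htn a b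
  have := aux_norm_le hlb htn (sub_mem ha hb)
  nlinarith [sq_nonneg ‖a - b‖]

theorem aux_smul (htn : ∀ φ, tnormSq φ = (t φ φ).re - m * ‖φ‖ ^ 2 + ‖φ‖ ^ 2) (c : ℂ) (a : H) :
    tnormSq (c • a) = ‖c‖ ^ 2 * tnormSq a := by
  have : t (c • a) (c • a) = ((‖c‖ ^ 2 : ℝ) : ℂ) * t a a := by
    rw [LinearMap.map_smul, LinearMap.smul_apply, LinearMap.map_smulₛₗ, smul_eq_mul, smul_eq_mul, ← mul_assoc,
      Complex.mul_conj, Complex.normSq_eq_norm_sq]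
  rw [htn, htn, this, Complex.re_ofReal_mul, norm_smul]
  ring

theorem aux_tendsto_add (hlb : ∀ φ ∈ dt, m * ‖φ‖ ^ 2 ≤ (t φ φ).re)
    (htn : ∀ φ, tnormSq φ = (t φ φ).re - m * ‖φ‖ ^ 2 + ‖φ‖ ^ 2) {a b : ℕ → H}
    (ha : ∀ n, a n ∈ dt) (hb : ∀ n, b n ∈ dt)
    (hta : Tendsto (fun n => tnormSq (a n)) atTop (nhds 0))
    (htb : Tendsto (fun n => tnormSq (b n)) atTop (nhds 0)) :
    Tendsto (fun n => tnormSq (a n + b n)) atTop (nhds 0) := by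
  refine squeeze_zero (fun n => (sq_nonneg _).trans (aux_norm_le hlb htn (add_mem (ha n) (hb n))))
    (fun n => aux_add_le hlb htn (ha n) (hb n)) ?_
  simpa using (hta.const_mul 2).add (htb.const_mul 2)

theorem aux_tendsto_sum (hlb : ∀ φ ∈ dt, m * ‖φ‖ ^ 2 ≤ (t φ φ).re)
    (htn : ∀ φ, tnormSq φ = (t φ φ).re - m * ‖φ‖ ^ 2 + ‖φ‖ ^ 2) {ι : Type*} (S : Finset ι)
    {a : ι → ℕ → H}
    (ha : ∀ i n, a i n ∈ dt)
    (hta : ∀ i, Tendsto (fun n => tnormSq (a i n)) atTop (nhds 0)) :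
    Tendsto (fun n => tnormSq (∑ i ∈ S, a i n)) atTop (nhds 0) := by
  classical
  induction S using Finset.induction_on with
  | empty => simp [htn]
  | insert i S hi ih =>
    simp only [Finset.sum_insert hi]
    exact aux_tendsto_add hlb htn (ha i) (fun n => sum_mem fun j _ => ha j n) (hta i) ih

theorem aux_norm_tendsto (hlb : ∀ φ ∈ dt, m * ‖φ‖ ^ 2 ≤ (t φ φ).re)
    (htn : ∀ φ, tnormSq φ = (t φ φ).re - m * ‖φ‖ ^ 2 + ‖φ‖ ^ 2) {a : ℕ → H}
    (ha : ∀ n, a n ∈ dt) (hta : Tendsto (fun n => tnormSq (a n)) atTop (nhds 0)) :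
    Tendsto (fun n => ‖a n‖) atTop (nhds 0) := by
  have h1 : Tendsto (fun n => ‖a n‖ ^ 2) atTop (nhds 0) :=
    squeeze_zero (fun n => sq_nonneg _) (fun n => aux_norm_le hlb htn (ha n)) hta
  have := h1.sqrt
  simpa [Real.sqrt_sq (norm_nonneg _)] using this

variable {T : H →ₗ.[ℂ] H} {L : ℕ → Submodule ℂ H} [∀ n, FiniteDimensional ℂ (L n)]
  {Tn : ∀ n, L n →ₗ[ℂ] L n}

theorem aux_sym
    (therm : ∀ φ ∈ dt, ∀ ψ ∈ dt, t ψ φ = starRingEnd ℂ (t φ ψ)) (hL : ∀ n, L n ≤ dt)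
    (hTn : ∀ n, ∀ φ ψ : L n, (⟪ψ, Tn n φ⟫ : ℂ) = t (φ : H) (ψ : H)) (n : ℕ) :
    (Tn n).IsSymmetric := by
  intro a b
  rw [← inner_conj_symm, hTn, hTn, ← therm _ (hL n a.2) _ (hL n b.2)]

theorem aux_ritz
    (hdomt : T.domain ≤ dt)
    (therm : ∀ φ ∈ dt, ∀ ψ ∈ dt, t ψ φ = starRingEnd ℂ (t φ ψ))
    (hcomp : ∀ φ : T.domain, ∀ ψ ∈ dt, t φ ψ = ⟪ψ, T φ⟫)
    (hlb : ∀ φ ∈ dt, m * ‖φ‖ ^ 2 ≤ (t φ φ).re)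
    (htn : ∀ φ, tnormSq φ = (t φ φ).re - m * ‖φ‖ ^ 2 + ‖φ‖ ^ 2)
    (hL : ∀ n, L n ≤ dt)
    (hLdense : ∀ φ ∈ dt, ∃ u : ℕ → H, (∀ n, u n ∈ L n) ∧
      Tendsto (fun n => tnormSq (φ - u n)) atTop (nhds 0))
    (hTn : ∀ n, ∀ φ ψ : L n, (⟪ψ, Tn n φ⟫ : ℂ) = t (φ : H) (ψ : H))
    (w : T.domain) :
    ∃ w' : ∀ n, L n, Tendsto (fun n => tnormSq ((w : H) - w' n)) atTop (nhds 0) ∧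
      ∀ n, ∀ v : L n, t ((w : H) - w' n) v = (m - 1) * ⟪(v : H), (w : H) - w' n⟫ := by
  have key : ∀ n, ∃ w' : L n, ∀ v : L n,
      t ((w : H) - w') v = (m - 1) * ⟪(v : H), (w : H) - w'⟫ := by
    intro n
    let B : L n →ₗ[ℂ] L n := Tn n + ((1 - m : ℝ) : ℂ) • LinearMap.id
    have hB : ∀ a v : L n, (⟪v, B a⟫ : ℂ) = t a v + ((1 - m : ℝ) : ℂ) * ⟪(v : H), (a : H)⟫ := by
      intro a v
      simp only [B, LinearMap.add_apply, LinearMap.smul_apply, LinearMap.id_apply]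
      rw [inner_add_right, hTn, inner_smul_right, Submodule.coe_inner]
    have hinj : Function.Injective B := by
      rw [injective_iff_map_eq_zero]
      intro a ha
      have h1 := hB a a
      rw [ha, inner_zero_right] at h1
      have h2 := congrArg Complex.re h1
      rw [Complex.zero_re, Complex.add_re, Complex.re_ofReal_mul, inner_self_eq_norm_sq_to_K] at h2
      have h3 : ((((‖(a : H)‖ : ℝ) : ℂ)) ^ 2).re = ‖(a : H)‖ ^ 2 := by
        rw [← Complex.ofReal_pow, Complex.ofReal_re]
      have h4 : (t (a : H) a).re + (1 - m) * ‖(a : H)‖ ^ 2 = 0 := by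
        rw [← h3]; exact h2.symm
      have h5 := hlb a (hL n a.2)
      have h6 : ‖(a : H)‖ ^ 2 ≤ 0 := by linarith
      have h7 : ‖(a : H)‖ = 0 := by
        have := sq_nonneg ‖(a : H)‖
        exact pow_eq_zero_iff (two_ne_zero) |>.1 (le_antisymm h6 this)
      exact Subtype.ext (norm_eq_zero.1 h7)
    obtain ⟨w', hw'⟩ := (LinearMap.injective_iff_surjective.1 hinj)
      ((L n).orthogonalProjectionOnto (T w + ((1 - m : ℝ) : ℂ) • (w : H)))
    refine ⟨w', fun v => ?_⟩
    have h1 := hB w' v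
    rw [hw', Submodule.inner_orthogonalProjectionOnto_eq_of_mem_left, inner_add_right,
      inner_smul_right, ← hcomp w v (hL n v.2)] at h1
    rw [map_sub, LinearMap.sub_apply, inner_sub_right]
    push_cast at h1
    linear_combination h1
  choose w' hw' using key
  refine ⟨w', ?_, hw'⟩
  obtain ⟨u, hu, hut⟩ := hLdense w (hdomt w.2)
  refine squeeze_zero (fun n => (sq_nonneg _).trans
    (aux_norm_le hlb htn (sub_mem (hdomt w.2) (hL n (w' n).2)))) (fun n => ?_) hut
  -- Pythagoras
  set a : H := (w : H) - w' n with ha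
  set b : H := (w' n : H) - u n with hb
  have hbL : b ∈ L n := sub_mem (w' n).2 (hu n)
  have hadt : a ∈ dt := sub_mem (hdomt w.2) (hL n (w' n).2)
  have hsum : (w : H) - u n = a + b := by simp [ha, hb]
  have h1 : t a b = (m - 1) * ⟪b, a⟫ := hw' n ⟨b, hbL⟩
  have h2 : t b a = starRingEnd ℂ (t a b) := therm _ hadt _ (hL n hbL)
  have h3 : (t a b).re = (m - 1) * (⟪b, a⟫ : ℂ).re := by
    rw [h1, ← Complex.ofReal_one, ← Complex.ofReal_sub, Complex.re_ofReal_mul]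
  have h4 : (t b a).re = (m - 1) * (⟪b, a⟫ : ℂ).re := by rw [h2, Complex.conj_re, h3]
  have h5 : ‖a + b‖ ^ 2 = ‖a‖ ^ 2 + 2 * (⟪b, a⟫ : ℂ).re + ‖b‖ ^ 2 := by
    rw [norm_add_sq (𝕜 := ℂ), ← inner_conj_symm b a, Complex.conj_re]; rfl
  have h6 := hlb b (hL n hbL)
  rw [hsum, htn, htn, h5]
  simp only [map_add, LinearMap.add_apply, Complex.add_re]
  rw [h3, h4]
  nlinarith [sq_nonneg ‖b‖]

theorem aux_residual
    (hcomp : ∀ φ : T.domain, ∀ ψ ∈ dt, t φ ψ = ⟪ψ, T φ⟫)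
    (hL : ∀ n, L n ≤ dt)
    (hTn : ∀ n, ∀ φ ψ : L n, (⟪ψ, Tn n φ⟫ : ℂ) = t (φ : H) (ψ : H))
    (z : ℂ) (n : ℕ) (w : T.domain) (w' : L n)
    (hw' : ∀ v : L n, t ((w : H) - w') v = (m - 1) * ⟪(v : H), (w : H) - w'⟫)
    (ψ : L n) (η : ℝ) (hη : 0 ≤ η)
    (hψ : ∀ v : L n, ‖t ψ v - z * ⟪(v : H), (ψ : H)⟫ - ⟪(v : H), T w - z • (w : H)⟫‖ ≤ η * ‖v‖) :
    ‖Tn n (ψ - w') - z • (ψ - w')‖ ≤ η + ‖(m - 1 - z : ℂ)‖ * ‖(w : H) - w'‖ := by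
  set R := Tn n (ψ - w') - z • (ψ - w') with hR
  have h1 : ∀ v : L n, (⟪v, R⟫ : ℂ) =
      (t ψ v - z * ⟪(v : H), (ψ : H)⟫ - ⟪(v : H), T w - z • (w : H)⟫)
        + (m - 1 - z) * ⟪(v : H), (w : H) - w'⟫ := by
    intro v
    have h2 := hw' v
    have h3 := hcomp w v (hL n v.2)
    rw [hR, inner_sub_right, hTn, inner_smul_right, Submodule.coe_inner]
    simp only [Submodule.coe_sub, map_sub, LinearMap.sub_apply, inner_sub_right, inner_smul_right]
      at h2 ⊢
    linear_combination h2 - h3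
  have h4 : ‖R‖ ^ 2 ≤ (η + ‖(m - 1 - z : ℂ)‖ * ‖(w : H) - w'‖) * ‖R‖ := by
    have h5 : ‖R‖ ^ 2 = ‖(⟪R, R⟫ : ℂ)‖ := by
      rw [inner_self_eq_norm_sq_to_K]; simp
    rw [h5, h1 R]
    refine (norm_add_le _ _).trans ?_
    rw [norm_mul, add_mul, mul_assoc]
    refine add_le_add (hψ R) (mul_le_mul_of_nonneg_left ?_ (norm_nonneg _))
    rw [mul_comm]
    exact norm_inner_le_norm (R : H) _
  rcases (norm_nonneg R).eq_or_lt with h | h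
  · rw [← h]; positivity
  · rw [sq] at h4
    exact le_of_mul_le_mul_right h4 h

theorem aux_small (hlb : ∀ φ ∈ dt, m * ‖φ‖ ^ 2 ≤ (t φ φ).re)
    (htn : ∀ φ, tnormSq φ = (t φ φ).re - m * ‖φ‖ ^ 2 + ‖φ‖ ^ 2)
    (hL : ∀ n, L n ≤ dt)
    (hTn : ∀ n, ∀ φ ψ : L n, (⟪ψ, Tn n φ⟫ : ℂ) = t (φ : H) (ψ : H))
    (z : ℂ) (q : ∀ n, L n) (h0 : Tendsto (fun n => ‖q n‖) atTop (nhds 0))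
    (h1 : Tendsto (fun n => ‖Tn n (q n) - z • q n‖) atTop (nhds 0)) :
    Tendsto (fun n => tnormSq (q n)) atTop (nhds 0) := by
  have hlim : Tendsto (fun n => ‖q n‖ * ‖Tn n (q n) - z • q n‖ + (‖z‖ + |1 - m|) * ‖q n‖ ^ 2)
      atTop (nhds 0) := by
    have := (h0.mul h1).add ((h0.pow 2).const_mul (‖z‖ + |1 - m|))
    simpa using this
  refine squeeze_zero (fun n => (sq_nonneg _).trans (aux_norm_le hlb htn (hL n (q n).2)))
    (fun n => ?_) hlim
  have h2 : t (q n) (q n) = ⟪q n, Tn n (q n) - z • q n⟫ + z * ((‖q n‖ : ℝ) : ℂ) ^ 2 := by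
    rw [inner_sub_right, hTn, inner_smul_right, inner_self_eq_norm_sq_to_K]
    simp
  have h3 : (t (q n) (q n)).re ≤ ‖q n‖ * ‖Tn n (q n) - z • q n‖ + ‖z‖ * ‖q n‖ ^ 2 := by
    refine (Complex.re_le_norm _).trans ?_
    rw [h2]
    refine (norm_add_le _ _).trans (add_le_add (norm_inner_le_norm _ _) ?_)
    rw [norm_mul, norm_pow, Complex.norm_real, norm_norm]
  rw [htn]
  have h4 : ‖((q n : L n) : H)‖ = ‖q n‖ := rfl
  rw [h4]
  nlinarith [mul_le_mul_of_nonneg_right (le_abs_self (1 - m)) (sq_nonneg ‖q n‖)]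

theorem aux_split
    (therm : ∀ φ ∈ dt, ∀ ψ ∈ dt, t ψ φ = starRingEnd ℂ (t φ ψ))
    (hlb : ∀ φ ∈ dt, m * ‖φ‖ ^ 2 ≤ (t φ φ).re)
    (htn : ∀ φ, tnormSq φ = (t φ φ).re - m * ‖φ‖ ^ 2 + ‖φ‖ ^ 2)
    (hL : ∀ n, L n ≤ dt)
    (hTn : ∀ n, ∀ φ ψ : L n, (⟪ψ, Tn n φ⟫ : ℂ) = t (φ : H) (ψ : H))
    (z : ℂ) (r : ℝ) (hr : 0 < r) (q : ∀ n, L n)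
    (h1 : Tendsto (fun n => ‖Tn n (q n) - z • q n‖) atTop (nhds 0)) :
    ∃ p : ∀ n, L n, (∀ n, (p n : H) ∈ enclosedSubspace L Tn n z r) ∧
      Tendsto (fun n => tnormSq ((q n : H) - p n)) atTop (nhds 0) := by
  have key := fun n => aux_sym_split (Tn n) (aux_sym therm hL hTn n) z r hr (q n)
  choose p hp hp1 hp2 using key
  refine ⟨p, fun n => Submodule.mem_map_of_mem (hp n), ?_⟩
  refine aux_small hlb htn hL hTn z (fun n => q n - p n) ?_ ?_
  · have : Tendsto (fun n => r⁻¹ * ‖Tn n (q n) - z • q n‖) atTop (nhds 0) := by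
      simpa using h1.const_mul r⁻¹
    refine squeeze_zero (fun n => norm_nonneg _) (fun n => ?_) this
    rw [inv_mul_eq_div, le_div_iff₀ hr, mul_comm]
    exact hp1 n
  · exact squeeze_zero (fun n => norm_nonneg _) hp2 h1

theorem aux_coeff {d : ℕ} (v : Fin d → H) (hv : Orthonormal ℂ v) (s : Fin d → H)
    (E : Submodule ℂ H) [FiniteDimensional ℂ E] (hs : ∀ i, s i ∈ E)
    (hE : Module.finrank ℂ E = d) (hsmall : ∑ i, ‖s i - v i‖ ≤ 1 / 2) (p : H) (hp : p ∈ E) :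
    ∃ c : Fin d → ℂ, p = ∑ i, c i • s i ∧ ∀ i, ‖c i‖ ≤ 2 * ‖p‖ := by
  have hbd : ∀ c : Fin d → ℂ, ‖c‖ ≤ 2 * ‖∑ i, c i • s i‖ := by
    intro c
    have h1 : ‖c‖ ≤ ‖∑ i, c i • s i‖ + ‖c‖ * (1 / 2) := by
      rw [pi_norm_le_iff_of_nonneg (by positivity)]
      intro i
      have h2 : c i = ⟪v i, ∑ j, c j • v j⟫ := (hv.inner_right_fintype c i).symm
      have h3 : ∑ j, c j • v j = ∑ j, c j • s j - ∑ j, c j • (s j - v j) := by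
        rw [← Finset.sum_sub_distrib]
        refine Finset.sum_congr rfl fun j _ => ?_
        rw [smul_sub, sub_sub_cancel]
      calc ‖c i‖ ≤ ‖v i‖ * ‖∑ j, c j • v j‖ := by
            conv_lhs => rw [h2]
            exact norm_inner_le_norm _ _
        _ = ‖∑ j, c j • s j - ∑ j, c j • (s j - v j)‖ := by rw [hv.1 i, one_mul, h3]
        _ ≤ ‖∑ j, c j • s j‖ + ‖∑ j, c j • (s j - v j)‖ := norm_sub_le _ _
        _ ≤ ‖∑ j, c j • s j‖ + ‖c‖ * (1 / 2) := by
            gcongr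
            refine (norm_sum_le _ _).trans ?_
            calc ∑ j, ‖c j • (s j - v j)‖ ≤ ∑ j, ‖c‖ * ‖s j - v j‖ := by
                  refine Finset.sum_le_sum fun j _ => ?_
                  rw [norm_smul]
                  gcongr
                  exact norm_le_pi_norm c j
              _ = ‖c‖ * ∑ j, ‖s j - v j‖ := by rw [Finset.mul_sum]
              _ ≤ _ := by gcongr
    linarith
  let S : (Fin d → ℂ) →ₗ[ℂ] E := Fintype.linearCombination ℂ (fun i => (⟨s i, hs i⟩ : E))
  have hS : ∀ c, ((S c : E) : H) = ∑ i, c i • s i := by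
    intro c
    simp [S, Fintype.linearCombination_apply]
  have hinj : Function.Injective S := by
    rw [injective_iff_map_eq_zero]
    intro c hc
    have := hbd c
    rw [← hS, hc] at this
    simpa using this
  have hsurj := (LinearMap.injective_iff_surjective_of_finrank_eq_finrank
    (by rw [hE]; simp)).1 hinj
  obtain ⟨c, hc⟩ := hsurj ⟨p, hp⟩
  have hpc : p = ∑ i, c i • s i := by rw [← hS, hc]
  refine ⟨c, hpc, fun i => (norm_le_pi_norm c i).trans ?_⟩
  rw [hpc]; exact hbd c

theorem aux_cluster
    (hdomt : T.domain ≤ dt)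
    (therm : ∀ φ ∈ dt, ∀ ψ ∈ dt, t ψ φ = starRingEnd ℂ (t φ ψ))
    (hcomp : ∀ φ : T.domain, ∀ ψ ∈ dt, t φ ψ = ⟪ψ, T φ⟫)
    (hlb : ∀ φ ∈ dt, m * ‖φ‖ ^ 2 ≤ (t φ φ).re)
    (htn : ∀ φ, tnormSq φ = (t φ φ).re - m * ‖φ‖ ^ 2 + ‖φ‖ ^ 2)
    (hL : ∀ n, L n ≤ dt)
    (hLdense : ∀ φ ∈ dt, ∃ u : ℕ → H, (∀ n, u n ∈ L n) ∧
      Tendsto (fun n => tnormSq (φ - u n)) atTop (nhds 0))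
    (hTn : ∀ n, ∀ φ ψ : L n, (⟪ψ, Tn n φ⟫ : ℂ) = t (φ : H) (ψ : H))
    (z : ℂ) (r : ℝ) (hr : 0 < r) [FiniteDimensional ℂ (pmEigenspace T z)]
    (hdim : ∀ᶠ n in atTop, Module.finrank ℂ (enclosedSubspace L Tn n z r)
        = Module.finrank ℂ (pmEigenspace T z))
    (ψ : ∀ n, L n) (hbd : ∃ C, ∀ n, ‖ψ n‖ ≤ C)
    (h1 : Tendsto (fun n => ‖Tn n (ψ n) - z • ψ n‖) atTop (nhds 0)) :
    ∃ y : ℕ → H, (∀ n, y n ∈ pmEigenspace T z) ∧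
      Tendsto (fun n => tnormSq ((ψ n : H) - y n)) atTop (nhds 0) := by
  classical
  obtain ⟨p, hpE, hpt⟩ := aux_split therm hlb htn hL hTn z r hr ψ h1
  let b := stdOrthonormalBasis ℂ (pmEigenspace T z)
  let v : Fin (Module.finrank ℂ (pmEigenspace T z)) → H := fun i => b i
  have hvK : ∀ i, v i ∈ pmEigenspace T z := fun i => (b i).2
  have hv : Orthonormal ℂ v := b.orthonormal.comp_linearIsometry (pmEigenspace T z).subtypeₗᵢ
  have hvdt : ∀ i, v i ∈ dt := fun i => hdomt (hvK i).1
  have hsex : ∀ i, ∃ s : ∀ n, L n, (∀ n, (s n : H) ∈ enclosedSubspace L Tn n z r) ∧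
      Tendsto (fun n => tnormSq ((s n : H) - v i)) atTop (nhds 0) := by
    intro i
    obtain ⟨hd, hTv⟩ := hvK i
    obtain ⟨w', hw1, hw2⟩ := aux_ritz hdomt therm hcomp hlb htn hL hLdense hTn ⟨v i, hd⟩
    have hneg : ∀ (f : ℕ → H), Tendsto (fun n => tnormSq (f n)) atTop (nhds 0) →
        Tendsto (fun n => tnormSq (- f n)) atTop (nhds 0) := by
      intro f hf
      refine hf.congr fun n => ?_
      have := aux_smul htn (-1) (f n)
      simpa using this.symm
    have hres : Tendsto (fun n => ‖Tn n (w' n) - z • w' n‖) atTop (nhds 0) := by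
      have hlim : Tendsto (fun n => (0 : ℝ) + ‖(m - 1 - z : ℂ)‖ * ‖v i - w' n‖) atTop (nhds 0) := by
        have := (aux_norm_tendsto hlb htn (fun n => sub_mem (hvdt i) (hL n (w' n).2)) hw1).const_mul
          ‖(m - 1 - z : ℂ)‖
        simpa using this
      refine squeeze_zero (fun n => norm_nonneg _) (fun n => ?_) hlim
      have := aux_residual hcomp hL hTn z n ⟨v i, hd⟩ (w' n) (hw2 n) 0 0 le_rfl (by
        intro u
        rw [hTv]; simp)
      refine le_trans (le_of_eq ?_) this
      rw [zero_sub, map_neg, smul_neg, neg_sub_neg, norm_sub_rev]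
    obtain ⟨s, hs1, hs2⟩ := aux_split therm hlb htn hL hTn z r hr w' hres
    refine ⟨s, hs1, ?_⟩
    have := hneg _ (aux_tendsto_add hlb htn (fun n => sub_mem (hvdt i) (hL n (w' n).2))
      (fun n => sub_mem (hL n (w' n).2) (hL n (s n).2)) hw1 hs2)
    refine this.congr fun n => ?_
    congr 1
    simp
  choose s hsE hst using hsex
  have hsdt : ∀ i n, (s i n : H) - v i ∈ dt := fun i n => sub_mem (hL n (s i n).2) (hvdt i)
  have hsum : Tendsto (fun n => ∑ i, ‖(s i n : H) - v i‖) atTop (nhds 0) := by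
    have := tendsto_finsetSum Finset.univ (fun i _ => aux_norm_tendsto hlb htn (hsdt i) (hst i))
    simpa using this
  have hev : ∀ᶠ n in atTop, Module.finrank ℂ (enclosedSubspace L Tn n z r)
        = Module.finrank ℂ (pmEigenspace T z) ∧ ∑ i, ‖(s i n : H) - v i‖ ≤ 1 / 2 :=
    hdim.and (hsum.eventually_le_const (by norm_num))
  have hc : ∀ n, ∃ c : Fin (Module.finrank ℂ (pmEigenspace T z)) → ℂ,
      ((Module.finrank ℂ (enclosedSubspace L Tn n z r)
        = Module.finrank ℂ (pmEigenspace T z) ∧ ∑ i, ‖(s i n : H) - v i‖ ≤ 1 / 2) →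
        (p n : H) = ∑ i, c i • (s i n : H)) ∧ ∀ i, ‖c i‖ ≤ 2 * ‖(p n : H)‖ := by
    intro n
    by_cases hn : Module.finrank ℂ (enclosedSubspace L Tn n z r)
        = Module.finrank ℂ (pmEigenspace T z) ∧ ∑ i, ‖(s i n : H) - v i‖ ≤ 1 / 2
    · have : FiniteDimensional ℂ (enclosedSubspace L Tn n z r) := by
        unfold enclosedSubspace; infer_instance
      obtain ⟨c, hc1, hc2⟩ := aux_coeff v hv (fun i => (s i n : H)) (enclosedSubspace L Tn n z r)
        (fun i => hsE i n) hn.1 hn.2 (p n) (hpE n)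
      exact ⟨c, fun _ => hc1, hc2⟩
    · exact ⟨0, fun h => absurd h hn, fun i => by simp⟩
  choose c hc1 hc2 using hc
  obtain ⟨C, hC⟩ := hbd
  have hdiff := aux_norm_tendsto hlb htn (fun n => sub_mem (hL n (ψ n).2) (hL n (p n).2)) hpt
  obtain ⟨D, hD⟩ := hdiff.bddAbove_range
  have hpb : ∀ n, ‖(p n : H)‖ ≤ C + D := by
    intro n
    have e1 : (p n : H) = ψ n - ((ψ n : H) - p n) := by simp
    have e2 : ‖(ψ n : H)‖ ≤ C := hC n
    have e3 : ‖(ψ n : H) - p n‖ ≤ D := hD ⟨n, rfl⟩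
    calc ‖(p n : H)‖ = ‖(ψ n : H) - ((ψ n : H) - p n)‖ := by rw [← e1]
      _ ≤ _ := (norm_sub_le _ _).trans (add_le_add e2 e3)
  refine ⟨fun n => ∑ i, c n i • v i, fun n => sum_mem fun i _ => Submodule.smul_mem _ _ (hvK i), ?_⟩
  have hlast : Tendsto (fun n => tnormSq (∑ i, c n i • ((s i n : H) - v i))) atTop (nhds 0) := by
    refine aux_tendsto_sum hlb htn Finset.univ (a := fun i n => c n i • ((s i n : H) - v i))
      (fun i n => Submodule.smul_mem _ _ (hsdt i n)) (fun i => ?_)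
    have hlim : Tendsto (fun n => (2 * (C + D)) ^ 2 * tnormSq ((s i n : H) - v i)) atTop
        (nhds 0) := by
      simpa using (hst i).const_mul ((2 * (C + D)) ^ 2)
    refine squeeze_zero (fun n => (sq_nonneg _).trans (aux_norm_le hlb htn
      (Submodule.smul_mem _ _ (hsdt i n)))) (fun n => ?_) hlim
    rw [aux_smul htn]
    have h0 := (sq_nonneg _).trans (aux_norm_le hlb htn (hsdt i n))
    have h2 : ‖c n i‖ ≤ 2 * (C + D) := (hc2 n i).trans (by linarith [hpb n])
    gcongr
  have := aux_tendsto_add hlb htn (fun n => sub_mem (hL n (ψ n).2) (hL n (p n).2))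
    (fun n => sum_mem fun i _ => Submodule.smul_mem _ _ (hsdt i n)) hpt hlast
  refine this.congr' ?_
  filter_upwards [hev] with n hn
  congr 1
  simp only [smul_sub, Finset.sum_sub_distrib]
  rw [← hc1 n hn]
  abel

theorem aux_weak_sol
    (hsa : IsSelfAdjoint T)
    (hdomt : T.domain ≤ dt)
    (therm : ∀ φ ∈ dt, ∀ ψ ∈ dt, t ψ φ = starRingEnd ℂ (t φ ψ))
    (hcomp : ∀ φ : T.domain, ∀ ψ ∈ dt, t φ ψ = ⟪ψ, T φ⟫)
    (hlb : ∀ φ ∈ dt, m * ‖φ‖ ^ 2 ≤ (t φ φ).re)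
    (htn : ∀ φ, tnormSq φ = (t φ φ).re - m * ‖φ‖ ^ 2 + ‖φ‖ ^ 2)
    (hL : ∀ n, L n ≤ dt)
    (hLdense : ∀ φ ∈ dt, ∃ u : ℕ → H, (∀ n, u n ∈ L n) ∧
      Tendsto (fun n => tnormSq (φ - u n)) atTop (nhds 0))
    (hTn : ∀ n, ∀ φ ψ : L n, (⟪ψ, Tn n φ⟫ : ℂ) = t (φ : H) (ψ : H))
    (z : ℂ) (f : ∀ n, L n) (hbd : ∃ C, ∀ n, ‖(f n : H)‖ ≤ C) (y : H)
    (η : ℕ → ℝ) (hη : Tendsto η atTop (nhds 0))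
    (hres : ∀ n, ∀ v : L n, ‖t (f n) v - z * ⟪(v : H), (f n : H)⟫ - ⟪(v : H), y⟫‖ ≤ η n * ‖v‖) :
    ∃ w : T.domain, T w - z • (w : H) = y := by
  obtain ⟨F, p, hF, hp⟩ := aux_weak (fun n => (f n : H)) hbd
  obtain ⟨C, hC⟩ := hbd
  have key : ∀ v : T.domain, (⟪p, T v - starRingEnd ℂ z • (v : H)⟫ : ℂ) = ⟪y, (v : H)⟫ := by
    intro v
    obtain ⟨v', hv1, hv2⟩ := aux_ritz hdomt therm hcomp hlb htn hL hLdense hTn v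
    have hv3 := aux_norm_tendsto hlb htn (fun n => sub_mem (hdomt v.2) (hL n (v' n).2)) hv1
    have hlim : Tendsto (fun n => (⟪(f n : H), T v - starRingEnd ℂ z • (v : H)⟫ : ℂ)
        - ⟪y, (v : H)⟫) atTop (nhds 0) := by
      have hl2 : Tendsto (fun n => (‖(m - 1 - starRingEnd ℂ z : ℂ)‖ * C + ‖y‖) * ‖(v : H) - v' n‖
          + |η n| * (‖(v : H)‖ + ‖(v : H) - v' n‖)) atTop (nhds 0) := by
        have := (hv3.const_mul (‖(m - 1 - starRingEnd ℂ z : ℂ)‖ * C + ‖y‖)).add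
          (hη.abs.mul (hv3.const_add ‖(v : H)‖))
        simpa using this
      refine squeeze_zero_norm (fun n => ?_) hl2
      have e1 := hv2 n (f n)
      have e2 := hcomp v (f n) (hL n (f n).2)
      have e3 := therm _ (hL n (f n).2) _ (hL n (v' n).2)
      set ρ := t (f n) (v' n) - z * ⟪(v' n : H), (f n : H)⟫ - ⟪(v' n : H), y⟫ with hρ
      have e4 : (⟪(f n : H), T v - starRingEnd ℂ z • (v : H)⟫ : ℂ) - ⟪y, (v : H)⟫ =
          (m - 1 - starRingEnd ℂ z) * ⟪(f n : H), (v : H) - v' n⟫ - ⟪y, (v : H) - v' n⟫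
            + starRingEnd ℂ ρ := by
        have e5 : starRingEnd ℂ ρ = t (v' n) (f n) - starRingEnd ℂ z * ⟪(f n : H), (v' n : H)⟫
            - ⟪y, (v' n : H)⟫ := by
          rw [hρ, map_sub, map_sub, map_mul, ← e3, inner_conj_symm, inner_conj_symm]
        rw [e5]
        simp only [map_sub, LinearMap.sub_apply, inner_sub_right, inner_smul_right] at e1 ⊢
        linear_combination e1 - e2
      rw [e4]
      refine (norm_add_le _ _).trans (add_le_add ((norm_sub_le _ _).trans ?_) ?_)
      · rw [add_mul, norm_mul, mul_assoc]
        refine add_le_add (mul_le_mul_of_nonneg_left ?_ (norm_nonneg _)) (norm_inner_le_norm _ _)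
        exact (norm_inner_le_norm _ _).trans (mul_le_mul_of_nonneg_right (hC n) (norm_nonneg _))
      · rw [RCLike.norm_conj]
        refine (hres n (v' n)).trans ?_
        have e6 : ‖v' n‖ ≤ ‖(v : H)‖ + ‖(v : H) - v' n‖ := by
          have : (v' n : H) = v - ((v : H) - v' n) := by simp
          calc ‖v' n‖ = ‖(v : H) - ((v : H) - v' n)‖ := by rw [← this]; rfl
            _ ≤ _ := norm_sub_le _ _
        exact mul_le_mul (le_abs_self _) e6 (norm_nonneg _) (abs_nonneg _)
    have h2 := (hp (T v - starRingEnd ℂ z • (v : H))).sub_const (⟪y, (v : H)⟫ : ℂ)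
    have h3 := tendsto_nhds_unique h2 (hlim.mono_left hF)
    exact sub_eq_zero.1 h3
  have key2 : ∀ v : T.domain, (⟪y + z • p, (v : H)⟫ : ℂ) = ⟪p, T v⟫ := by
    intro v
    have := key v
    rw [inner_sub_right, inner_smul_right] at this
    rw [inner_add_left, inner_smul_left, ← this]
    ring
  have h4 : ∃ h : p ∈ T.adjoint.domain, T.adjoint ⟨p, h⟩ = y + z • p := by
    have h := LinearPMap.mem_adjoint_domain_of_exists p ⟨y + z • p, key2⟩
    exact ⟨h, LinearPMap.adjoint_apply_eq hsa.dense_domain ⟨p, h⟩ key2⟩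
  rw [LinearPMap.isSelfAdjoint_def.1 hsa] at h4
  obtain ⟨h, h5⟩ := h4
  exact ⟨⟨p, h⟩, by rw [h5]; simp⟩

end form

/-- **Lemma (Blemma).** -/
theorem stmt_5
    -- `T` is a semi-bounded self-adjoint operator with `m = min σ(T)`
    (T : H →ₗ.[ℂ] H) (hsa : IsSelfAdjoint T)
    (m : ℝ) (hm : IsLeast {x : ℝ | (x : ℂ) ∈ pmSpectrum T} m)
    -- `t` is the closed sesquilinear form associated to `T`
    (dt : Submodule ℂ H) (t : H →ₗ[ℂ] H →ₗ⋆[ℂ] ℂ)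
    (hdomt : T.domain ≤ dt)
    (therm : ∀ φ ∈ dt, ∀ ψ ∈ dt, t ψ φ = starRingEnd ℂ (t φ ψ))
    (hcomp : ∀ φ : T.domain, ∀ ψ ∈ dt, t φ ψ = ⟪ψ, T φ⟫)
    (hlb : ∀ φ ∈ dt, m * ‖φ‖ ^ 2 ≤ (t φ φ).re)
    (tnormSq : H → ℝ)
    (htn : ∀ φ, tnormSq φ = (t φ φ).re - m * ‖φ‖ ^ 2 + ‖φ‖ ^ 2)
    (hclosed : ∀ u : ℕ → H, (∀ k, u k ∈ dt) →
      (∀ ε > 0, ∃ N, ∀ j ≥ N, ∀ k ≥ N, tnormSq (u j - u k) < ε) →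
      ∃ φ ∈ dt, Tendsto (fun k => tnormSq (u k - φ)) atTop (nhds 0))
    -- `A` is a closed `|T|^(1/2)`-compact operator defined (at least) on `Dom t`
    (A : H →ₗ.[ℂ] H) (hdomA : dt ≤ A.domain)
    (hAclosed : IsClosed (A.graph : Set (H × H)))
    (hAcpt : ∀ (u : ℕ → H) (hu : ∀ k, u k ∈ dt), (∃ C, ∀ k, tnormSq (u k) ≤ C) →
      ∃ (g : ℕ → ℕ) (v : H), StrictMono g ∧
        Tendsto (fun k => A ⟨u (g k), hdomA (hu (g k))⟩) atTop (nhds v))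
    -- `(T+A)* = T + A*`
    (hTAadj : (T + A).adjoint = T + A.adjoint)
    -- the relative form bound
    (α β : ℝ) (hα0 : 0 ≤ α) (hα1 : α < 1) (hβ : 0 ≤ β)
    (hbound : ∀ φ (hφ : φ ∈ dt), ‖(⟪φ, A ⟨φ, hdomA hφ⟩⟫ : ℂ)‖ ≤ α * (t φ φ).re + β * ‖φ‖ ^ 2)
    -- trial spaces
    (L : ℕ → Submodule ℂ H) (hL : ∀ n, L n ≤ dt)
    [∀ n, FiniteDimensional ℂ (L n)]
    (hLdense : ∀ φ ∈ dt, ∃ u : ℕ → H, (∀ n, u n ∈ L n) ∧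
      Tendsto (fun n => tnormSq (φ - u n)) atTop (nhds 0))
    -- compressions of the form `t`
    (Tn : ∀ n, L n →ₗ[ℂ] L n)
    (hTn : ∀ n, ∀ φ ψ : L n, (⟪ψ, Tn n φ⟫ : ℂ) = t (φ : H) (ψ : H))
    -- `U` is a `T_n`-uniform set
    (U : Set ℂ) (hUopen : IsOpen U)
    (hU1 : ∀ Γ : Set ℂ, Γ ⊆ U ∩ pmResolventSet T → IsCompact Γ →
      ∃ δ > 0, ∃ N : ℕ, ∀ z ∈ Γ, ∀ n ≥ N, ∀ φ : L n, δ * ‖φ‖ ≤ ‖Tn n φ - z • φ‖)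
    (hU2 : U ∩ {w : ℂ | ∃ zs : ℕ → ℂ,
        (∀ n, zs n ∈ spectrum ℂ (Tn n : Module.End ℂ (L n))) ∧ Tendsto zs atTop (nhds w)}
      = U ∩ pmSpectrum T)
    (hU2' : U ∩ pmSpectrum T ⊆ pmDiscSpectrum T)
    (hU3 : ∀ μ ∈ pmSpectrum T ∩ U, ∀ r > 0, Metric.sphere μ r ⊆ U →
      (∀ w ∈ pmSpectrum T, w ∈ Metric.closedBall μ r → w = μ) →
      ∀ᶠ n in atTop, Module.finrank ℂ (enclosedSubspace L Tn n μ r)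
        = Module.finrank ℂ (pmEigenspace T μ))
    -- `z ∈ σ(T+A) ∩ U`, and a bounded sequence `φ n ∈ L n` with
    -- `max_{v ∈ L n, ‖v‖=1} |(s - z)(φ n, v) - ⟨x, v⟩| → 0`
    (z : ℂ) (hz : z ∈ pmSpectrum (T + A) ∩ U)
    (x : H) (φ : ℕ → H) (hφ : ∀ n, φ n ∈ L n)
    (hφbdd : ∃ C, ∀ n, ‖φ n‖ ≤ C)
    (ε : ℕ → ℝ) (hε : Tendsto ε atTop (nhds 0))
    (hconv : ∀ n, ∀ v ∈ L n, ‖v‖ = 1 →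
      ‖t (φ n) v + ⟪v, A ⟨φ n, hdomA (hL n (hφ n))⟩⟫ - z * ⟪v, φ n⟫ - ⟪v, x⟫‖ ≤ ε n) :
    ∃ (u : H) (g : ℕ → ℕ), StrictMono g ∧
      Tendsto (fun k => A ⟨φ (g k), hdomA (hL (g k) (hφ (g k)))⟩) atTop (nhds u) ∧
      -- `x - u ⊥ ker(T - z)`
      (∀ v ∈ pmEigenspace T z, ⟪v, x - u⟫ = (0 : ℂ)) ∧
      -- `dist_t (φ_{n_k} - (𝒯 - z)⁻¹(x - u), ker (T - z)) → 0`, where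
      -- `w = (𝒯 - z)⁻¹(x - u)` is the unique solution of `(T - z) w = x - u`
      -- orthogonal to `ker (T - z)`
      ∃ (w : H) (hw : w ∈ T.domain),
        (∀ v ∈ pmEigenspace T z, ⟪v, w⟫ = (0 : ℂ)) ∧
        T ⟨w, hw⟩ - z • w = x - u ∧
        Tendsto (fun k => tdist tnormSq (φ (g k) - w) (pmEigenspace T z)) atTop (nhds 0) := by
  obtain ⟨C, hC⟩ := hφbdd
  have hzU : z ∈ U := hz.2
  have hC0 : 0 ≤ C := (norm_nonneg _).trans (hC 0)
  -- homogeneity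
  have hconv' : ∀ n, ∀ v ∈ L n,
      ‖t (φ n) v + ⟪v, A ⟨φ n, hdomA (hL n (hφ n))⟩⟫ - z * ⟪v, φ n⟫ - ⟪v, x⟫‖ ≤ |ε n| * ‖v‖ := by
    intro n v hv
    by_cases h0 : v = 0
    · subst h0; simp
    have hvn : ‖v‖ ≠ 0 := norm_ne_zero_iff.2 h0
    have hvc : ((‖v‖ : ℝ) : ℂ) ≠ 0 := by exact_mod_cast hvn
    set v1 : H := ((‖v‖ : ℝ) : ℂ)⁻¹ • v with hv1
    have hv1L : v1 ∈ L n := Submodule.smul_mem _ _ hv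
    have hv1n : ‖v1‖ = 1 := by
      rw [hv1, norm_smul, norm_inv, Complex.norm_real, norm_norm, inv_mul_cancel₀ hvn]
    have hvv : v = ((‖v‖ : ℝ) : ℂ) • v1 := by
      rw [hv1, smul_smul, mul_inv_cancel₀ hvc, one_smul]
    have h := hconv n v1 hv1L hv1n
    have heq : t (φ n) v + ⟪v, A ⟨φ n, hdomA (hL n (hφ n))⟩⟫ - z * ⟪v, φ n⟫ - ⟪v, x⟫
        = ((‖v‖ : ℝ) : ℂ) * (t (φ n) v1 + ⟪v1, A ⟨φ n, hdomA (hL n (hφ n))⟩⟫ - z * ⟪v1, φ n⟫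
          - ⟪v1, x⟫) := by
      have i1 : ∀ a : H, (⟪v, a⟫ : ℂ) = ((‖v‖ : ℝ) : ℂ) * ⟪v1, a⟫ := by
        intro a
        conv_lhs => rw [hvv]
        rw [inner_smul_left, Complex.conj_ofReal]
      have i2 : t (φ n) v = ((‖v‖ : ℝ) : ℂ) * t (φ n) v1 := by
        conv_lhs => rw [hvv]
        rw [LinearMap.map_smulₛₗ, Complex.conj_ofReal, smul_eq_mul]
      rw [i1, i1, i1, i2]
      ring
    rw [heq, norm_mul, Complex.norm_real, norm_norm, mul_comm]
    exact mul_le_mul_of_nonneg_right (h.trans (le_abs_self _)) (norm_nonneg _)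
  obtain ⟨E, hE⟩ := hε.abs.bddAbove_range
  have hE' : ∀ n, |ε n| ≤ E := fun n => hE ⟨n, rfl⟩
  -- boundedness in the form norm
  have htb : ∃ M, ∀ n, tnormSq (φ n) ≤ M := by
    refine ⟨(β * C ^ 2 + ‖z‖ * C ^ 2 + ‖x‖ * C + E * C) / (1 - α) + |1 - m| * C ^ 2, fun n => ?_⟩
    have hn := hC n
    have hn0 := norm_nonneg (φ n)
    have hsq : ‖φ n‖ ^ 2 ≤ C ^ 2 := by gcongr
    have h1 := hconv' n (φ n) (hφ n)
    have h2 := hbound (φ n) (hL n (hφ n))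
    set a : ℂ := ⟪φ n, A ⟨φ n, hdomA (hL n (hφ n))⟩⟫ with ha
    set R := t (φ n) (φ n) + a - z * ⟪φ n, φ n⟫ - ⟪φ n, x⟫ with hR
    have h3 : t (φ n) (φ n) = R - a + z * ⟪φ n, φ n⟫ + ⟪φ n, x⟫ := by rw [hR]; ring
    have h4 : (t (φ n) (φ n)).re ≤ ‖R‖ + ‖a‖ + ‖z‖ * ‖φ n‖ ^ 2 + ‖φ n‖ * ‖x‖ := by
      refine (Complex.re_le_norm _).trans ?_
      rw [h3]
      refine (norm_add_le _ _).trans (add_le_add ((norm_add_le _ _).trans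
        (add_le_add (norm_sub_le _ _) ?_)) (norm_inner_le_norm _ _))
      rw [norm_mul, inner_self_eq_norm_sq_to_K]
      simp
    have h5 : ‖R‖ ≤ E * C :=
      h1.trans (mul_le_mul (hE' n) hn hn0 ((abs_nonneg _).trans (hE' n)))
    have h6 : β * ‖φ n‖ ^ 2 ≤ β * C ^ 2 := by gcongr
    have h7 : ‖z‖ * ‖φ n‖ ^ 2 ≤ ‖z‖ * C ^ 2 := by gcongr
    have h8 : ‖φ n‖ * ‖x‖ ≤ ‖x‖ * C := by rw [mul_comm]; gcongr
    have h9 : (t (φ n) (φ n)).re ≤ (β * C ^ 2 + ‖z‖ * C ^ 2 + ‖x‖ * C + E * C) / (1 - α) := by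
      rw [le_div_iff₀ (by linarith)]
      linarith
    have h10 : (1 - m) * ‖φ n‖ ^ 2 ≤ |1 - m| * C ^ 2 := by
      have := le_abs_self (1 - m)
      have := abs_nonneg (1 - m)
      gcongr
    rw [htn]
    linarith
  obtain ⟨g, u, hg, hgu⟩ := hAcpt φ (fun n => hL n (hφ n)) htb
  refine ⟨u, g, hg, hgu, ?_⟩
  have hgt : Tendsto g atTop atTop := hg.tendsto_atTop
  -- pass to the subsequence
  let L' : ℕ → Submodule ℂ H := fun k => L (g k)
  let Tn' : ∀ k, L' k →ₗ[ℂ] L' k := fun k => Tn (g k)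
  have hfin : ∀ k, FiniteDimensional ℂ (L' k) := fun k => inferInstanceAs
    (FiniteDimensional ℂ (L (g k)))
  have hL' : ∀ k, L' k ≤ dt := fun k => hL (g k)
  have hLdense' : ∀ φ ∈ dt, ∃ u : ℕ → H, (∀ n, u n ∈ L' n) ∧
      Tendsto (fun n => tnormSq (φ - u n)) atTop (nhds 0) := by
    intro ψ hψ
    obtain ⟨a, ha, hat⟩ := hLdense ψ hψ
    exact ⟨fun k => a (g k), fun k => ha (g k), hat.comp hgt⟩
  have hTn' : ∀ n, ∀ φ ψ : L' n, (⟪ψ, Tn' n φ⟫ : ℂ) = t (φ : H) (ψ : H) := fun k => hTn (g k)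
  let f : ∀ k, L' k := fun k => ⟨φ (g k), hφ (g k)⟩
  have hfb : ∀ k, ‖(f k : H)‖ ≤ C := fun k => hC (g k)
  let η : ℕ → ℝ := fun k => |ε (g k)| + ‖A ⟨φ (g k), hdomA (hL (g k) (hφ (g k)))⟩ - u‖
  have hη0 : ∀ k, 0 ≤ η k := fun k => by positivity
  have hη : Tendsto η atTop (nhds 0) := by
    have h1 := (hε.comp hgt).abs
    have h2 := (hgu.sub_const u).norm
    simpa using h1.add h2
  have hres : ∀ k, ∀ v : L' k,
      ‖t (f k) v - z * ⟪(v : H), (f k : H)⟫ - ⟪(v : H), x - u⟫‖ ≤ η k * ‖v‖ := by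
    intro k v
    have h1 := hconv' (g k) v v.2
    set Aφ := A ⟨φ (g k), hdomA (hL (g k) (hφ (g k)))⟩ with hAφ
    have h2 : t (f k) v - z * ⟪(v : H), (f k : H)⟫ - ⟪(v : H), x - u⟫ =
        (t (φ (g k)) v + ⟪(v : H), Aφ⟫ - z * ⟪(v : H), φ (g k)⟫ - ⟪(v : H), x⟫)
          - ⟪(v : H), Aφ - u⟫ := by
      simp only [inner_sub_right, f]
      ring
    rw [h2]
    refine (norm_sub_le _ _).trans ?_
    rw [add_mul]
    refine add_le_add h1 ((norm_inner_le_norm _ _).trans ?_)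
    rw [mul_comm]
    exact le_rfl
  obtain ⟨w0, hw0⟩ := aux_weak_sol hsa hdomt therm hcomp hlb htn hL' hLdense' hTn' z f ⟨C, hfb⟩
    (x - u) η hη hres
  -- `T` is symmetric
  have hTsym : ∀ a b : T.domain, (⟪T a, (b : H)⟫ : ℂ) = ⟪(a : H), T b⟫ := by
    have h := LinearPMap.adjoint_isFormalAdjoint (T := T) hsa.dense_domain
    rw [LinearPMap.isSelfAdjoint_def.1 hsa] at h
    exact h
  have hperp : ∀ v ∈ pmEigenspace T z, ⟪v, x - u⟫ = (0 : ℂ) := by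
    rintro v ⟨hvd, hTv⟩
    by_cases h0 : v = 0
    · rw [h0, inner_zero_left]
    have h1 := hTsym ⟨v, hvd⟩ ⟨v, hvd⟩
    rw [hTv, inner_smul_left, inner_smul_right] at h1
    have h2 : starRingEnd ℂ z = z := mul_right_cancel₀ (inner_self_ne_zero.2 h0) h1
    have h3 := hTsym ⟨v, hvd⟩ w0
    rw [hTv, inner_smul_left, h2] at h3
    rw [← hw0, inner_sub_right, inner_smul_right, ← h3, sub_self]
  refine ⟨hperp, ?_⟩
  have hKfin : FiniteDimensional ℂ (pmEigenspace T z) := by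
    by_cases hs : z ∈ pmSpectrum T
    · exact (hU2' ⟨hzU, hs⟩).2.2.2
    · have hr : z ∈ pmResolventSet T := not_not.1 hs
      obtain ⟨R, -, hR⟩ := hr
      have : pmEigenspace T z = ⊥ := by
        rw [eq_bot_iff]
        rintro v ⟨hvd, hTv⟩
        have := hR ⟨v, hvd⟩
        rw [hTv, sub_self, map_zero] at this
        exact this.symm
      rw [this]; infer_instance
  let P : H := (pmEigenspace T z).starProjection (w0 : H)
  have hP : P ∈ pmEigenspace T z := Submodule.starProjection_apply_mem _ _
  obtain ⟨hPd, hTP⟩ := id hP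
  let w : T.domain := w0 - ⟨P, hPd⟩
  have hTw : T w - z • (w : H) = x - u := by
    have h1 : T w = T w0 - z • P := by rw [← hTP]; exact T.map_sub _ _
    have h2 : (w : H) = w0 - P := rfl
    rw [h1, h2, ← hw0, smul_sub]
    abel
  refine ⟨w, w.2, ?_, hTw, ?_⟩
  · intro v hv
    have := Submodule.starProjection_inner_eq_zero (K := pmEigenspace T z) (w0 : H) v hv
    rw [← inner_conj_symm, show (w : H) = w0 - (pmEigenspace T z).starProjection (w0 : H) from rfl,
      this, map_zero]
  -- the Ritz projections of `w`
  obtain ⟨w', hw1, hw2⟩ := aux_ritz hdomt therm hcomp hlb htn hL' hLdense' hTn' w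
  have hwn := aux_norm_tendsto hlb htn (fun n => sub_mem (hdomt w.2) (hL' n (w' n).2)) hw1
  have hψres : Tendsto (fun k => ‖Tn' k (f k - w' k) - z • (f k - w' k)‖) atTop (nhds 0) := by
    have hlim : Tendsto (fun k => η k + ‖(m - 1 - z : ℂ)‖ * ‖(w : H) - w' k‖) atTop (nhds 0) := by
      simpa using hη.add (hwn.const_mul ‖(m - 1 - z : ℂ)‖)
    refine squeeze_zero (fun k => norm_nonneg _) (fun k => ?_) hlim
    refine aux_residual hcomp hL' hTn' z k w (w' k) (hw2 k) (f k) (η k) (hη0 k) ?_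
    intro v
    rw [hTw]
    exact hres k v
  have hψbd : ∃ D, ∀ k, ‖f k - w' k‖ ≤ D := by
    obtain ⟨D, hD⟩ := hwn.bddAbove_range
    refine ⟨C + (‖(w : H)‖ + D), fun k => ?_⟩
    have e3 : ‖(w : H) - w' k‖ ≤ D := hD ⟨k, rfl⟩
    have e4 : (w' k : H) = w - ((w : H) - w' k) := by simp
    have e5 : ‖(w' k : H)‖ ≤ ‖(w : H)‖ + D := by
      calc ‖(w' k : H)‖ = ‖(w : H) - ((w : H) - w' k)‖ := by rw [← e4]
        _ ≤ _ := (norm_sub_le _ _).trans (by gcongr)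
    exact (norm_sub_le _ _).trans (add_le_add (hfb k) e5)
  have hcl : ∃ y : ℕ → H, (∀ n, y n ∈ pmEigenspace T z) ∧
      Tendsto (fun n => tnormSq (((f n - w' n : L' n) : H) - y n)) atTop (nhds 0) := by
    by_cases hs : z ∈ pmSpectrum T
    · obtain ⟨-, ⟨ε₀, hε₀, hiso⟩, -, -⟩ := hU2' ⟨hzU, hs⟩
      obtain ⟨r₁, hr₁, hball⟩ := Metric.isOpen_iff.1 hUopen z hzU
      have hrpos : 0 < min (ε₀ / 2) (r₁ / 2) := by positivity
      refine aux_cluster hdomt therm hcomp hlb htn hL' hLdense' hTn' z (min (ε₀ / 2) (r₁ / 2)) hrpos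
        ?_ (fun k => f k - w' k) hψbd hψres
      refine hgt.eventually (hU3 z ⟨hs, hzU⟩ _ hrpos ?_ ?_)
      · intro a ha
        refine hball ?_
        rw [Metric.mem_sphere] at ha
        rw [Metric.mem_ball, ha]
        exact (min_le_right _ _).trans_lt (by linarith)
      · intro a ha hab
        by_contra hne
        have h1 := hiso a ha hne
        have h2 := Metric.mem_closedBall.1 hab
        have h3 := min_le_left (ε₀ / 2) (r₁ / 2)
        linarith
    · have hr : z ∈ pmResolventSet T := not_not.1 hs
      obtain ⟨δ, hδ, N, hN⟩ := hU1 {z} (by rintro a rfl; exact ⟨hzU, hr⟩) isCompact_singleton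
      refine ⟨fun _ => 0, fun _ => zero_mem _, ?_⟩
      simp only [sub_zero]
      refine aux_small hlb htn hL' hTn' z (fun k => f k - w' k) ?_ hψres
      have hlim : Tendsto (fun k => δ⁻¹ * ‖Tn' k (f k - w' k) - z • (f k - w' k)‖) atTop
          (nhds 0) := by
        simpa using hψres.const_mul δ⁻¹
      refine squeeze_zero' (Eventually.of_forall fun k => norm_nonneg _) ?_ hlim
      filter_upwards [hgt.eventually_ge_atTop N] with k hk
      rw [inv_mul_eq_div, le_div_iff₀ hδ, mul_comm]
      exact hN z rfl (g k) hk (f k - w' k)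
  obtain ⟨y, hyK, hyt⟩ := hcl
  have hydt : ∀ n, y n ∈ dt := fun n => hdomt (hyK n).1
  have hneg : Tendsto (fun n => tnormSq ((w' n : H) - w)) atTop (nhds 0) := by
    refine hw1.congr fun n => ?_
    have h1 := aux_smul htn (-1) ((w : H) - w' n)
    rw [neg_one_smul, neg_sub] at h1
    rw [h1]; simp
  have hfinal := aux_tendsto_add hlb htn (fun n => sub_mem (hL' n (f n - w' n).2) (hydt n))
    (fun n => sub_mem (hL' n (w' n).2) (hdomt w.2)) hyt hneg
  have hsq : Tendsto (fun k => Real.sqrt (tnormSq (φ (g k) - w - y k))) atTop (nhds 0) := by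
    have h1 := hfinal.sqrt
    rw [Real.sqrt_zero] at h1
    refine h1.congr fun k => ?_
    congr 2
    simp only [Submodule.coe_sub, f]
    abel
  refine squeeze_zero (fun k => ?_) (fun k => ?_) hsq
  · refine Real.sInf_nonneg ?_
    rintro _ ⟨a, -, rfl⟩
    exact Real.sqrt_nonneg _
  · refine csInf_le ⟨0, ?_⟩ ⟨y k, hyK k, rfl⟩
    rintro _ ⟨a, -, rfl⟩
    exact Real.sqrt_nonneg _
end
end

section
/- Let X ⊂ U(a,b) be compact, set d_X = dist(X, σ(T)\Δ) and d_Δ = dist({λ_1+i, …, λ_d+i}, X). Let Q be an orthogonal projection on H, ε = ‖(I − Q)E(Δ)‖, and c = min{d_X − 1 − 2ε, d_Δ − 3ε}. Then ‖(T + iQ − z)u‖ ≥ c‖u‖ for all z ∈ X and all u ∈ Dom(T). -/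
open scoped ComplexInnerProductSpace

noncomputable section

variable {H : Type*} [NormedAddCommGroup H] [InnerProductSpace ℂ H] [CompleteSpace H]

/-- The region `U(a,b)`: all `z` with `a < Re z < b` lying in the exterior of the two circles
of radius `1` centred at `a` and at `b`, and with `z ≠ λ_j + i` for all `j`. -/
def Uab (a b : ℝ) {d : ℕ} (lam : Fin d → ℝ) : Set ℂ :=
  {z | a < z.re ∧ z.re < b ∧ 1 < dist z (a : ℂ) ∧ 1 < dist z (b : ℂ) ∧
    ∀ j, z ≠ (lam j : ℂ) + Complex.I}


theorem aux_key (A : H →L[ℂ] H) (hA : IsSelfAdjoint A) (ζ : ℂ) (δ : ℝ)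
    (hδ : 0 ≤ δ)
    (h : ∀ μ ∈ spectrum ℝ A, μ ≠ 0 → δ * |μ| ≤ ‖1 - ζ * (μ : ℂ)‖) (w : H) :
    δ * ‖A w‖ ≤ ‖w - ζ • A w‖ := by
  have hnn : 0 ≤ cfc (fun x : ℝ => 1 - (2 * ζ.re) * x + (‖ζ‖ ^ 2 - δ ^ 2) * x ^ 2) A := by
    apply cfc_nonneg
    intro x hx
    by_cases h0 : x = 0
    · simp [h0]
    · have h1 := h x hx h0
      have h2 := mul_self_le_mul_self (by positivity) h1
      rw [← sq, ← sq, mul_pow, sq_abs, Complex.sq_norm, Complex.normSq_apply] at h2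
      rw [Complex.sq_norm, Complex.normSq_apply]
      simp at h2
      nlinarith
  have heq : cfc (fun x : ℝ => 1 - (2 * ζ.re) * x + (‖ζ‖ ^ 2 - δ ^ 2) * x ^ 2) A
      = 1 - (2 * ζ.re) • A + (‖ζ‖ ^ 2 - δ ^ 2) • A ^ 2 := by
    rw [cfc_add .., cfc_sub .., cfc_const_mul .., cfc_const_mul .., cfc_id' ℝ A, cfc_pow_id A 2,
      cfc_const_one ℝ A]
  rw [heq, ContinuousLinearMap.nonneg_iff_isPositive] at hnn
  have h3 := hnn.re_inner_nonneg_right w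
  have hsym := hA.isSymmetric
  have h4 : (inner ℂ w (A (A w)) : ℂ) = inner ℂ (A w) (A w) := (hsym w (A w)).symm
  have h5 : ‖w - ζ • A w‖ ^ 2 = ‖w‖ ^ 2 - 2 * (ζ * inner ℂ w (A w)).re + ‖ζ‖ ^ 2 * ‖A w‖ ^ 2 := by
    rw [@norm_sub_sq ℂ, inner_smul_right, norm_smul, mul_pow]; rfl
  have h6 : (inner ℂ w (A w) : ℂ).im = 0 := by
    have h7 : (inner ℂ (A w) w : ℂ) = inner ℂ w (A w) := hsym w w
    rw [← inner_conj_symm] at h7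
    exact Complex.conj_eq_iff_im.mp h7
  have h8 : (inner ℂ w w : ℂ).re = ‖w‖ ^ 2 := by
    rw [inner_self_eq_norm_sq_to_K]; norm_cast
  have h9 : (inner ℂ (A w) (A w) : ℂ).re = ‖A w‖ ^ 2 := by
    rw [inner_self_eq_norm_sq_to_K]; norm_cast
  have h10 : RCLike.re (inner ℂ w ((1 - (2 * ζ.re) • A + (‖ζ‖ ^ 2 - δ ^ 2) • A ^ 2 : H →L[ℂ] H) w) : ℂ)
     = ‖w‖ ^ 2 - 2 * ζ.re * (inner ℂ w (A w) : ℂ).re + (‖ζ‖ ^ 2 - δ ^ 2) * ‖A w‖ ^ 2 := by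
    simp only [add_apply, sub_apply,
      smul_apply, pow_two A, mul_apply_eq_comp,
      one_apply_eq_self, inner_add_right, inner_sub_right, inner_smul_right_eq_smul, h4]
    simp only [RCLike.re_to_complex, Complex.add_re, Complex.sub_re, Complex.real_smul, Complex.re_ofReal_mul, h8, h9]
  rw [h10] at h3
  rw [Complex.mul_re, h6] at h5
  refine le_of_sq_le_sq ?_ (norm_nonneg _)
  rw [h5, mul_pow]
  nlinarith

theorem aux_unit_of_surj (A : H →L[ℂ] H) (hA : IsSelfAdjoint A)
    (hs : Function.Surjective A) : IsUnit A := by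
  rw [ContinuousLinearMap.isUnit_iff_bijective]
  refine ⟨?_, hs⟩
  rw [injective_iff_map_eq_zero]
  intro x hx
  obtain ⟨y, rfl⟩ := hs x
  have h := hA.isSymmetric y (A y)
  simp only [ContinuousLinearMap.coe_coe] at h
  rw [hx, inner_zero_right, inner_self_eq_zero] at h
  exact h

theorem aux_isolated (A : H →L[ℂ] H) (hA : IsSelfAdjoint A) (μ : ℝ)
    (hμ : μ ∈ spectrum ℝ A) (hiso : ∀ᶠ x in nhds μ, x ≠ μ → x ∉ spectrum ℝ A) :
    ∃ w, w ≠ 0 ∧ A w = (μ : ℂ) • w := by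
  classical
  let g : ℝ → ℝ := fun x => if x = μ then 1 else 0
  have hg : ContinuousOn g (spectrum ℝ A) := by
    intro x hx
    by_cases hxμ : x = μ
    · subst hxμ
      apply (continuousWithinAt_const (b := (1:ℝ))).congr_of_eventuallyEq
      · filter_upwards [nhdsWithin_le_nhds hiso, self_mem_nhdsWithin] with y hy hy'
        have : y = x := by by_contra hne; exact hy hne hy'
        simp [g, this]
      · simp [g]
    · apply ContinuousAt.continuousWithinAt
      apply (continuousAt_const (y := (0:ℝ))).congr
      filter_upwards [isOpen_ne.mem_nhds hxμ] with y hy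
      simp only [g]; rw [if_neg hy]
  have h0 : cfc g A ≠ 0 := by
    intro h
    have : cfc g A = cfc (fun _ : ℝ => (0:ℝ)) A := by rw [h, cfc_const_zero]
    have := (cfc_eq_cfc_iff_eqOn (hf := hg)).mp this hμ
    simp [g] at this
  have h1 : (A - algebraMap ℝ _ μ) * cfc g A = 0 := by
    have : cfc (fun x : ℝ => (x - μ)) A = A - algebraMap ℝ _ μ := by
      rw [cfc_sub .., cfc_id' ℝ A, cfc_const μ A]
    rw [← this, ← cfc_mul (fun x : ℝ => x - μ) g A (by fun_prop) hg]
    have : (fun x : ℝ => (x - μ) * g x) = fun _ => 0 := by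
      funext x; by_cases hx : x = μ <;> simp [g, hx]
    rw [this, cfc_const_zero]
  obtain ⟨v, hv⟩ : ∃ v, cfc g A v ≠ 0 := by
    by_contra hcon
    push Not at hcon
    exact h0 (by ext v; simpa using hcon v)
  refine ⟨_, hv, ?_⟩
  have := congrArg (fun B : H →L[ℂ] H => B v) h1
  simp only [mul_apply_eq_comp, sub_apply, zero_apply, Algebra.algebraMap_eq_smul_one, smul_apply, one_apply_eq_self] at this
  rw [sub_eq_zero] at this
  rw [this]; rfl


theorem aux_proj_le (E : H →L[ℂ] H) (hEsa : IsSelfAdjoint E) (hE : IsIdempotentElem E) (v : H) :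
    ‖E v‖ ≤ ‖v‖ := by
  have h1 : E (E v) = E v := congrArg (fun B : H →L[ℂ] H => B v) hE
  have h2 : (inner ℂ (E v) (E v) : ℂ) = inner ℂ v (E v) := by
    have := hEsa.isSymmetric v (E v)
    simp only [ContinuousLinearMap.coe_coe] at this
    rw [this, h1]
  have h3 : ‖E v‖ ^ 2 ≤ ‖v‖ * ‖E v‖ := by
    rw [← @inner_self_eq_norm_sq ℂ, h2]
    exact re_inner_le_norm _ _
  by_contra hcon
  push Not at hcon
  nlinarith [norm_nonneg v, norm_nonneg (E v)]

theorem aux_final (E Q : H →L[ℂ] H) (hEsa : IsSelfAdjoint E) (hE : IsIdempotentElem E)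
    (hQsa : IsSelfAdjoint Q) (hQ : IsIdempotentElem Q) (w x y u : H) (ζ : ℂ) (m ε : ℝ)
    (hm : 0 ≤ m) (hε : ε = ‖(1 - Q) * E‖) (hu : u = x + y) (hx : E x = x) (hy : E y = 0)
    (h1 : m * ‖x‖ ≤ ‖E w - (ζ - Complex.I) • x‖)
    (h2 : (m + 1) * ‖y‖ ≤ ‖w - E w - ζ • y‖) :
    (m - 2 * ε) * ‖u‖ ≤ ‖w - ζ • u + Complex.I • Q u‖ := by
  have hEE : ∀ v, E (E v) = E v := fun v => congrArg (fun B : H →L[ℂ] H => B v) hE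
  have hP : ∀ v, ‖v - E v‖ ≤ ‖v‖ := fun v => by
    simpa using aux_proj_le (1 - E) ((IsSelfAdjoint.one _).sub hEsa) hE.one_sub v
  have hEu : E u = x := by rw [hu, map_add, hx, hy, add_zero]
  have horth : ∀ p q : H, E p = p → E q = 0 → ‖p + q‖ ^ 2 = ‖p‖ ^ 2 + ‖q‖ ^ 2 := by
    intro p q hp hq
    have : (inner ℂ p q : ℂ) = 0 := by
      have := hEsa.isSymmetric p q
      simp only [ContinuousLinearMap.coe_coe] at this
      rw [hp, hq, inner_zero_right] at this
      exact this
    rw [@norm_add_sq ℂ, this]; simp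
  set p := E w - (ζ - Complex.I) • x with hp
  set q := (w - E w - ζ • y) + Complex.I • (Q y - E (Q y)) with hq
  have hEp : E p = p := by rw [hp]; simp [hEE, hx]
  have hEq : E q = 0 := by rw [hq]; simp [hEE, hy]
  have hqn : m * ‖y‖ ≤ ‖q‖ := by
    have e1 : ‖Complex.I • (Q y - E (Q y))‖ ≤ ‖y‖ := by
      rw [norm_smul, Complex.norm_I, one_mul]
      exact (hP _).trans (aux_proj_le Q hQsa hQ y)
    have e2 := norm_sub_le q (Complex.I • (Q y - E (Q y)))
    rw [hq, add_sub_cancel_right, ← hq] at e2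
    linarith
  have hpq : m * ‖u‖ ≤ ‖p + q‖ := by
    refine le_of_sq_le_sq ?_ (norm_nonneg _)
    rw [mul_pow, horth p q hEp hEq, hu, horth x y hx hy]
    have a1 := pow_le_pow_left₀ (by positivity) h1 2
    have a2 := pow_le_pow_left₀ (by positivity) hqn 2
    rw [mul_pow] at a1 a2
    linarith
  have hF1 : ‖Q x - E (Q x)‖ ≤ ε * ‖u‖ := by
    have e : Q x - E (Q x) = -(((1 - Q) * E) u - E (((1 - Q) * E) u)) := by
      simp only [mul_apply_eq_comp, sub_apply, one_apply_eq_self, hEu, map_sub, hx]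
      abel
    rw [e, norm_neg, hε]
    exact (hP _).trans (ContinuousLinearMap.le_opNorm _ _)
  have hF2 : ‖E u - E (Q u)‖ ≤ ε * ‖u‖ := by
    have e : star ((1 - Q) * E) = E * (1 - Q) := by
      rw [star_mul, hEsa.star_eq, star_sub, star_one, hQsa.star_eq]
    rw [hε, ← norm_star ((1 - Q) * E), e]
    have e3 : E u - E (Q u) = (E * (1 - Q)) u := by
      simp only [mul_apply_eq_comp, sub_apply, one_apply_eq_self, map_sub]
    rw [e3]
    exact ContinuousLinearMap.le_opNorm (E * (1 - Q)) u
  have hdec : w - ζ • u + Complex.I • Q u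
      = (p + q) - Complex.I • ((E u - E (Q u)) - (Q x - E (Q x))) := by
    rw [hEu, hp, hq, hu]
    simp only [map_add, smul_sub, sub_smul, smul_add]
    abel
  have hfin : ‖Complex.I • ((E u - E (Q u)) - (Q x - E (Q x)))‖ ≤ 2 * ε * ‖u‖ := by
    rw [norm_smul, Complex.norm_I, one_mul]
    refine (norm_sub_le _ _).trans ?_
    linarith
  rw [hdec]
  have := norm_sub_norm_le (p + q) (Complex.I • ((E u - E (Q u)) - (Q x - E (Q x))))
  linarith

/-- **Lemma.** `‖(T + iQ - z)u‖ ≥ c ‖u‖` for all `z ∈ X` and `u ∈ Dom T`. -/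
theorem stmt_11
    -- `T` is a semi-bounded self-adjoint operator
    (T : H →ₗ.[ℂ] H) (hsa : IsSelfAdjoint T)
    (hsemibdd : ∃ m : ℝ, ∀ u : T.domain, m * ‖(u : H)‖ ^ 2 ≤ (⟪(u : H), T u⟫ : ℂ).re)
    -- `a, b ∈ ρ(T)`, `Δ = [a,b]`, and `Δ ∩ σ(T) = {λ_1,…,λ_d} ⊆ σ_dis(T)`
    (a b : ℝ) (hab : a < b)
    (ha : (a : ℂ) ∈ pmResolventSet T) (hb : (b : ℂ) ∈ pmResolventSet T)
    (d : ℕ) (lam : Fin d → ℝ)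
    (hΔ : (fun x : ℝ => (x : ℂ)) '' Set.Icc a b ∩ pmSpectrum T
      = Set.range fun j => ((lam j : ℂ)))
    (hdis : ∀ j, ((lam j : ℂ)) ∈ pmDiscSpectrum T)
    -- the eigenvalues are repeated according to multiplicity
    (hmult : ∀ j, Module.finrank ℂ (pmEigenspace T ((lam j : ℂ)))
      = (Finset.univ.filter fun i => lam i = lam j).card)
    -- `E = E(Δ)` is the spectral projection of `T` for `Δ`
    (E : H →L[ℂ] H) (hEsa : IsSelfAdjoint E) (hEidem : IsIdempotentElem E)
    (hErange : LinearMap.range E.toLinearMap = ⨆ j, pmEigenspace T ((lam j : ℂ)))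
    -- `Q` is an orthogonal projection and `ε = ‖(I - Q)E(Δ)‖`
    (Q : H →L[ℂ] H) (hQsa : IsSelfAdjoint Q) (hQidem : IsIdempotentElem Q)
    (ε : ℝ) (hε : ε = ‖(1 - Q) * E‖)
    -- `X` is a compact subset of `U(a,b)`
    (X : Set ℂ) (hXcpt : IsCompact X) (hXU : X ⊆ Uab a b lam)
    -- `d_X = dist(X, σ(T)\Δ)` and `d_Δ = dist({λ_1+i,…,λ_d+i}, X)`
    (dX dΔ : ℝ)
    (hdX : dX = sInf (Set.image2 dist X
      (pmSpectrum T \ ((fun x : ℝ => (x : ℂ)) '' Set.Icc a b))))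
    (hdΔ : dΔ = sInf (Set.image2 dist (Set.range fun j => (lam j : ℂ) + Complex.I) X))
    -- `c = min{d_X - 1 - 2ε, d_Δ - 3ε}`
    (c : ℝ) (hc : c = min (dX - 1 - 2 * ε) (dΔ - 3 * ε)) :
    ∀ z ∈ X, ∀ u : T.domain,
      c * ‖(u : H)‖ ≤ ‖T u + Complex.I • Q (u : H) - z • (u : H)‖ := by
  intro z hz u
  have hdense := hsa.dense_domain
  have hformal : ∀ x y : T.domain, (⟪T x, (y : H)⟫ : ℂ) = ⟪(x : H), T y⟫ := by
    have h := LinearPMap.adjoint_isFormalAdjoint hdense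
    rw [LinearPMap.isSelfAdjoint_def.mp hsa] at h
    intro x y
    exact h x y
  have hnorm0 : 0 ≤ ε := hε ▸ norm_nonneg _
  -- trivial case
  by_cases hcneg : c < 0
  · exact (mul_nonpos_of_nonpos_of_nonneg hcneg.le (norm_nonneg _)).trans (norm_nonneg _)
  push Not at hcneg
  have hc1 : c ≤ dX - 1 - 2 * ε := hc ▸ min_le_left _ _
  have hc2 : c ≤ dΔ - 3 * ε := hc ▸ min_le_right _ _
  obtain ⟨R, hR1, hR2⟩ := ha
  have hRsym : ∀ x y, (⟪R x, y⟫ : ℂ) = ⟪x, R y⟫ := by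
    intro x y
    obtain ⟨hx, hx'⟩ := hR1 x
    obtain ⟨hy, hy'⟩ := hR1 y
    have h := hformal ⟨R x, hx⟩ ⟨R y, hy⟩
    simp only at h
    conv_lhs => rw [← hy']
    conv_rhs => rw [← hx']
    rw [inner_sub_right, inner_sub_left, h, inner_smul_left, inner_smul_right, Complex.conj_ofReal]
  have hRsa : IsSelfAdjoint R := by
    rw [ContinuousLinearMap.isSelfAdjoint_iff_isSymmetric]
    exact hRsym
  have hEE : ∀ v, E (E v) = E v := fun v => congrArg (fun B : H →L[ℂ] H => B v) hEidem
  have hRinj : ∀ w, R w = 0 → w = 0 := by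
    intro w hw
    obtain ⟨h, h'⟩ := hR1 w
    rw [← h']
    have : (⟨R w, h⟩ : T.domain) = 0 := Subtype.ext hw
    rw [this, T.map_zero, hw]; simp
  -- eigenvectors
  have heig : ∀ (s : ℂ) (φ : H), φ ∈ pmEigenspace T s → (s - a) • R φ = φ := by
    rintro s φ ⟨h, h'⟩
    have := hR2 ⟨φ, h⟩
    rw [h'] at this
    simp only at this
    rw [← sub_smul, map_smul] at this
    exact this
  have hEfix : ∀ j, ∀ φ ∈ pmEigenspace T (lam j : ℂ), E φ = φ := by
    intro j φ hφ
    have : φ ∈ LinearMap.range E.toLinearMap := by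
      rw [hErange]; exact Submodule.mem_iSup_of_mem j hφ
    obtain ⟨v, rfl⟩ := this
    exact hEE v
  have hlam_a : ∀ j, (lam j : ℂ) - a ≠ 0 := by
    intro j h0
    have h1 := (hdis j).2.2.1
    apply h1
    rw [Submodule.eq_bot_iff]
    intro φ hφ
    have := heig _ φ hφ
    rw [h0, zero_smul] at this
    exact this.symm
  have hReig : ∀ j, ∀ φ ∈ pmEigenspace T (lam j : ℂ), R φ = ((lam j : ℂ) - a)⁻¹ • φ := by
    intro j φ hφ
    have := heig _ φ hφ
    rw [eq_inv_smul_iff₀ (hlam_a j)]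
    exact this
  have hERE : ∀ v, E (R (E v)) = R (E v) := by
    have : LinearMap.range E.toLinearMap ≤
        LinearMap.ker ((E * R - R : H →L[ℂ] H) : H →ₗ[ℂ] H) := by
      rw [hErange]
      refine iSup_le fun j φ hφ => ?_
      simp [hReig j φ hφ, hEfix j φ hφ]
    intro v
    have h := this ⟨v, rfl⟩
    simpa [sub_eq_zero] using h
  have hcomm : E * R = R * E := by
    have h1 : E * R * E = R * E := by ext v; simpa using hERE v
    have h2 := congrArg star h1
    simp only [star_mul, hEsa.star_eq, hRsa.star_eq] at h2
    exact h2.symm.trans ((mul_assoc E R E).symm.trans h1)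
  have hcomm' : ∀ v, E (R v) = R (E v) := fun v => congrArg (fun B : H →L[ℂ] H => B v) hcomm
  have hREsa : IsSelfAdjoint (R * E) := by
    rw [isSelfAdjoint_iff, star_mul, hEsa.star_eq, hRsa.star_eq, hcomm]
  have hRPsa : IsSelfAdjoint (R - R * E) := hRsa.sub hREsa
  have hmne : ∀ A : H →L[ℂ] H, IsSelfAdjoint A → ∀ μ : ℝ, μ ∈ spectrum ℝ A →
      ¬ Function.Surjective (fun v => A v - (μ : ℂ) • v) := by
    intro A hA μ hμ hs
    rw [spectrum.mem_iff] at hμ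
    apply hμ
    have h := aux_unit_of_surj (A - algebraMap ℝ (H →L[ℂ] H) μ)
      (hA.sub (IsSelfAdjoint.algebraMap _ (IsSelfAdjoint.all μ))) (by
        convert hs using 2 with v
        simp [Algebra.algebraMap_eq_smul_one])
    rw [← IsUnit.neg_iff, neg_sub]
    exact h
  -- spectrum of `R E`
  have hspecE : ∀ μ ∈ spectrum ℝ (R * E), μ ≠ 0 → ∃ j, ((lam j : ℂ) - a) * μ = 1 := by
    intro μ hμ h0
    by_contra hcon
    push Not at hcon
    apply hmne _ hREsa μ hμ
    have h0' : (μ : ℂ) ≠ 0 := by exact_mod_cast h0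
    have hr : LinearMap.range E.toLinearMap ≤
        LinearMap.range ((R * E - (μ : ℂ) • 1 : H →L[ℂ] H) : H →ₗ[ℂ] H) := by
      rw [hErange]
      refine iSup_le fun j φ hφ => ?_
      have hne : ((lam j : ℂ) - a)⁻¹ - μ ≠ 0 := by
        intro h
        apply hcon j
        rw [← sub_eq_zero.mp h, mul_inv_cancel₀ (hlam_a j)]
      refine ⟨(((lam j : ℂ) - a)⁻¹ - μ)⁻¹ • φ, ?_⟩
      have : (R * E - (μ : ℂ) • 1 : H →L[ℂ] H) φ = (((lam j : ℂ) - a)⁻¹ - μ) • φ := by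
        simp [hEfix j φ hφ, hReig j φ hφ, sub_smul]
      rw [map_smul, ContinuousLinearMap.coe_coe, this, inv_smul_smul₀ hne]
    intro v
    obtain ⟨v1, hv1⟩ := hr ⟨v, rfl⟩
    refine ⟨v1 + (-(μ : ℂ)⁻¹) • (v - E v), ?_⟩
    simp only [ContinuousLinearMap.coe_coe, sub_apply, mul_apply_eq_comp, smul_apply,
      one_apply_eq_self] at hv1
    simp only [map_add, map_smul, map_sub, mul_apply_eq_comp, hEE, sub_self, smul_zero, add_zero,
      smul_add, smul_smul]
    rw [mul_neg, mul_inv_cancel₀ h0', neg_smul, one_smul, ← sub_sub, hv1]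
    abel
  -- spectrum of `R (1 - E)`
  have hspec1 : ∀ μ ∈ spectrum ℝ (R - R * E), μ ≠ 0 → ((a + μ⁻¹ : ℝ) : ℂ) ∈ pmSpectrum T := by
    intro μ hμ h0
    have h0' : (μ : ℂ) ≠ 0 := by exact_mod_cast h0
    rintro ⟨S, hS1, hS2⟩
    apply hmne _ hRPsa μ hμ
    -- `R - μ` is surjective
    have hsurj : ∀ v, ∃ w, R w - (μ : ℂ) • w = v := by
      intro v
      obtain ⟨hv, hv'⟩ := hS1 v
      refine ⟨(-(μ : ℂ)⁻¹) • (T ⟨S v, hv⟩ - (a : ℂ) • S v), ?_⟩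
      have e1 := hR2 ⟨S v, hv⟩
      simp only at e1
      rw [map_smul, e1, smul_smul, mul_neg, mul_inv_cancel₀ h0']
      push_cast at hv'
      conv_rhs => rw [← hv']
      simp only [add_smul, neg_smul, one_smul]
      abel
    intro v
    obtain ⟨w, hw⟩ := hsurj (v - E v)
    refine ⟨w - E w + (-(μ : ℂ)⁻¹) • E v, ?_⟩
    have e1 := congrArg E hw
    simp only [map_sub, map_smul, hEE, sub_self, hcomm'] at e1
    simp only [map_add, map_smul, map_sub, mul_apply_eq_comp, sub_apply, hEE, sub_self, smul_zero,
      add_zero, smul_add, smul_smul, smul_sub]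
    rw [mul_neg, mul_inv_cancel₀ h0', neg_smul, one_smul]
    have e2 : v = (R w - (μ : ℂ) • w) - (R (E w) - (μ : ℂ) • E w) + E v := by
      rw [hw, e1]; abel
    conv_rhs => rw [e2]
    abel
  have hspecP : ∀ μ ∈ spectrum ℝ (R - R * E), μ ≠ 0 → ((a + μ⁻¹ : ℝ) : ℂ) ∈
      pmSpectrum T \ ((fun x : ℝ => (x : ℂ)) '' Set.Icc a b) := by
    intro μ hμ h0
    have h0' : (μ : ℂ) ≠ 0 := by exact_mod_cast h0
    have hs := hspec1 μ hμ h0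
    refine ⟨hs, fun hI => ?_⟩
    have hj : ((a + μ⁻¹ : ℝ) : ℂ) ∈ Set.range fun j => ((lam j : ℂ)) := hΔ ▸ ⟨hI, hs⟩
    obtain ⟨j, hj⟩ := hj
    simp only at hj
    obtain ⟨η, hη, hiso⟩ := (hdis j).2.1
    have hev : ∀ᶠ x in nhds μ, x ≠ μ → x ∉ spectrum ℝ (R - R * E) := by
      have hcont : ContinuousAt (fun x : ℝ => ((a + x⁻¹ : ℝ) : ℂ)) μ :=
        Complex.continuous_ofReal.continuousAt.comp (continuousAt_const.add (continuousAt_inv₀ h0))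
      have h1 := hcont.eventually (Metric.ball_mem_nhds _ hη)
      filter_upwards [h1, isOpen_ne.mem_nhds h0] with x hx hx0 hxμ hxs
      have h2 := hiso _ (hspec1 x hxs hx0) (by
        rw [hj]
        intro h
        have := Complex.ofReal_injective h
        exact hxμ (inv_injective (add_left_cancel this)))
      rw [hj] at h2
      exact absurd (Metric.mem_ball.mp hx) (not_lt.mpr h2)
    obtain ⟨w, hw0, hw⟩ := aux_isolated _ hRPsa μ hμ hev
    have hEw : E w = 0 := by
      have := congrArg E hw
      simp only [sub_apply, mul_apply_eq_comp, map_sub, hcomm', hEE, sub_self, map_smul] at this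
      exact (smul_eq_zero.mp this.symm).resolve_left h0'
    have hRw : R w = (μ : ℂ) • w := by
      simpa [hEw] using hw
    apply hw0
    rw [← hEw]
    refine (hEfix j w ?_).symm
    have hwd : w ∈ T.domain := by
      obtain ⟨h, -⟩ := hR1 w
      rw [hRw] at h
      exact (Submodule.smul_mem_iff _ h0').mp h
    refine ⟨hwd, ?_⟩
    obtain ⟨h, h'⟩ := hR1 w
    have e : (⟨R w, h⟩ : T.domain) = (μ : ℂ) • ⟨w, hwd⟩ := Subtype.ext hRw
    rw [e, T.map_smul, hRw] at h'
    rw [hj]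
    have h3 : T ⟨w, hwd⟩ = (μ : ℂ)⁻¹ • (w + (a : ℂ) • (μ : ℂ) • w) := by
      rw [eq_inv_smul_iff₀ h0', ← sub_eq_iff_eq_add, h']
    rw [h3, smul_add, smul_smul, smul_smul]
    push_cast
    rw [add_smul, add_comm]
    congr 2
    field_simp
  -- distances
  have hd1 : ∀ s ∈ pmSpectrum T \ ((fun x : ℝ => (x : ℂ)) '' Set.Icc a b), dX ≤ dist z s := by
    intro s hs
    rw [hdX]
    refine csInf_le ⟨0, ?_⟩ (Set.mem_image2_of_mem hz hs)
    rintro _ ⟨x, -, y, -, rfl⟩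
    exact dist_nonneg
  have hd2 : ∀ j, dΔ ≤ dist ((lam j : ℂ) + Complex.I) z := by
    intro j
    rw [hdΔ]
    refine csInf_le ⟨0, ?_⟩ (Set.mem_image2_of_mem ⟨j, rfl⟩ hz)
    rintro _ ⟨x, -, y, -, rfl⟩
    exact dist_nonneg
  set m := c + 2 * ε with hm
  have hm0 : 0 ≤ m := by positivity
  set w := T u - (a : ℂ) • (u : H) with hw
  have hRw : R w = u := hR2 u
  have hb1 := aux_key (R * E) hREsa (z - a - Complex.I) m hm0 (by
    intro μ hμ h0
    obtain ⟨j, hj⟩ := hspecE μ hμ h0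
    have e : 1 - (z - a - Complex.I) * (μ : ℂ) = ((lam j : ℂ) + Complex.I - z) * μ := by
      rw [← hj]; ring
    rw [e, norm_mul, Complex.norm_real, Real.norm_eq_abs, ← dist_eq_norm]
    refine mul_le_mul_of_nonneg_right ?_ (abs_nonneg _)
    linarith [hd2 j]) (E w)
  have hb2 := aux_key (R - R * E) hRPsa (z - a) (m + 1) (by positivity) (by
    intro μ hμ h0
    have h0' : (μ : ℂ) ≠ 0 := by exact_mod_cast h0
    have hj := hd1 _ (hspecP μ hμ h0)
    have e : 1 - (z - a) * (μ : ℂ) = (((a + μ⁻¹ : ℝ) : ℂ) - z) * μ := by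
      push_cast; field_simp; ring
    rw [e, norm_mul, Complex.norm_real, Real.norm_eq_abs, ← dist_eq_norm, dist_comm]
    refine mul_le_mul_of_nonneg_right ?_ (abs_nonneg _)
    linarith) (w - E w)
  simp only [mul_apply_eq_comp, sub_apply, map_sub, hEE, sub_self, sub_zero] at hb1 hb2
  have hfin := aux_final E Q hEsa hEidem hQsa hQidem w (R (E w)) (R w - R (E w)) (u : H) (z - a)
    m ε hm0 hε (by rw [hRw]; abel) (hERE w) (by rw [map_sub, hcomm', hERE, sub_self]) hb1 hb2
  have e1 : w - (z - a) • (u : H) + Complex.I • Q (u : H)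
      = T u + Complex.I • Q (u : H) - z • (u : H) := by
    rw [hw, sub_smul]; abel
  rw [e1, hm, add_sub_cancel_right] at hfin
  exact hfin
end
end

section
/- Let Q be an orthogonal projection on H and ε = ‖(I − Q)E(Δ)‖. Let U_ε(a,b) be the open set contained in U(a,b) which is exterior to the circles centered at a and b of radius 1 + 2ε and exterior to the circles centered at λ_j + i of radius 3ε for 1 ≤ j ≤ d. Then U_ε(a,b) ⊂ ρ(T + iQ). -/
open scoped ComplexInnerProductSpace

noncomputable section

variable {H : Type*} [NormedAddCommGroup H] [InnerProductSpace ℂ H] [CompleteSpace H]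

/-- The resolvent set of the perturbed operator `T + B`, where `B` is bounded. -/
def pertResolventSet (T : H →ₗ.[ℂ] H) (B : H →L[ℂ] H) : Set ℂ :=
  {z | ∃ R : H →L[ℂ] H,
    (∀ y : H, ∃ hy : R y ∈ T.domain, T ⟨R y, hy⟩ + B (R y) - z • R y = y) ∧
      ∀ x : T.domain, R (T x + B (x : H) - z • (x : H)) = x}

/-- The spectrum of the perturbed operator `T + B`. -/
def pertSpectrum (T : H →ₗ.[ℂ] H) (B : H →L[ℂ] H) : Set ℂ := (pertResolventSet T B)ᶜ

set_option linter.unusedSectionVars false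

/-- Upper bound of a bounded self-adjoint operator off finitely many eigenvectors. -/
lemma key_pos (R E : H →L[ℂ] H) (hR : IsSelfAdjoint R) (hc : Commute R E)
    (l : ℝ) (d : ℕ) (mu : Fin d → ℝ)
    (hspec : ∀ s ∈ spectrum ℝ R, 1 < l * s → ∃ j, s = mu j)
    (hker : ∀ j y, R y = (mu j : ℂ) • y → E y = y) :
    ∀ y, E y = 0 → l * (⟪y, R y⟫ : ℂ).re ≤ ‖y‖ ^ 2 := by
  intro y hy
  set f : ℝ → ℝ := fun s => max (l * s - 1) 0 with hf
  set g : ℝ → ℝ := fun s => Real.sqrt (max (1 - l * s) 0) with hg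
  have hfc : Continuous f := by fun_prop
  have hgc : Continuous g := by fun_prop
  have step : ∀ S : Finset (Fin d),
      cfc (fun s => (∏ j ∈ S, (s - mu j)) * f s) R y = 0 → cfc f R y = 0 := by
    intro S
    induction S using Finset.induction_on with
    | empty => simp
    | insert i S hi ih =>
      intro h
      apply ih
      set k : ℝ → ℝ := fun s => (∏ j ∈ S, (s - mu j)) * f s with hk
      have hkc : Continuous k := by fun_prop
      have e1 : (fun s => (∏ j ∈ insert i S, (s - mu j)) * f s) = fun s => (s - mu i) * k s := by
        funext s; rw [Finset.prod_insert hi, hk]; ring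
      rw [e1, cfc_mul (fun s => s - mu i) k R (by fun_prop) hkc.continuousOn,
        cfc_sub (fun s => s) (fun _ => mu i) R (by fun_prop) (by fun_prop),
        cfc_id' ℝ R, cfc_const (mu i) R] at h
      have h2 : R (cfc k R y) = (mu i : ℂ) • cfc k R y := by
        have : R (cfc k R y) - (mu i : ℂ) • cfc k R y = 0 := by
          rw [← h]
          simp [Algebra.algebraMap_eq_smul_one]
        exact sub_eq_zero.mp this
      have h3 := hker i _ h2
      have h4 : E (cfc k R y) = cfc k R (E y) := by
        have := (hc.cfc_real k).eq
        exact (congrArg (fun A : H →L[ℂ] H => A y) this).symm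
      rw [← h3, h4, hy, map_zero]
  have hF : cfc f R y = 0 := by
    apply step Finset.univ
    have : cfc (fun s => (∏ j, (s - mu j)) * f s) R = cfc (fun _ => (0:ℝ)) R := by
      apply cfc_congr
      intro s hs
      by_cases h1 : 1 < l * s
      · obtain ⟨j, hj⟩ := hspec s hs h1
        have : ∏ j, (s - mu j) = 0 := Finset.prod_eq_zero (Finset.mem_univ j) (by simp [hj])
        simp [this]
      · have : f s = 0 := by simp only [hf]; exact max_eq_right (by linarith)
        simp [this]
    rw [this]; simp
  have hG : cfc g R * cfc g R = 1 - (l : ℂ) • R + cfc f R := by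
    rw [← cfc_mul g g R hgc.continuousOn hgc.continuousOn]
    have e : (fun s => g s * g s) = fun s => (1 - l * s) + f s := by
      funext s
      simp only [hg, hf]
      rw [Real.mul_self_sqrt (le_max_right _ _)]
      rcases le_total (l * s) 1 with h | h
      · rw [max_eq_left (by linarith), max_eq_right (by linarith)]; ring
      · rw [max_eq_right (by linarith), max_eq_left (by linarith)]; ring
    rw [e, cfc_add R (fun s => 1 - l * s) f (by fun_prop) hfc.continuousOn,
      cfc_sub (fun _ => (1:ℝ)) (fun s => l * s) R (by fun_prop) (by fun_prop),
      cfc_const_mul l (fun s => s) R (by fun_prop), cfc_id' ℝ R, cfc_const_one ℝ R]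
    rfl
  have hGsa : IsSelfAdjoint (cfc g R) := cfc_predicate g R
  have h5 : (⟪y, (cfc g R * cfc g R) y⟫ : ℂ).re = ‖cfc g R y‖ ^ 2 := by
    have h6 : (⟪y, cfc g R (cfc g R y)⟫ : ℂ) = ⟪cfc g R y, cfc g R y⟫ := by
      have := ContinuousLinearMap.adjoint_inner_right (cfc g R) y (cfc g R y)
      rw [show ContinuousLinearMap.adjoint (cfc g R) = cfc g R from hGsa] at this
      exact this
    change (⟪y, cfc g R (cfc g R y)⟫ : ℂ).re = _
    rw [h6, inner_self_eq_norm_sq_to_K]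
    norm_cast
  have h7 : (⟪y, (cfc g R * cfc g R) y⟫ : ℂ).re = ‖y‖ ^ 2 - l * (⟪y, R y⟫ : ℂ).re := by
    rw [hG]
    simp only [add_apply, sub_apply, hF, add_zero,
      one_apply_eq_self, smul_apply, inner_sub_right,
      inner_smul_right, inner_self_eq_norm_sq_to_K, Complex.sub_re, Complex.re_ofReal_mul]
    norm_cast
  nlinarith [sq_nonneg ‖cfc g R y‖]

/-- `T x = y`, as a relation. -/
def Gr (T : H →ₗ.[ℂ] H) (x y : H) : Prop := ∃ h : x ∈ T.domain, T ⟨x, h⟩ = y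

lemma Gr.add {T : H →ₗ.[ℂ] H} {x y x' y' : H} (h : Gr T x y) (h' : Gr T x' y') :
    Gr T (x + x') (y + y') := by
  obtain ⟨h, rfl⟩ := h
  obtain ⟨h', rfl⟩ := h'
  exact ⟨add_mem h h', T.map_add ⟨x, h⟩ ⟨x', h'⟩⟩

lemma Gr.smul {T : H →ₗ.[ℂ] H} {x y : H} (c : ℂ) (h : Gr T x y) :
    Gr T (c • x) (c • y) := by
  obtain ⟨h, rfl⟩ := h
  exact ⟨Submodule.smul_mem _ c h, T.map_smul c ⟨x, h⟩⟩

lemma Gr.sub {T : H →ₗ.[ℂ] H} {x y x' y' : H} (h : Gr T x y) (h' : Gr T x' y') :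
    Gr T (x - x') (y - y') := by
  have := h.add (h'.smul (-1))
  simpa [sub_eq_add_neg] using this

lemma Gr.unique {T : H →ₗ.[ℂ] H} {x y y' : H} (h : Gr T x y) (h' : Gr T x y') : y = y' := by
  obtain ⟨h, rfl⟩ := h
  obtain ⟨h', rfl⟩ := h'
  rfl

lemma Gr.symm {T : H →ₗ.[ℂ] H} (hsa : IsSelfAdjoint T) {x y x' y' : H}
    (h : Gr T x y) (h' : Gr T x' y') : (⟪y, x'⟫ : ℂ) = ⟪x, y'⟫ := by
  obtain ⟨h, rfl⟩ := h
  obtain ⟨h', rfl⟩ := h'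
  have := LinearPMap.adjoint_isFormalAdjoint (hsa.dense_domain)
  rw [LinearPMap.isSelfAdjoint_def.mp hsa] at this
  exact this ⟨x, h⟩ ⟨x', h'⟩

/-- `R = (T - a)⁻¹`. -/
def IsRes (T : H →ₗ.[ℂ] H) (a : ℂ) (R : H →L[ℂ] H) : Prop :=
  (∀ y, Gr T (R y) (y + a • R y)) ∧ ∀ x y, Gr T x y → R (y - a • x) = x

lemma exists_isRes {T : H →ₗ.[ℂ] H} {a : ℂ} (h : a ∈ pmResolventSet T) : ∃ R, IsRes T a R := by
  obtain ⟨R, h1, h2⟩ := h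
  refine ⟨R, fun y => ?_, ?_⟩
  · obtain ⟨hy, e⟩ := h1 y
    exact ⟨hy, by rw [sub_eq_iff_eq_add.mp e]⟩
  · rintro x y ⟨hx, rfl⟩
    exact h2 ⟨x, hx⟩

lemma IsRes.selfAdjoint {T : H →ₗ.[ℂ] H} (hsa : IsSelfAdjoint T) {a : ℝ} {R : H →L[ℂ] H}
    (hR : IsRes T a R) : IsSelfAdjoint R := by
  rw [ContinuousLinearMap.isSelfAdjoint_iff_isSymmetric]
  intro x y
  have := Gr.symm hsa (hR.1 x) (hR.1 y)
  simp only [inner_add_left, inner_add_right, inner_smul_left, inner_smul_right,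
    Complex.conj_ofReal] at this
  have h2 := add_right_cancel this
  exact h2.symm

lemma IsRes.eigen {T : H →ₗ.[ℂ] H} {a z : ℂ} {R : H →L[ℂ] H}
    (hR : IsRes T a R) {x : H} (hx : x ∈ pmEigenspace T z) : (z - a) • R x = x := by
  have := hR.2 x (z • x) hx
  rwa [← sub_smul, map_smul] at this

lemma IsRes.ker {T : H →ₗ.[ℂ] H} {a z : ℂ} {R : H →L[ℂ] H} (hza : z ≠ a)
    (hR : IsRes T a R) {x : H} (hx : R x = (z - a)⁻¹ • x) : x ∈ pmEigenspace T z := by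
  have hne := sub_ne_zero.mpr hza
  have h := (hR.1 x).smul (z - a)
  rw [hx, smul_smul, mul_inv_cancel₀ hne, one_smul, smul_add, smul_smul, smul_smul] at h
  rw [← add_smul] at h
  have e : z - a + (z - a) * a * (z - a)⁻¹ = z := by field_simp; ring
  rw [e] at h
  exact h

lemma IsRes.isUnit {T : H →ₗ.[ℂ] H} {a t : ℂ} {R S : H →L[ℂ] H} (hta : t ≠ a)
    (hR : IsRes T a R) (hS : IsRes T t S) : IsUnit ((t - a)⁻¹ • (1 : H →L[ℂ] H) - R) := by
  have hne := sub_ne_zero.mpr hta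
  have i1 : S = R + (t - a) • (R * S) := by
    ext y
    have := hR.2 _ _ (hS.1 y)
    rw [add_sub_assoc, ← sub_smul, map_add, map_smul] at this
    exact this.symm
  have i2 : R = S + (a - t) • (S * R) := by
    ext y
    have := hS.2 _ _ (hR.1 y)
    rw [add_sub_assoc, ← sub_smul, map_add, map_smul] at this
    exact this.symm
  have j1 : (t - a) • (R * S) = S - R := by rw [eq_sub_iff_add_eq']; exact i1.symm
  have j2 : (t - a) • (S * R) = S - R := by
    have : (a - t) • (S * R) = R - S := by rw [eq_sub_iff_add_eq']; exact i2.symm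
    rw [← neg_sub a t, neg_smul, this, neg_sub]
  refine ⟨⟨_, (t - a) • (1 + (t - a) • S), ?_, ?_⟩, rfl⟩
  · rw [mul_smul_comm, mul_add, mul_smul_comm, sub_mul, sub_mul, smul_sub, j1]
    simp only [mul_one, one_mul, smul_mul_assoc, smul_smul, mul_inv_cancel₀ hne, one_smul,
      smul_add, smul_sub]
    abel
  · rw [smul_mul_assoc, add_mul, smul_mul_assoc, mul_sub, mul_sub, smul_sub, j2]
    simp only [mul_one, one_mul, mul_smul_comm, smul_smul, mul_inv_cancel₀ hne, one_smul,
      smul_add, smul_sub]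
    abel

lemma commute_of_range {T : H →ₗ.[ℂ] H} {a : ℝ} {R E : H →L[ℂ] H}
    (hR : IsRes T a R) (hRsa : IsSelfAdjoint R) (hEsa : IsSelfAdjoint E)
    (hEidem : IsIdempotentElem E) {d : ℕ} {lam : Fin d → ℝ} (hne : ∀ j, (lam j : ℂ) ≠ a)
    (hErange : LinearMap.range E.toLinearMap = ⨆ j, pmEigenspace T ((lam j : ℂ))) :
    Commute R E := by
  have hEid : ∀ x, x ∈ LinearMap.range E.toLinearMap → E x = x := by
    rintro _ ⟨y, rfl⟩
    exact congrArg (fun A : H →L[ℂ] H => A y) hEidem.eq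
  have hmap : ∀ x ∈ LinearMap.range E.toLinearMap, R x ∈ LinearMap.range E.toLinearMap := by
    rw [hErange]
    intro x hx
    induction hx using Submodule.iSup_induction' with
    | mem j x hx =>
      have h := hR.eigen hx
      have h2 : R x = ((lam j : ℂ) - a)⁻¹ • x := by
        nth_rewrite 2 [← h]
        rw [smul_smul, inv_mul_cancel₀ (sub_ne_zero.mpr (hne j)), one_smul]
      rw [h2]
      exact Submodule.smul_mem _ _ (Submodule.mem_iSup_of_mem j hx)
    | zero => simp
    | add x y _ _ hx hy => rw [map_add]; exact add_mem hx hy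
  have h1 : E * (R * E) = R * E := by
    ext y
    exact hEid _ (hmap _ ⟨y, rfl⟩)
  have h2 := congrArg star h1
  rw [star_mul, star_mul, hRsa.star_eq, hEsa.star_eq, mul_assoc, h1] at h2
  exact h2

lemma eig_lower {T : H →ₗ.[ℂ] H} (hsa : IsSelfAdjoint T) {d : ℕ} (lam : Fin d → ℝ)
    {x y : H} (hxy : Gr T x y) (hx : x ∈ ⨆ j, pmEigenspace T ((lam j : ℂ)))
    (w : ℂ) (δ : ℝ) (hδ : 0 ≤ δ) (h : ∀ j, δ ≤ ‖(lam j : ℂ) - w‖) :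
    δ * ‖x‖ ≤ ‖y - w • x‖ := by
  classical
  have hV : OrthogonalFamily ℂ (fun m : ℝ => pmEigenspace T (m : ℂ))
      (fun m => (pmEigenspace T (m : ℂ)).subtypeₗᵢ) := by
    intro m n hmn u v
    have := Gr.symm hsa u.2 v.2
    rw [inner_smul_left, inner_smul_right, Complex.conj_ofReal] at this
    have h2 : ((m : ℂ) - n) * ⟪(u : H), (v : H)⟫ = 0 := by rw [sub_mul, this, sub_self]
    rcases mul_eq_zero.mp h2 with h3 | h3
    · exact absurd (by exact_mod_cast sub_eq_zero.mp h3) hmn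
    · exact h3
  have hx' : x ∈ ⨆ m ∈ Finset.univ.image lam, pmEigenspace T ((m : ℝ) : ℂ) := by
    refine (iSup_le fun j => ?_ : (⨆ j, pmEigenspace T ((lam j : ℂ))) ≤ _) hx
    exact le_iSup₂_of_le (lam j) (Finset.mem_image_of_mem lam (Finset.mem_univ j)) le_rfl
  obtain ⟨v, rfl⟩ := (Submodule.mem_iSup_finset_iff_exists_sum _ _).mp hx'
  have hgr : ∀ S : Finset ℝ, Gr T (∑ m ∈ S, (v m : H)) (∑ m ∈ S, (m : ℂ) • (v m : H)) := by
    intro S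
    induction S using Finset.induction_on with
    | empty =>
      simp only [Finset.sum_empty]
      exact ⟨zero_mem _, T.map_zero⟩
    | insert i S hi ih =>
      rw [Finset.sum_insert hi, Finset.sum_insert hi]
      exact Gr.add (v i).2 ih
  rw [Gr.unique hxy (hgr _), Finset.smul_sum, ← Finset.sum_sub_distrib]
  have n1 := hV.norm_sum v (Finset.univ.image lam)
  have n2 := hV.norm_sum (fun m => ((m : ℂ) - w) • v m) (Finset.univ.image lam)
  simp only [Submodule.coe_subtypeₗᵢ, Submodule.subtype_apply, sub_smul] at n1 n2
  refine le_of_sq_le_sq ?_ (norm_nonneg _)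
  rw [mul_pow, n1, Finset.mul_sum]
  refine le_trans ?_ n2.symm.le
  apply Finset.sum_le_sum
  intro m hm
  obtain ⟨j, -, rfl⟩ := Finset.mem_image.mp hm
  rw [← sub_smul, norm_smul, mul_pow]
  gcongr
  exact h j

lemma real_ineq {l t v N s X D : ℝ} (hl : 0 < l) (ht : 0 < t) (htl : t < l)
    (hN : 0 ≤ N) (hX : 0 ≤ X) (h1 : l * s ≤ N) (h2 : 0 ≤ N - 2 * l * s + l ^ 2 * X)
    (hD1 : D ^ 2 ≤ t ^ 2 + v ^ 2) (hD2 : D ^ 2 ≤ (l - t) ^ 2 + v ^ 2) :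
    D ^ 2 * X ≤ N - 2 * t * s + (t ^ 2 + v ^ 2) * X := by
  rcases le_total (2 * t) l with h | h
  · have : D ^ 2 * X ≤ (t ^ 2 + v ^ 2) * X := by gcongr
    have k : 0 ≤ l * (N - 2 * t * s) := by
      nlinarith [mul_nonneg (sub_nonneg.mpr h) hN, mul_nonneg ht.le (sub_nonneg.mpr h1)]
    have := nonneg_of_mul_nonneg_right k hl
    linarith
  · have e : D ^ 2 * X ≤ ((l - t) ^ 2 + v ^ 2) * X := by gcongr
    have k : 0 ≤ l * (N - 2 * t * s + (2 * t * l - l ^ 2) * X) := by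
      nlinarith [mul_nonneg (sub_nonneg.mpr h) h2,
        mul_nonneg (sub_nonneg.mpr htl.le) (sub_nonneg.mpr h1)]
    have := nonneg_of_mul_nonneg_right k hl
    nlinarith

lemma norm_sub_smul_sq (x y : H) (hre : (⟪y, x⟫ : ℂ).im = 0) (w : ℂ) :
    ‖y - w • x‖ ^ 2 = ‖y‖ ^ 2 - 2 * w.re * (⟪y, x⟫ : ℂ).re + (w.re ^ 2 + w.im ^ 2) * ‖x‖ ^ 2 := by
  rw [@norm_sub_sq ℂ, inner_smul_right, norm_smul, mul_pow, Complex.sq_norm, Complex.normSq_apply]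
  simp only [RCLike.re_eq_complex_re, Complex.mul_re, hre]
  ring

lemma perp_lower {x y : H} (a b : ℝ) (hre : (⟪y, x⟫ : ℂ).im = 0)
    (h1 : (b - a) * (⟪y - (a : ℂ) • x, x⟫ : ℂ).re ≤ ‖y - (a : ℂ) • x‖ ^ 2)
    (z : ℂ) (haz : a < z.re) (hzb : z.re < b) (D : ℝ) (hDa : D ≤ dist z a)
    (hDb : D ≤ dist z b) (hD : 0 ≤ D) : D * ‖x‖ ≤ ‖y - z • x‖ := by
  set u := y - (a : ℂ) • x with hu
  have hux : (⟪u, x⟫ : ℂ).im = 0 := by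
    rw [hu, inner_sub_left, inner_smul_left, inner_self_eq_norm_sq_to_K, Complex.sub_im, hre]
    simp [← Complex.ofReal_pow]
  have e : y - z • x = u - (z - a) • x := by rw [hu, sub_smul]; abel
  have hda : D ^ 2 ≤ (z.re - a) ^ 2 + z.im ^ 2 := by
    have : D ^ 2 ≤ dist z (a : ℂ) ^ 2 := by gcongr
    rw [Complex.dist_eq, Complex.sq_norm, Complex.normSq_apply] at this
    simp at this; nlinarith
  have hdb : D ^ 2 ≤ ((b - a) - (z.re - a)) ^ 2 + z.im ^ 2 := by
    have : D ^ 2 ≤ dist z (b : ℂ) ^ 2 := by gcongr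
    rw [Complex.dist_eq, Complex.sq_norm, Complex.normSq_apply] at this
    simp at this; nlinarith
  have h2 := norm_sub_smul_sq x u hux ((b - a : ℝ) : ℂ)
  have h3 := norm_sub_smul_sq x u hux (z - a)
  simp at h2 h3
  refine le_of_sq_le_sq ?_ (norm_nonneg _)
  rw [mul_pow, e, h3]
  refine real_ineq (l := b - a) (by linarith) (by linarith) (by linarith) (by positivity)
    (by positivity) h1 ?_ hda hdb
  have := sq_nonneg ‖u - ((b : ℂ) - a) • x‖
  rw [h2] at this
  linarith

lemma proj_pyth {E : H →L[ℂ] H} (hEsa : IsSelfAdjoint E) (hEidem : IsIdempotentElem E) (v : H) :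
    ‖E v‖ ≤ ‖v‖ ∧ ‖v - E v‖ ≤ ‖v‖ := by
  have hid : E (E v) = E v := congrArg (fun A : H →L[ℂ] H => A v) hEidem.eq
  have h0 : (⟪E v, v - E v⟫ : ℂ) = 0 := by
    have := ContinuousLinearMap.adjoint_inner_left E (v - E v) v
    rw [show ContinuousLinearMap.adjoint E = E from hEsa] at this
    rw [this, map_sub, hid, sub_self, inner_zero_right]
  have h := norm_add_sq_eq_norm_sq_add_norm_sq_of_inner_eq_zero _ _ h0
  rw [add_sub_cancel] at h
  constructor
  · nlinarith [norm_nonneg v, norm_nonneg (E v), mul_self_nonneg ‖v - E v‖]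
  · nlinarith [norm_nonneg v, norm_nonneg (v - E v), mul_self_nonneg ‖E v‖]

lemma main_lower {T : H →ₗ.[ℂ] H} {E Q : H →L[ℂ] H}
    (hEsa : IsSelfAdjoint E) (hEidem : IsIdempotentElem E)
    (hQsa : IsSelfAdjoint Q) (hQidem : IsIdempotentElem Q)
    (hE : ∀ x y, Gr T x y → Gr T (E x) (E y))
    (c z : ℂ) (hc : ‖c‖ = 1) (ε η : ℝ) (hε : ε = ‖(1 - Q) * E‖)
    (hL : ∀ x y, Gr T x y → E x = x → (3 * ε + η) * ‖x‖ ≤ ‖y - (z - c) • x‖)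
    (hP : ∀ x y, Gr T x y → E x = 0 → (1 + 2 * ε + η) * ‖x‖ ≤ ‖y - z • x‖)
    (hη : 0 < η) {x y : H} (hxy : Gr T x y) :
    η / 2 * ‖x‖ ≤ ‖y + c • Q x - z • x‖ := by
  have hid : ∀ v, E (E v) = E v := fun v => congrArg (fun A : H →L[ℂ] H => A v) hEidem.eq
  have hε0 : 0 ≤ ε := hε ▸ norm_nonneg _
  have hK : ∀ v, ‖E v - Q (E v)‖ ≤ ε * ‖E v‖ := by
    intro v
    have := ((1 - Q) * E).le_opNorm (E v)
    rw [← hε] at this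
    simpa [hid] using this
  have hKs : ∀ v, ‖E (v - Q v)‖ ≤ ε * ‖v‖ := by
    intro v
    have := (star ((1 - Q) * E)).le_opNorm v
    rw [norm_star, ← hε, star_mul, star_sub, star_one, hEsa.star_eq, hQsa.star_eq] at this
    simpa using this
  set x1 := E x with hx1
  set x2 := x - E x with hx2
  have hEx2 : E x2 = 0 := by rw [hx2, map_sub, hid, sub_self]
  have hx : x = x1 + x2 := by rw [hx1, hx2]; abel
  set w := y + c • Q x - z • x with hw
  have l1 := hL x1 (E y) (hE x y hxy) (hid x)
  have l2 := hP x2 (y - E y) (hxy.sub (hE x y hxy)) hEx2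
  have b1 : E y - (z - c) • x1 = E w + c • E (x1 - Q x1) + c • E (x2 - Q x2) := by
    have q : Q x = Q x1 + Q x2 := by rw [← map_add, ← hx]
    simp only [hw, map_add, map_sub, map_smul, q, hEx2, ← hx1]
    rw [show E x1 = x1 from hid x]
    module
  have b2 : (y - E y) - z • x2 = (w - E w) + c • ((x1 - Q x1) - E (x1 - Q x1))
      - c • (Q x2 - E (Q x2)) := by
    have q : Q x = Q x1 + Q x2 := by rw [← map_add, ← hx]
    simp only [hw, map_add, map_sub, map_smul, q, ← hx1]
    rw [show E x1 = x1 from hid x, hx2, ← hx1]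
    module
  have n1 : ‖E y - (z - c) • x1‖ ≤ ‖w‖ + ε * ‖x1‖ + ε * ‖x2‖ := by
    rw [b1]
    refine (norm_add₃_le).trans ?_
    rw [norm_smul, norm_smul, hc, one_mul, one_mul]
    have := (proj_pyth hEsa hEidem w).1
    have := (proj_pyth hEsa hEidem (x1 - Q x1)).1
    have := hK x
    have := hKs x2
    linarith
  have n2 : ‖(y - E y) - z • x2‖ ≤ ‖w‖ + ε * ‖x1‖ + ‖x2‖ := by
    rw [b2]
    refine (norm_sub_le _ _).trans ?_
    refine (add_le_add_left (norm_add_le _ _) _).trans ?_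
    rw [norm_smul, norm_smul, hc, one_mul, one_mul]
    have := (proj_pyth hEsa hEidem w).2
    have := (proj_pyth hEsa hEidem (x1 - Q x1)).2
    have := (proj_pyth hEsa hEidem (Q x2)).2
    have := (proj_pyth hQsa hQidem x2).1
    have := hK x
    linarith
  have n3 : ‖x‖ ≤ ‖x1‖ + ‖x2‖ := by
    conv_lhs => rw [hx]
    exact norm_add_le _ _
  have p1 := mul_nonneg hε0 (norm_nonneg x1)
  have p2 := mul_nonneg hε0 (norm_nonneg x2)
  nlinarith [mul_le_mul_of_nonneg_left n3 hη.le]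

lemma final_inv {T : H →ₗ.[ℂ] H} {R Q : H →L[ℂ] H} {a : ℝ} (hR : IsRes T a R)
    (hRsa : IsSelfAdjoint R) (hQsa : IsSelfAdjoint Q) (c z : ℂ) (κ : ℝ) (hκ : 0 < κ)
    (h1 : ∀ x y, Gr T x y → κ * ‖x‖ ≤ ‖y + c • Q x - z • x‖)
    (h2 : ∀ x y, Gr T x y →
      κ * ‖x‖ ≤ ‖y + (starRingEnd ℂ c) • Q x - (starRingEnd ℂ z) • x‖) :
    z ∈ pertResolventSet T (c • Q) := by
  set B : H →L[ℂ] H := ((a : ℂ) - z) • 1 + c • Q with hB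
  set M : H →L[ℂ] H := 1 + B * R with hM
  have hMR : ∀ v, M v = (v + (a : ℂ) • R v) + c • Q (R v) - z • R v := by
    intro v
    change v + (((a : ℂ) - z) • R v + c • Q (R v)) = _
    module
  have lowR : ∀ v, κ * ‖R v‖ ≤ ‖M v‖ := fun v => by
    rw [hMR]; exact h1 _ _ (hR.1 v)
  have low : ∀ v, ‖v‖ ≤ (1 + ‖B‖ / κ) * ‖M v‖ := by
    intro v
    have e : v = M v - B (R v) := by simp [hM]
    have k1 : ‖R v‖ ≤ ‖M v‖ / κ := by rw [le_div_iff₀ hκ, mul_comm]; exact lowR v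
    calc ‖v‖ = ‖M v - B (R v)‖ := by rw [← e]
      _ ≤ ‖M v‖ + ‖B (R v)‖ := norm_sub_le _ _
      _ ≤ ‖M v‖ + ‖B‖ * (‖M v‖ / κ) := by
        gcongr
        exact (B.le_opNorm _).trans (by gcongr)
      _ = _ := by ring
  have hanti : AntilipschitzWith (⟨1 + ‖B‖ / κ, by positivity⟩ : NNReal) M :=
    M.antilipschitz_of_bound low
  have hadj : star M = 1 + R * (((a : ℂ) - starRingEnd ℂ z) • 1 + (starRingEnd ℂ c) • Q) := by
    simp [hM, hB, star_add, star_mul, star_smul, hRsa.star_eq, hQsa.star_eq]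
  have hker : ∀ v, star M v = 0 → v = 0 := by
    intro v hv
    set u := ((a : ℂ) - starRingEnd ℂ z) • v + (starRingEnd ℂ c) • Q v with hu
    have e : R u = - v := by
      rw [hadj] at hv
      exact (neg_eq_of_add_eq_zero_right hv).symm
    have g := (hR.1 u).smul (-1)
    have k := h2 _ _ g
    rw [e] at k
    have z0 : ((-1 : ℂ) • (u + (a : ℂ) • (-v)) + (starRingEnd ℂ) c • Q ((-1 : ℂ) • (-v))
        - (starRingEnd ℂ) z • ((-1 : ℂ) • (-v))) = 0 := by
      simp only [hu, map_smul, map_neg]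
      module
    rw [z0, norm_zero] at k
    have : ‖(-1 : ℂ) • (-v)‖ = ‖v‖ := by simp
    rw [this] at k
    have : ‖v‖ ≤ 0 := by
      by_contra hcon
      push Not at hcon
      nlinarith [mul_pos hκ hcon]
    exact norm_le_zero_iff.mp this
  have hinj : M.ker = ⊥ := LinearMap.ker_eq_bot.mpr hanti.injective
  have hclosed : IsClosed (M.range : Set H) := by
    have := ContinuousLinearMap.closed_range_of_antilipschitz hanti
    rw [← this]
    exact Submodule.isClosed_topologicalClosure _
  have hsurj : M.range = ⊤ := by
    have : CompleteSpace M.range := hclosed.completeSpace_coe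
    rw [← Submodule.orthogonal_eq_bot_iff]
    rw [Submodule.eq_bot_iff]
    intro v hv
    apply hker
    have : ∀ u, (⟪star M v, u⟫ : ℂ) = 0 := by
      intro u
      have k := ContinuousLinearMap.adjoint_inner_left M u v
      rw [ContinuousLinearMap.star_eq_adjoint, k]
      exact (Submodule.mem_orthogonal' _ _).mp hv _ ⟨u, rfl⟩
    exact inner_self_eq_zero.mp (this _)
  set e := ContinuousLinearEquiv.ofBijective M hinj hsurj with he
  have he1 : ∀ v, M (e.symm v) = v := fun v =>
    ContinuousLinearEquiv.ofBijective_apply_symm_apply M hinj hsurj v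
  have he2 : ∀ v, e.symm (M v) = v := fun v =>
    ContinuousLinearEquiv.ofBijective_symm_apply_apply M hinj hsurj v
  refine ⟨R * (e.symm : H →L[ℂ] H), ?_, ?_⟩
  · intro y
    obtain ⟨hd, k⟩ := hR.1 (e.symm y)
    refine ⟨hd, ?_⟩
    have := hMR (e.symm y)
    rw [he1] at this
    rw [← k] at this
    exact this.symm
  · rintro ⟨x, hx⟩
    have k := hR.2 x _ ⟨hx, rfl⟩
    set v := T ⟨x, hx⟩ - (a : ℂ) • x with hv
    have : T ⟨x, hx⟩ + (c • Q) x - z • x = M v := by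
      rw [hMR, k, hv, smul_apply]; abel
    change R (e.symm (T ⟨x, hx⟩ + (c • Q) x - z • x)) = x
    rw [this, he2, k]

/-- **Corollary.** `U_ε(a,b) ⊆ ρ(T + iQ)`. -/
theorem stmt_12
    -- `T` is a semi-bounded self-adjoint operator
    (T : H →ₗ.[ℂ] H) (hsa : IsSelfAdjoint T)
    (hsemibdd : ∃ m : ℝ, ∀ u : T.domain, m * ‖(u : H)‖ ^ 2 ≤ (⟪(u : H), T u⟫ : ℂ).re)
    -- `a, b ∈ ρ(T)`, `Δ = [a,b]`, and `Δ ∩ σ(T) = {λ_1,…,λ_d} ⊆ σ_dis(T)`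
    (a b : ℝ) (hab : a < b)
    (ha : (a : ℂ) ∈ pmResolventSet T) (hb : (b : ℂ) ∈ pmResolventSet T)
    (d : ℕ) (lam : Fin d → ℝ)
    (hΔ : (fun x : ℝ => (x : ℂ)) '' Set.Icc a b ∩ pmSpectrum T
      = Set.range fun j => ((lam j : ℂ)))
    (hdis : ∀ j, ((lam j : ℂ)) ∈ pmDiscSpectrum T)
    -- the eigenvalues are repeated according to multiplicity
    (hmult : ∀ j, Module.finrank ℂ (pmEigenspace T ((lam j : ℂ)))
      = (Finset.univ.filter fun i => lam i = lam j).card)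
    -- `E = E(Δ)` is the spectral projection of `T` for `Δ`
    (E : H →L[ℂ] H) (hEsa : IsSelfAdjoint E) (hEidem : IsIdempotentElem E)
    (hErange : LinearMap.range E.toLinearMap = ⨆ j, pmEigenspace T ((lam j : ℂ)))
    -- `Q` is an orthogonal projection
    (Q : H →L[ℂ] H) (hQsa : IsSelfAdjoint Q) (hQidem : IsIdempotentElem Q)
    -- `ε = ‖(I - Q)E(Δ)‖`
    (ε : ℝ) (hε : ε = ‖(1 - Q) * E‖) :
    -- `U_ε(a,b)`, the part of `U(a,b)` exterior to the circles centred at `a`, `b` of radius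
    -- `1 + 2ε` and to the circles centred at `λ_j + i` of radius `3ε`, lies in `ρ(T + iQ)`
    ∀ z ∈ Uab a b lam, 1 + 2 * ε < dist z (a : ℂ) → 1 + 2 * ε < dist z (b : ℂ) →
      (∀ j, 3 * ε < dist z ((lam j : ℂ) + Complex.I)) →
      z ∈ pertResolventSet T (Complex.I • Q) := by
  obtain ⟨R, hR⟩ := exists_isRes ha
  have hRsa := hR.selfAdjoint hsa
  have hne : ∀ j, (lam j : ℂ) ≠ a := fun j h => (hdis j).1 (h ▸ ha)
  have hcomm := commute_of_range hR hRsa hEsa hEidem hne hErange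
  have hER : ∀ v, E (R v) = R (E v) := fun v =>
    (congrArg (fun A : H →L[ℂ] H => A v) hcomm.eq).symm
  have hEid : ∀ x, x ∈ LinearMap.range E.toLinearMap → E x = x := by
    rintro _ ⟨y, rfl⟩
    exact congrArg (fun A : H →L[ℂ] H => A y) hEidem.eq
  have hE : ∀ x y, Gr T x y → Gr T (E x) (E y) := by
    intro x y hxy
    have k := hR.2 x y hxy
    have g := hR.1 (E (y - (a : ℂ) • x))
    rw [← hER, k] at g
    simpa using g
  have hspec : ∀ s ∈ spectrum ℝ R, 1 < (b - a) * s → ∃ j, s = (lam j - a)⁻¹ := by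
    intro s hs h1
    have hba : 0 < b - a := sub_pos.mpr hab
    have hs0 : 0 < s := by
      by_contra hcon
      push Not at hcon
      nlinarith [mul_nonneg hba.le (neg_nonneg.mpr hcon)]
    have hsi : 0 < s⁻¹ := inv_pos.mpr hs0
    have hlt : s⁻¹ < b - a := by
      rw [inv_lt_iff_one_lt_mul₀ hs0]; linarith
    by_cases ht : ((a + s⁻¹ : ℝ) : ℂ) ∈ pmResolventSet T
    · exfalso
      obtain ⟨S, hS⟩ := exists_isRes ht
      have hta : ((a + s⁻¹ : ℝ) : ℂ) ≠ (a : ℂ) := by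
        intro h
        have := Complex.ofReal_injective h
        linarith
      have hu := hR.isUnit hta hS
      refine hs ?_
      have e : (((a + s⁻¹ : ℝ) : ℂ) - (a : ℂ))⁻¹ = (s : ℂ) := by
        push_cast
        simp
      rw [e] at hu
      rw [spectrum.mem_resolventSet_iff, Algebra.algebraMap_eq_smul_one]
      exact hu
    · have hmem : ((a + s⁻¹ : ℝ) : ℂ) ∈ (fun x : ℝ => (x : ℂ)) '' Set.Icc a b ∩ pmSpectrum T :=
        ⟨⟨a + s⁻¹, ⟨by linarith, by linarith⟩, rfl⟩, ht⟩
      rw [hΔ] at hmem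
      obtain ⟨j, hj⟩ := hmem
      have hj' : lam j = a + s⁻¹ := Complex.ofReal_injective hj
      exact ⟨j, by rw [hj']; simp⟩
  have hker : ∀ j y, R y = (((lam j - a)⁻¹ : ℝ) : ℂ) • y → E y = y := by
    intro j y hy
    apply hEid
    rw [hErange]
    refine Submodule.mem_iSup_of_mem j (hR.ker (hne j) ?_)
    rw [hy]; push_cast; rfl
  have hpos := key_pos R E hRsa hcomm (b - a) d (fun j => (lam j - a)⁻¹) hspec hker
  have hreal : ∀ x y, Gr T x y → (⟪y, x⟫ : ℂ).im = 0 := by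
    intro x y hxy
    have h := Gr.symm hsa hxy hxy
    rw [← inner_conj_symm x y] at h
    exact Complex.conj_eq_iff_im.mp h.symm
  have hP : ∀ x y, Gr T x y → E x = 0 → ∀ w : ℂ, a < w.re → w.re < b → ∀ D : ℝ,
      D ≤ dist w a → D ≤ dist w b → 0 ≤ D → D * ‖x‖ ≤ ‖y - w • x‖ := by
    intro x y hxy hx w haw hwb D hDa hDb hD
    refine perp_lower a b (hreal x y hxy) ?_ w haw hwb D hDa hDb hD
    have hEy : E y = 0 := by
      have g := hE x y hxy
      rw [hx] at g
      exact g.unique ⟨zero_mem _, T.map_zero⟩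
    have := hpos (y - (a : ℂ) • x) (by rw [map_sub, map_smul, hx, hEy]; simp)
    rwa [hR.2 x y hxy] at this
  have hε0 : 0 ≤ ε := hε ▸ norm_nonneg _
  intro z hz hza hzb hzl
  obtain ⟨haz, hzb', -⟩ := hz
  obtain ⟨η, hη, hηa, hηb, hηl⟩ : ∃ η > 0, 1 + 2 * ε + η ≤ dist z (a : ℂ) ∧
      1 + 2 * ε + η ≤ dist z (b : ℂ) ∧
      ∀ j, 3 * ε + η ≤ dist z ((lam j : ℂ) + Complex.I) := by
    have h3 : ∃ η > 0, ∀ j, 3 * ε + η ≤ dist z ((lam j : ℂ) + Complex.I) := by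
      rcases isEmpty_or_nonempty (Fin d) with he | he
      · exact ⟨1, one_pos, fun j => he.elim j⟩
      · obtain ⟨j0, hj0⟩ := Finite.exists_min fun j => dist z ((lam j : ℂ) + Complex.I)
        refine ⟨dist z ((lam j0 : ℂ) + Complex.I) - 3 * ε, sub_pos.mpr (hzl j0), fun j => ?_⟩
        have := hj0 j
        linarith
    obtain ⟨η, hη, hj⟩ := h3
    refine ⟨min η (min (dist z (a : ℂ) - (1 + 2 * ε)) (dist z (b : ℂ) - (1 + 2 * ε))),
      lt_min hη (lt_min (by linarith) (by linarith)), ?_, ?_, fun j => ?_⟩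
    · have := (min_le_right η (min (dist z (a : ℂ) - (1 + 2 * ε))
        (dist z (b : ℂ) - (1 + 2 * ε)))).trans (min_le_left _ _)
      linarith
    · have := (min_le_right η (min (dist z (a : ℂ) - (1 + 2 * ε))
        (dist z (b : ℂ) - (1 + 2 * ε)))).trans (min_le_right _ _)
      linarith
    · have := (min_le_left η (min (dist z (a : ℂ) - (1 + 2 * ε))
        (dist z (b : ℂ) - (1 + 2 * ε))))
      have := hj j
      linarith
  have low : ∀ c w : ℂ, ‖c‖ = 1 → a < w.re → w.re < b → 1 + 2 * ε + η ≤ dist w (a : ℂ) →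
      1 + 2 * ε + η ≤ dist w (b : ℂ) → (∀ j, 3 * ε + η ≤ ‖(lam j : ℂ) - (w - c)‖) →
      ∀ x y, Gr T x y → η / 2 * ‖x‖ ≤ ‖y + c • Q x - w • x‖ := by
    intro c w hc haw hwb hwa' hwb' hl x y hxy
    refine main_lower hEsa hEidem hQsa hQidem hE c w hc ε η hε ?_ ?_ hη hxy
    · intro x y hxy hx
      refine eig_lower hsa lam hxy ?_ (w - c) _ (by positivity) hl
      rw [← hErange]
      exact ⟨x, hx⟩
    · intro x y hxy hx
      exact hP x y hxy hx w haw hwb _ hwa' hwb' (by positivity)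
  have hl1 : ∀ j, 3 * ε + η ≤ ‖(lam j : ℂ) - (z - Complex.I)‖ := by
    intro j
    have := hηl j
    rw [dist_comm, Complex.dist_eq] at this
    rwa [show (lam j : ℂ) - (z - Complex.I) = (lam j : ℂ) + Complex.I - z by ring]
  have hconj : ∀ r : ℝ, dist (starRingEnd ℂ z) (r : ℂ) = dist z (r : ℂ) := by
    intro r
    rw [Complex.dist_eq, Complex.dist_eq, ← RCLike.norm_conj (z - r), map_sub, Complex.conj_ofReal]
  refine final_inv hR hRsa hQsa Complex.I z (η / 2) (by positivity) ?_ ?_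
  · exact low Complex.I z (by simp) haz hzb' hηa hηb hl1
  · refine low _ _ (by simp) (by simpa using haz) (by simpa using hzb') (by rwa [hconj])
      (by rwa [hconj]) fun j => ?_
    rw [← RCLike.norm_conj, map_sub, map_sub, Complex.conj_ofReal, Complex.conj_conj,
      Complex.conj_conj]
    exact hl1 j
end
end
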